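/- Let Ω ⊂ ℝ^N be a bounded domain of class C² and let g ∈ 𝒢₂. Let μ ∈ 𝔐_ρ(Ω) be a positive measure whose Green potential 𝔾_μ satisfies 𝔾_μ ∈ L^g_loc(Ω). Then μ is g-good, i.e. the boundary value problem −Δu + g∘u = μ in Ω, u = 0 on ∂Ω, has a weak solution. -/

import Mathlib

open MeasureTheory Metric Set Filter Topology ENNReal

noncomputable section

abbrev Euc (N : ℕ) := EuclideanSpace ℝ (Fin N)

variable {N : ℕ}

/-- Distance to the boundary of `Ω`. -/
def rho (Ω : Set (Euc N)) (x : Euc N) : ℝ := Metric.infDist x (frontier Ω)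

/-- A bounded domain of class `C²`: open, connected, bounded, and near every boundary
point `Ω` coincides with the sublevel set of a `C²` function with nonvanishing derivative. -/
def IsBoundedC2Domain (Ω : Set (Euc N)) : Prop :=
  IsOpen Ω ∧ IsConnected Ω ∧ Bornology.IsBounded Ω ∧
  ∀ x ∈ frontier Ω, ∃ f : Euc N → ℝ, ∃ U : Set (Euc N),
    U ∈ nhds x ∧ ContDiffOn ℝ 2 f U ∧ (∀ y ∈ U, fderiv ℝ f y ≠ 0) ∧
    Ω ∩ U = {y ∈ U | f y < 0}

/-- The Laplacian, as the trace of the second derivative. -/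
def lap (φ : Euc N → ℝ) (x : Euc N) : ℝ :=
  ∑ i : Fin N,
    iteratedFDeriv ℝ 2 φ x ![EuclideanSpace.single i 1, EuclideanSpace.single i 1]

/-- Test functions of class `C²(Ω̄)` vanishing on `∂Ω`. -/
def TestFun (Ω : Set (Euc N)) (φ : Euc N → ℝ) : Prop :=
  ContDiff ℝ 2 φ ∧ ∀ x ∈ frontier Ω, φ x = 0

/-- Smooth functions compactly supported in the open set `Ω`. -/
def CcInf (Ω : Set (Euc N)) (φ : Euc N → ℝ) : Prop :=
  ContDiff ℝ (⊤ : ℕ∞) φ ∧ HasCompactSupport φ ∧ tsupport φ ⊆ Ω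

/-- A positive Borel measure on `Ω` with `∫_Ω ρ dμ < ∞`. -/
def MemMrho (Ω : Set (Euc N)) (μ : Measure (Euc N)) : Prop :=
  μ Ωᶜ = 0 ∧ ∫⁻ x, ENNReal.ofReal (rho Ω x) ∂μ < ⊤

/-- A (signed) measure in `𝔐_ρ(Ω)`, given by its Jordan decomposition:
a mutually singular pair of positive measures, each carried by `Ω` and
with finite `ρ`-integral.  The total variation is `pos + neg`. -/
structure SignedRho (Ω : Set (Euc N)) where
  pos : Measure (Euc N)
  neg : Measure (Euc N)
  singular : MeasureTheory.Measure.MutuallySingular pos neg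
  pos_mem : MemMrho Ω pos
  neg_mem : MemMrho Ω neg

/-- `u` is a weak solution of `-Δu + g∘u = μ` in `Ω`, `u = 0` on `∂Ω`,
for the signed measure `μ = μp - μn`. -/
def IsWeakSol (Ω : Set (Euc N)) (g : ℝ → ℝ) (μp μn : Measure (Euc N))
    (u : Euc N → ℝ) : Prop :=
  IntegrableOn u Ω volume ∧
  IntegrableOn (fun x => g |u x| * rho Ω x) Ω volume ∧
  ∀ φ : Euc N → ℝ, TestFun Ω φ →
    Integrable φ μp ∧ Integrable φ μn ∧
    ∫ x in Ω, (-(u x) * lap φ x + g (u x) * φ x) =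
      (∫ x, φ x ∂μp) - ∫ x, φ x ∂μn

/-- `w = 𝔾_μ` is the Green potential of the (signed) measure `μ = μp - μn`. -/
def IsGreenPot (Ω : Set (Euc N)) (μp μn : Measure (Euc N)) (w : Euc N → ℝ) : Prop :=
  IntegrableOn w Ω volume ∧
  ∀ φ : Euc N → ℝ, TestFun Ω φ →
    Integrable φ μp ∧ Integrable φ μn ∧
    ∫ x in Ω, w x * (-(lap φ x)) = (∫ x, φ x ∂μp) - ∫ x, φ x ∂μn

/-- Membership in the Orlicz space `L^h(S)`. -/
def MemOrlicz (h : ℝ → ℝ) (S : Set (Euc N)) (f : Euc N → ℝ) : Prop :=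
  AEStronglyMeasurable f (volume.restrict S) ∧
  ∃ k : ℝ, 0 < k ∧ ∫⁻ x in S, ENNReal.ofReal (h (f x / k)) ∂volume ≤ 1

/-- Membership in `L^h_loc(Ω)`. -/
def MemOrliczLoc (h : ℝ → ℝ) (Ω : Set (Euc N)) (f : Euc N → ℝ) : Prop :=
  ∀ K : Set (Euc N), IsCompact K → K ⊆ Ω → MemOrlicz h K f

/-- The Luxemburg norm on `L^h(S)`, valued in `ℝ≥0∞` (`∞` if no admissible constant). -/
def orliczNorm (h : ℝ → ℝ) (S : Set (Euc N)) (f : Euc N → ℝ) : ℝ≥0∞ :=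
  sInf ((fun r : ℝ => ENNReal.ofReal r) ''
    {r : ℝ | 0 < r ∧ ∫⁻ x in S, ENNReal.ofReal (h (f x / r)) ∂volume ≤ 1})

/-- The norm of `W²L^h(S)`: the sum of the Luxemburg norms of all derivatives
of order at most 2. -/
def sobNorm2 (h : ℝ → ℝ) (S : Set (Euc N)) (φ : Euc N → ℝ) : ℝ≥0∞ :=
  orliczNorm h S φ
  + ∑ i : Fin N, orliczNorm h S (fun x => fderiv ℝ φ x (EuclideanSpace.single i 1))
  + ∑ i : Fin N, ∑ j : Fin N, orliczNorm h S
      (fun x => iteratedFDeriv ℝ 2 φ x ![EuclideanSpace.single i 1, EuclideanSpace.single j 1])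

/-- `h = |g|`. -/
def absFun (g : ℝ → ℝ) : ℝ → ℝ := fun t => |g t|

/-- The class `𝒢`: odd continuous monotone increasing `g` such that `h = |g|` is `C¹`,
strictly convex, `h'(0) = 0`, `h' > 0` on `(0,∞)` and `h'(t) → ∞` as `t → ∞`. -/
def MemG (g : ℝ → ℝ) : Prop :=
  Continuous g ∧ Monotone g ∧ (∀ t, g (-t) = - g t) ∧
  ContDiff ℝ 1 (absFun g) ∧ StrictConvexOn ℝ Set.univ (absFun g) ∧
  deriv (absFun g) 0 = 0 ∧ (∀ t > 0, 0 < deriv (absFun g) t) ∧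
  Tendsto (deriv (absFun g)) atTop atTop

/-- The `Δ₂` condition. -/
def DeltaTwo (h : ℝ → ℝ) : Prop :=
  ∃ C : ℝ, 0 < C ∧ ∀ a > (0:ℝ), ∀ b > (0:ℝ), h (a + b) ≤ C * (h a + h b)

/-- The conjugate function `h*(t) = ∫_0^t (h')⁻¹(s) ds`. -/
def conjFun (h : ℝ → ℝ) : ℝ → ℝ := fun t => ∫ s in (0:ℝ)..t, Function.invFun (deriv h) s

/-- The class `𝒢₂`: `g ∈ 𝒢` with `h = |g|` and `h*` satisfying the `Δ₂` condition. -/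
def MemG2 (g : ℝ → ℝ) : Prop :=
  MemG g ∧ DeltaTwo (absFun g) ∧ DeltaTwo (conjFun (absFun g))

/-- The capacity `C_{2,h*}(E)` (for compact `E ⊆ Ω`): the supremum of `ν(Ω)` over positive
measures `ν` concentrated on `E` whose Green potential exists and has `L^{h*}` norm `≤ 1`. -/
def capacity (Ω : Set (Euc N)) (hstar : ℝ → ℝ) (E : Set (Euc N)) : ℝ≥0∞ :=
  sSup {m : ℝ≥0∞ | ∃ ν : Measure (Euc N), ν (Ω \ E) = 0 ∧ ν Ωᶜ = 0 ∧
    (∃ w : Euc N → ℝ, IsGreenPot Ω ν 0 w ∧ orliczNorm hstar Ω w ≤ 1) ∧ m = ν Ω}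

/-- The signed measure `μ = μp - μn` belongs to `W^{-2}L^g(Ω)` (with `h = h*` as parameter):
`|∫ φ dμ| ≤ C ‖φ‖_{W²L^{h*}(Ω)}` for all test functions `φ ∈ C_c^∞(Ω)`. -/
def MemWneg2 (Ω : Set (Euc N)) (hstar : ℝ → ℝ) (μp μn : Measure (Euc N)) : Prop :=
  ∃ C : ℝ, 0 < C ∧ ∀ φ : Euc N → ℝ, CcInf Ω φ →
    Integrable φ μp ∧ Integrable φ μn ∧
    ENNReal.ofReal |(∫ x, φ x ∂μp) - ∫ x, φ x ∂μn| ≤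
      ENNReal.ofReal C * sobNorm2 hstar Ω φ

/-- Local membership in `W^{-2}L^g`: the bound holds on every `C²` subdomain
compactly contained in `Ω`. -/
def MemWneg2Loc (Ω : Set (Euc N)) (hstar : ℝ → ℝ) (μp μn : Measure (Euc N)) : Prop :=
  ∀ Ω' : Set (Euc N), IsBoundedC2Domain Ω' → closure Ω' ⊆ Ω → MemWneg2 Ω' hstar μp μn

/-- The Keller–Osserman condition: `∫_1^∞ (∫_0^s g)^{-1/2} ds < ∞`. -/
def KellerOsserman (g : ℝ → ℝ) : Prop :=
  IntegrableOn (fun s : ℝ => (∫ t in (0:ℝ)..s, g t) ^ (-(1:ℝ)/2)) (Set.Ici (1:ℝ)) volume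

/-- The subcriticality condition `∫_0^1 g(r^{2-N}) r^{N-1} dr < ∞`. -/
def Subcritical (g : ℝ → ℝ) (N : ℕ) : Prop :=
  IntegrableOn (fun r : ℝ => g (r ^ ((2:ℝ) - N)) * r ^ ((N:ℝ) - 1))
    (Set.Ioo (0:ℝ) 1) volume

/-- `μ ∈ 𝔅_∞(Ω)` with singular (compact) set `F`. -/
def MemBinfty (Ω : Set (Euc N)) (μ : Measure (Euc N)) (F : Set (Euc N)) : Prop :=
  IsCompact F ∧ F ⊆ Ω ∧ μ Ωᶜ = 0 ∧
  (∀ O : Set (Euc N), IsOpen O → F ⊆ O → μ (Ω \ closure O) < ⊤) ∧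
  ∀ A : Set (Euc N), MeasurableSet A → A ⊆ F → A.Nonempty → μ A = ⊤

/-- A generalized solution of `-Δu + g∘u = μ` in `Ω`, `u = 0` on `∂Ω`,
for `μ ∈ 𝔅_∞(Ω)` with singular set `F`. -/
def IsGenSol (Ω : Set (Euc N)) (g : ℝ → ℝ) (μ : Measure (Euc N)) (F : Set (Euc N))
    (u : Euc N → ℝ) : Prop :=
  (∀ O : Set (Euc N), IsOpen O → F ⊆ O →
    IntegrableOn u (Ω \ closure O) volume ∧
    IntegrableOn (fun x => g (u x)) (Ω \ closure O) volume) ∧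
  (∀ φ : Euc N → ℝ, TestFun Ω φ → tsupport φ ⊆ closure Ω \ F →
    Integrable φ μ ∧
    ∫ x in Ω, (-(u x) * lap φ x + g (u x) * φ x) = ∫ x, φ x ∂μ) ∧
  ∀ ν : Measure (Euc N), MemMrho Ω ν → ν Fᶜ = 0 →
    ∀ v : Euc N → ℝ, IsWeakSol Ω g ν 0 v →
      ∀ᵐ x ∂(volume.restrict (Ω \ F)), v x ≤ u x

/-- A nonnegative solution of the homogeneous equation `-Δu + g∘u = 0` in `Ω ∖ F`
vanishing on `∂Ω`. -/
def IsHomSol (Ω F : Set (Euc N)) (g : ℝ → ℝ) (U : Euc N → ℝ) : Prop :=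
  (∀ O : Set (Euc N), IsOpen O → F ⊆ O →
    IntegrableOn U (Ω \ closure O) volume ∧
    IntegrableOn (fun x => g (U x)) (Ω \ closure O) volume) ∧
  (∀ᵐ x ∂(volume.restrict (Ω \ F)), 0 ≤ U x) ∧
  ∀ φ : Euc N → ℝ, TestFun Ω φ → tsupport φ ⊆ closure Ω \ F →
    ∫ x in Ω, (-(U x) * lap φ x + g (U x) * φ x) = 0


/-! ### Calculus of gradients and Laplacians -/

lemma inner_gradient_eq (φ : Euc N → ℝ) (x v : Euc N) :
    inner ℝ (gradient φ x) v = fderiv ℝ φ x v := by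
  simp [gradient]

lemma gradient_apply_eq (φ : Euc N → ℝ) (x : Euc N) (i : Fin N) :
    gradient φ x i = fderiv ℝ φ x (EuclideanSpace.single i 1) := by
  rw [← inner_gradient_eq, EuclideanSpace.inner_single_right]; simp

lemma norm_gradient_eq (φ : Euc N → ℝ) (x : Euc N) : ‖gradient φ x‖ = ‖fderiv ℝ φ x‖ := by
  simp [gradient]

lemma inner_eq_sum (v w : Euc N) : inner ℝ v w = ∑ i, v i * w i := by
  simp [PiLp.inner_apply, mul_comm]

lemma continuous_gradient {φ : Euc N → ℝ} (hφ : ContDiff ℝ 1 φ) : Continuous (gradient φ) :=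
  (InnerProductSpace.toDual ℝ (Euc N)).symm.continuous.comp (hφ.continuous_fderiv one_ne_zero)

lemma lap_eq_sum {φ : Euc N → ℝ} (hφ : ContDiff ℝ 2 φ) (x : Euc N) :
    lap φ x = ∑ i, fderiv ℝ (fun y => fderiv ℝ φ y (EuclideanSpace.single i 1)) x
      (EuclideanSpace.single i 1) := by
  unfold lap
  refine Finset.sum_congr rfl fun i _ => ?_
  rw [iteratedFDeriv_two_apply]
  have h : DifferentiableAt ℝ (fderiv ℝ φ) x :=
    ((hφ.fderiv_right (m := 1) (by norm_num)).differentiable (by norm_num)) x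
  rw [fderiv_clm_apply h (differentiableAt_const _)]
  simp

lemma contDiff_fderiv_apply {φ : Euc N → ℝ} (hφ : ContDiff ℝ 2 φ) (v : Euc N) :
    ContDiff ℝ 1 (fun y => fderiv ℝ φ y v) :=
  (hφ.fderiv_right (m := 1) (by norm_num)).clm_apply contDiff_const

lemma continuous_lap {φ : Euc N → ℝ} (hφ : ContDiff ℝ 2 φ) : Continuous (lap φ) := by
  have : lap φ = fun x => ∑ i, fderiv ℝ (fun y => fderiv ℝ φ y (EuclideanSpace.single i 1)) x
      (EuclideanSpace.single i 1) := funext fun x => lap_eq_sum hφ x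
  rw [this]
  refine continuous_finsetSum _ fun i _ => ?_
  exact ((contDiff_fderiv_apply hφ _).continuous_fderiv one_ne_zero).clm_apply continuous_const

lemma fderiv_comp_real {F F' : ℝ → ℝ} (hF : ∀ t, HasDerivAt F (F' t) t) {φ : Euc N → ℝ}
    {x : Euc N} (hφ : DifferentiableAt ℝ φ x) :
    fderiv ℝ (fun y => F (φ y)) x = F' (φ x) • fderiv ℝ φ x :=
  ((hF (φ x)).comp_hasFDerivAt x hφ.hasFDerivAt).fderiv

lemma gradient_comp_real {F F' : ℝ → ℝ} (hF : ∀ t, HasDerivAt F (F' t) t) {φ : Euc N → ℝ}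
    {x : Euc N} (hφ : DifferentiableAt ℝ φ x) :
    gradient (fun y => F (φ y)) x = F' (φ x) • gradient φ x := by
  simp only [gradient, fderiv_comp_real hF hφ, map_smul]

lemma lap_comp_real {F F' F'' : ℝ → ℝ} (hF : ∀ t, HasDerivAt F (F' t) t)
    (hF' : ∀ t, HasDerivAt F' (F'' t) t) (hFc : ContDiff ℝ 2 F) {φ : Euc N → ℝ}
    (hφ : ContDiff ℝ 2 φ) (x : Euc N) :
    lap (fun y => F (φ y)) x = F'' (φ x) * ‖gradient φ x‖ ^ 2 + F' (φ x) * lap φ x := by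
  have hd : Differentiable ℝ φ := hφ.differentiable (by norm_num)
  rw [lap_eq_sum (φ := fun y => F (φ y)) (hFc.comp hφ), lap_eq_sum hφ, ← real_inner_self_eq_norm_sq, inner_eq_sum,
    Finset.mul_sum, Finset.mul_sum, ← Finset.sum_add_distrib]
  refine Finset.sum_congr rfl fun i _ => ?_
  have h1 : (fun y => fderiv ℝ (fun y => F (φ y)) y (EuclideanSpace.single i 1)) =
      fun y => F' (φ y) * fderiv ℝ φ y (EuclideanSpace.single i 1) := by
    funext y; rw [fderiv_comp_real hF (hd y)]; simp
  rw [h1]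
  have h2 : DifferentiableAt ℝ (fun y => fderiv ℝ φ y (EuclideanSpace.single i 1)) x :=
    (contDiff_fderiv_apply hφ _).differentiable (by norm_num) x
  have h3 : DifferentiableAt ℝ (fun y => F' (φ y)) x :=
    ((hF' (φ x)).comp_hasFDerivAt x (hd x).hasFDerivAt).differentiableAt
  rw [fderiv_fun_mul h3 h2, fderiv_comp_real hF' (hd x), gradient_apply_eq]
  simp
  ring

lemma lap_fun_mul {φ ψ : Euc N → ℝ} (hφ : ContDiff ℝ 2 φ) (hψ : ContDiff ℝ 2 ψ) (x : Euc N) :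
    lap (fun y => φ y * ψ y) x =
      φ x * lap ψ x + 2 * inner ℝ (gradient φ x) (gradient ψ x) + ψ x * lap φ x := by
  have hd : Differentiable ℝ φ := hφ.differentiable (by norm_num)
  have hd' : Differentiable ℝ ψ := hψ.differentiable (by norm_num)
  rw [lap_eq_sum (hφ.mul hψ), lap_eq_sum hφ, lap_eq_sum hψ, inner_eq_sum, Finset.mul_sum,
    Finset.mul_sum, Finset.mul_sum, ← Finset.sum_add_distrib, ← Finset.sum_add_distrib]
  refine Finset.sum_congr rfl fun i _ => ?_
  have h1 : (fun y => fderiv ℝ (fun y => φ y * ψ y) y (EuclideanSpace.single i 1)) =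
      fun y => φ y * fderiv ℝ ψ y (EuclideanSpace.single i 1)
        + ψ y * fderiv ℝ φ y (EuclideanSpace.single i 1) := by
    funext y; rw [fderiv_fun_mul (hd y) (hd' y)]; simp
  rw [h1]
  have h2 : DifferentiableAt ℝ (fun y => fderiv ℝ φ y (EuclideanSpace.single i 1)) x :=
    (contDiff_fderiv_apply hφ _).differentiable (by norm_num) x
  have h3 : DifferentiableAt ℝ (fun y => fderiv ℝ ψ y (EuclideanSpace.single i 1)) x :=
    (contDiff_fderiv_apply hψ _).differentiable (by norm_num) x
  rw [fderiv_fun_add ((hd x).fun_mul h3) ((hd' x).fun_mul h2), fderiv_fun_mul (hd x) h3,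
    fderiv_fun_mul (hd' x) h2, gradient_apply_eq, gradient_apply_eq]
  simp
  ring

lemma fderiv_sub_normSq (c : ℝ) (p x : Euc N) :
    fderiv ℝ (fun y : Euc N => c - ‖y - p‖ ^ 2) x = -(2 : ℝ) • innerSL ℝ (x - p) := by
  have h := ((hasFDerivAt_id x).sub_const p).norm_sq.const_sub c
  simp only [id] at h
  rw [HasFDerivAt.fderiv h]
  ext v; simp

lemma gradient_sub_normSq (c : ℝ) (p x : Euc N) :
    gradient (fun y : Euc N => c - ‖y - p‖ ^ 2) x = -(2 : ℝ) • (x - p) := by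
  refine ext_inner_right ℝ fun v => ?_
  rw [inner_gradient_eq, fderiv_sub_normSq]; simp [inner_smul_left, inner_sub_left]

lemma contDiff_sub_normSq (c : ℝ) (p : Euc N) {n : WithTop ℕ∞} :
    ContDiff ℝ n (fun y : Euc N => c - ‖y - p‖ ^ 2) :=
  contDiff_const.sub ((contDiff_id.sub contDiff_const).norm_sq ℝ)

lemma lap_sub_normSq (c : ℝ) (p x : Euc N) :
    lap (fun y : Euc N => c - ‖y - p‖ ^ 2) x = -(2 * N) := by
  rw [lap_eq_sum (contDiff_sub_normSq c p)]
  have : ∀ i : Fin N, fderiv ℝ (fun y => fderiv ℝ (fun y : Euc N => c - ‖y - p‖ ^ 2) y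
      (EuclideanSpace.single i 1)) x (EuclideanSpace.single i 1) = -2 := by
    intro i
    have h1 : (fun y => fderiv ℝ (fun y : Euc N => c - ‖y - p‖ ^ 2) y
        (EuclideanSpace.single i 1)) = fun y => -2 * inner ℝ (y - p) (EuclideanSpace.single i 1) := by
      funext y; rw [fderiv_sub_normSq]; simp [inner_sub_left]
    rw [h1]
    have h2 := ((((hasFDerivAt_id x).sub_const p).inner ℝ
      (hasFDerivAt_const (EuclideanSpace.single i (1 : ℝ)) x)).const_mul (-2))
    simp only [id] at h2
    rw [h2.fderiv]
    simp
  simp [this]; ring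

/-! ### Powers of the positive part -/

lemma hasDerivAt_posPart_pow (n : ℕ) (t : ℝ) :
    HasDerivAt (fun t : ℝ => (max t 0) ^ (n + 2)) ((n + 2) * (max t 0) ^ (n + 1)) t := by
  rcases lt_trichotomy t 0 with h | h | h
  · have : (fun t : ℝ => (max t 0) ^ (n + 2)) =ᶠ[𝓝 t] fun _ => 0 := by
      filter_upwards [gt_mem_nhds h] with s hs
      simp [max_eq_right hs.le]
    rw [max_eq_right h.le]
    simpa using (hasDerivAt_const t (0 : ℝ)).congr_of_eventuallyEq this
  · subst h
    rw [hasDerivAt_iff_isLittleO_nhds_zero]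
    simp only [zero_add, max_self, ne_eq, Nat.add_eq_zero_iff, OfNat.ofNat_ne_zero, and_false,
      not_false_eq_true, zero_pow, sub_zero, one_ne_zero, mul_zero, smul_eq_mul]
    have h1 : (fun h : ℝ => max h 0 ^ (n + 2)) =O[𝓝 0] fun h : ℝ => h ^ (n + 2) := by
      refine Asymptotics.isBigO_of_le _ fun s => ?_
      rw [norm_pow, norm_pow]
      refine pow_le_pow_left₀ (norm_nonneg _) ?_ _
      rw [Real.norm_eq_abs, Real.norm_eq_abs, abs_of_nonneg (le_max_right _ _)]
      exact max_le (le_abs_self _) (abs_nonneg _)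
    refine h1.trans_isLittleO ?_
    have := Asymptotics.isLittleO_pow_pow (𝕜 := ℝ) (show 1 < n + 2 by omega)
    simpa using this
  · have : (fun t : ℝ => (max t 0) ^ (n + 2)) =ᶠ[𝓝 t] fun t => t ^ (n + 2) := by
      filter_upwards [lt_mem_nhds h] with s hs
      simp [max_eq_left hs.le]
    rw [max_eq_left h.le]
    simpa using (hasDerivAt_pow (n + 2) t).congr_of_eventuallyEq this

lemma contDiff_posPart_pow (n : ℕ) : ContDiff ℝ (n + 1 : ℕ) (fun t : ℝ => (max t 0) ^ (n + 2)) := by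
  induction n with
  | zero =>
    rw [show ((0 + 1 : ℕ) : WithTop ℕ∞) = 1 by simp, contDiff_one_iff_deriv]
    refine ⟨fun t => (hasDerivAt_posPart_pow 0 t).differentiableAt, ?_⟩
    rw [show deriv (fun t : ℝ => (max t 0) ^ (0 + 2)) = _ from
      funext fun t => (hasDerivAt_posPart_pow 0 t).deriv]
    fun_prop
  | succ n ih =>
    rw [show ((n + 1 + 1 : ℕ) : WithTop ℕ∞) = (n + 1 : ℕ) + 1 by push_cast; rfl,
      contDiff_succ_iff_deriv]
    refine ⟨fun t => (hasDerivAt_posPart_pow _ t).differentiableAt, by simp, ?_⟩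
    rw [show deriv (fun t : ℝ => (max t 0) ^ (n + 1 + 2)) = _ from
      funext fun t => (hasDerivAt_posPart_pow _ t).deriv]
    exact contDiff_const.mul ih

/-! ### Strongly monotone maps on a Hilbert space -/

lemma exists_zero_of_stronglyMonotone {X : Type*} [NormedAddCommGroup X] [InnerProductSpace ℝ X]
    [CompleteSpace X] (A : X → X) {L c : ℝ} (hc : 0 < c)
    (hL : ∀ x y, ‖A x - A y‖ ≤ L * ‖x - y‖)
    (hm : ∀ x y, c * ‖x - y‖ ^ 2 ≤ inner ℝ (A x - A y) (x - y)) : ∃ x, A x = 0 := by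
  set M : ℝ := max (max L c) 1 with hM
  have hM1 : 1 ≤ M := le_max_right _ _
  have hMc : c ≤ M := (le_max_right _ _).trans (le_max_left _ _)
  have hLM : L ≤ M := (le_max_left _ _).trans (le_max_left _ _)
  have hM0 : 0 < M := by linarith
  set τ : ℝ := c / M ^ 2 with hτ
  have hτ0 : 0 < τ := by positivity
  set q : ℝ := 1 - c ^ 2 / M ^ 2 with hq
  have hq1 : q < 1 := by rw [hq]; have : 0 < c ^ 2 / M ^ 2 := by positivity
                         linarith
  have hq0 : 0 ≤ q := by
    rw [hq, sub_nonneg, div_le_one (by positivity)]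
    exact pow_le_pow_left₀ hc.le hMc 2
  have key : ∀ x y, ‖(x - τ • A x) - (y - τ • A y)‖ ≤ Real.sqrt q * ‖x - y‖ := by
    intro x y
    rw [← Real.sqrt_sq (norm_nonneg (x - y)), ← Real.sqrt_mul hq0]
    apply Real.le_sqrt_of_sq_le
    have e : (x - τ • A x) - (y - τ • A y) = (x - y) - τ • (A x - A y) := by
      rw [smul_sub]; abel
    rw [e, norm_sub_sq_real, inner_smul_right, norm_smul, real_inner_comm, mul_pow,
      Real.norm_of_nonneg hτ0.le]
    have h1 := hm x y
    have h2 : ‖A x - A y‖ ^ 2 ≤ M ^ 2 * ‖x - y‖ ^ 2 := by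
      rw [← mul_pow]
      exact pow_le_pow_left₀ (norm_nonneg _)
        ((hL x y).trans (mul_le_mul_of_nonneg_right hLM (norm_nonneg _))) 2
    have h3 : τ ^ 2 * ‖A x - A y‖ ^ 2 ≤ τ ^ 2 * (M ^ 2 * ‖x - y‖ ^ 2) :=
      mul_le_mul_of_nonneg_left h2 (sq_nonneg _)
    have h4 : τ * (c * ‖x - y‖ ^ 2) ≤ τ * inner ℝ (A x - A y) (x - y) :=
      mul_le_mul_of_nonneg_left h1 hτ0.le
    have h5 : q * ‖x - y‖ ^ 2 = ‖x - y‖ ^ 2 - 2 * (τ * (c * ‖x - y‖ ^ 2))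
        + τ ^ 2 * (M ^ 2 * ‖x - y‖ ^ 2) := by
      rw [hq, hτ]; field_simp; ring
    linarith
  have hcon : ContractingWith (Real.toNNReal (Real.sqrt q)) fun x => x - τ • A x := by
    refine ⟨?_, LipschitzWith.of_dist_le_mul fun x y => ?_⟩
    · rw [← NNReal.coe_lt_coe, Real.coe_toNNReal _ (Real.sqrt_nonneg _), NNReal.coe_one,
        Real.sqrt_lt' one_pos]
      simpa using hq1
    · rw [dist_eq_norm, dist_eq_norm, Real.coe_toNNReal _ (Real.sqrt_nonneg _)]
      exact key x y
  refine ⟨ContractingWith.fixedPoint _ hcon, ?_⟩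
  have h := hcon.fixedPoint_isFixedPt
  have h' : τ • A (ContractingWith.fixedPoint _ hcon) = 0 := by
    have := h.eq
    simpa [sub_eq_self] using this
  exact (smul_eq_zero.1 h').resolve_left hτ0.ne'

/-! ### Convergence of `L²` pairings -/

lemma memLp_two_integrable_inner {α E : Type*} {m : MeasurableSpace α} {ν : Measure α}
    [NormedAddCommGroup E] [InnerProductSpace ℝ E] {f g : α → E} (hf : MemLp f 2 ν)
    (hg : MemLp g 2 ν) : Integrable (fun x => (inner ℝ (f x) (g x) : ℝ)) ν := by
  refine (L2.integrable_inner (𝕜 := ℝ) (hf.toLp f) (hg.toLp g)).congr ?_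
  filter_upwards [hf.coeFn_toLp, hg.coeFn_toLp] with x h1 h2
  rw [h1, h2]

lemma inner_toLp_eq {α E : Type*} {m : MeasurableSpace α} {ν : Measure α}
    [NormedAddCommGroup E] [InnerProductSpace ℝ E] {f g : α → E} (hf : MemLp f 2 ν)
    (hg : MemLp g 2 ν) :
    (inner ℝ (hf.toLp f) (hg.toLp g) : ℝ) = ∫ x, inner ℝ (f x) (g x) ∂ν := by
  rw [L2.inner_def]
  refine integral_congr_ae ?_
  filter_upwards [hf.coeFn_toLp, hg.coeFn_toLp] with x h1 h2
  rw [h1, h2]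

lemma tendsto_integral_inner_of_eLpNorm {α E : Type*} {m : MeasurableSpace α} {ν : Measure α}
    [NormedAddCommGroup E] [InnerProductSpace ℝ E] {f g : ℕ → α → E} {f₀ g₀ : α → E}
    (hf : ∀ n, MemLp (f n) 2 ν) (hf₀ : MemLp f₀ 2 ν) (hg : ∀ n, MemLp (g n) 2 ν)
    (hg₀ : MemLp g₀ 2 ν) (hfl : Tendsto (fun n => eLpNorm (f n - f₀) 2 ν) atTop (𝓝 0))
    (hgl : Tendsto (fun n => eLpNorm (g n - g₀) 2 ν) atTop (𝓝 0)) :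
    Tendsto (fun n => ∫ x, (inner ℝ (f n x) (g n x) : ℝ) ∂ν) atTop
      (𝓝 (∫ x, inner ℝ (f₀ x) (g₀ x) ∂ν)) := by
  have h1 := (Lp.tendsto_Lp_iff_tendsto_eLpNorm'' f hf f₀ hf₀).2 hfl
  have h2 := (Lp.tendsto_Lp_iff_tendsto_eLpNorm'' g hg g₀ hg₀).2 hgl
  have h3 := h1.inner (𝕜 := ℝ) h2
  simpa only [inner_toLp_eq] using h3

lemma tendsto_integral_inner_left {α E : Type*} {m : MeasurableSpace α} {ν : Measure α}
    [NormedAddCommGroup E] [InnerProductSpace ℝ E] {f : ℕ → α → E} {f₀ g₀ : α → E}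
    (hf : ∀ n, MemLp (f n) 2 ν) (hf₀ : MemLp f₀ 2 ν)
    (hg₀ : MemLp g₀ 2 ν) (hfl : Tendsto (fun n => eLpNorm (f n - f₀) 2 ν) atTop (𝓝 0)) :
    Tendsto (fun n => ∫ x, (inner ℝ (f n x) (g₀ x) : ℝ) ∂ν) atTop
      (𝓝 (∫ x, inner ℝ (f₀ x) (g₀ x) ∂ν)) :=
  tendsto_integral_inner_of_eLpNorm hf hf₀ (fun _ => hg₀) hg₀ hfl (by simp)

/-! ### The space `H¹₀(Ω)` -/

/-- `C¹` functions with compact support in `Ω`. -/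
structure IsCore (Ω : Set (Euc N)) (a : Euc N → ℝ) : Prop where
  contDiff : ContDiff ℝ 1 a
  hasCompactSupport : HasCompactSupport a
  subset : tsupport a ⊆ Ω

/-- `v` belongs to `H¹₀(Ω)` (extended by zero) and `V` is its weak gradient. -/
def MemH (Ω : Set (Euc N)) (v : Euc N → ℝ) (V : Euc N → Euc N) : Prop :=
  MemLp v 2 volume ∧ MemLp V 2 volume ∧ ∃ a : ℕ → Euc N → ℝ, (∀ n, IsCore Ω (a n)) ∧
    Tendsto (fun n => eLpNorm (a n - v) 2 volume) atTop (𝓝 0) ∧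
    Tendsto (fun n => eLpNorm (gradient (a n) - V) 2 volume) atTop (𝓝 0)

namespace IsCore

variable {Ω : Set (Euc N)} {a b : Euc N → ℝ}

lemma hasCompactSupport_gradient (h : IsCore Ω a) : HasCompactSupport (gradient a) :=
  (h.hasCompactSupport.fderiv ℝ).comp_left (g := (InnerProductSpace.toDual ℝ (Euc N)).symm)
    (map_zero _)

lemma gradient_eq_zero (h : IsCore Ω a) {x : Euc N} (hx : x ∉ Ω) : gradient a x = 0 := by
  have : fderiv ℝ a x = 0 := fderiv_of_notMem_tsupport ℝ fun h' => hx (h.subset h')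
  simp [gradient, this]

lemma eq_zero (h : IsCore Ω a) {x : Euc N} (hx : x ∉ Ω) : a x = 0 :=
  image_eq_zero_of_notMem_tsupport fun h' => hx (h.subset h')

lemma continuous (h : IsCore Ω a) : Continuous a := h.contDiff.continuous

lemma differentiable (h : IsCore Ω a) : Differentiable ℝ a :=
  h.contDiff.differentiable one_ne_zero

lemma continuous_gradient (h : IsCore Ω a) : Continuous (gradient a) :=
  _root_.continuous_gradient h.contDiff

lemma memLp (h : IsCore Ω a) {p : ℝ≥0∞} : MemLp a p volume :=
  h.continuous.memLp_of_hasCompactSupport h.hasCompactSupport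

lemma memLp_gradient (h : IsCore Ω a) {p : ℝ≥0∞} : MemLp (gradient a) p volume :=
  h.continuous_gradient.memLp_of_hasCompactSupport h.hasCompactSupport_gradient

lemma zero : IsCore Ω (0 : Euc N → ℝ) :=
  ⟨contDiff_const, HasCompactSupport.zero, by simp [tsupport]⟩

lemma add (h : IsCore Ω a) (h' : IsCore Ω b) : IsCore Ω (a + b) :=
  ⟨h.contDiff.add h'.contDiff, h.hasCompactSupport.add h'.hasCompactSupport,
    (tsupport_add a b).trans (union_subset h.subset h'.subset)⟩

lemma const_smul (h : IsCore Ω a) (c : ℝ) : IsCore Ω (c • a) :=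
  ⟨h.contDiff.const_smul c, h.hasCompactSupport.smul_left (f := fun _ => c),
    (tsupport_smul_subset_right (fun _ => c) a).trans h.subset⟩

lemma gradient_add (h : IsCore Ω a) (h' : IsCore Ω b) :
    gradient (a + b) = gradient a + gradient b := by
  funext x
  simp [gradient, fderiv_add (h.differentiable x) (h'.differentiable x)]

lemma gradient_const_smul (h : IsCore Ω a) (c : ℝ) : gradient (c • a) = c • gradient a := by
  funext x
  simp [gradient, fderiv_const_smul (h.differentiable x)]

lemma comp_real (h : IsCore Ω a) {θ θ' : ℝ → ℝ} (hθ : ∀ t, HasDerivAt θ (θ' t) t)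
    (hc : Continuous θ') (h0 : θ 0 = 0) : IsCore Ω (fun x => θ (a x)) := by
  have hC : ContDiff ℝ 1 θ := by
    rw [contDiff_one_iff_deriv]
    refine ⟨fun t => (hθ t).differentiableAt, ?_⟩
    rwa [show deriv θ = θ' from funext fun t => (hθ t).deriv]
  exact ⟨hC.comp h.contDiff, h.hasCompactSupport.comp_left h0,
    (closure_mono (fun x hx => by
      rw [Function.mem_support] at hx ⊢; intro h'; exact hx (by simp [h', h0]))).trans h.subset⟩

/-- Integration by parts. -/
lemma integral_inner_gradient (h : IsCore Ω a) {φ : Euc N → ℝ} (hφ : ContDiff ℝ 2 φ) :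
    ∫ x, (inner ℝ (gradient a x) (gradient φ x) : ℝ) = ∫ x, a x * -(lap φ x) := by
  have hi : ∀ i : Fin N, ∫ x, a x * fderiv ℝ (fun y => fderiv ℝ φ y (EuclideanSpace.single i 1)) x
      (EuclideanSpace.single i 1) = - ∫ x, fderiv ℝ a x (EuclideanSpace.single i 1) *
        fderiv ℝ φ x (EuclideanSpace.single i 1) := by
    intro i
    have c1 := (contDiff_fderiv_apply hφ (EuclideanSpace.single i 1))
    have c2 : Continuous fun x => fderiv ℝ a x (EuclideanSpace.single i 1) :=
      (h.contDiff.continuous_fderiv one_ne_zero).clm_apply continuous_const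
    have c3 : HasCompactSupport fun x => fderiv ℝ a x (EuclideanSpace.single i 1) :=
      h.hasCompactSupport.fderiv_apply ℝ _
    have c4 : Continuous fun x => fderiv ℝ (fun y => fderiv ℝ φ y (EuclideanSpace.single i 1)) x
      (EuclideanSpace.single i 1) :=
      (c1.continuous_fderiv one_ne_zero).clm_apply continuous_const
    refine integral_mul_fderiv_eq_neg_fderiv_mul_of_integrable ?_ ?_ ?_
      (fun x _ => h.differentiable x) (fun x _ => c1.differentiable one_ne_zero x)
    · exact (c2.mul c1.continuous).integrable_of_hasCompactSupport c3.mul_right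
    · exact (h.continuous.mul c4).integrable_of_hasCompactSupport h.hasCompactSupport.mul_right
    · exact (h.continuous.mul c1.continuous).integrable_of_hasCompactSupport
        h.hasCompactSupport.mul_right
  have e1 : ∀ x, (inner ℝ (gradient a x) (gradient φ x) : ℝ) = ∑ i : Fin N,
      fderiv ℝ a x (EuclideanSpace.single i 1) * fderiv ℝ φ x (EuclideanSpace.single i 1) := by
    intro x
    rw [inner_eq_sum]; simp_rw [gradient_apply_eq]
  have e2 : ∀ x, a x * -(lap φ x) = ∑ i : Fin N, -(a x *
      fderiv ℝ (fun y => fderiv ℝ φ y (EuclideanSpace.single i 1)) x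
      (EuclideanSpace.single i 1)) := by
    intro x
    rw [lap_eq_sum hφ, Finset.sum_neg_distrib, ← Finset.mul_sum]; ring
  simp_rw [e1, e2]
  rw [integral_finsetSum, integral_finsetSum]
  · refine Finset.sum_congr rfl fun i _ => ?_
    rw [integral_neg, hi, neg_neg]
  · intro i _
    refine (Continuous.integrable_of_hasCompactSupport ?_ h.hasCompactSupport.mul_right).neg
    exact h.continuous.mul
      (((contDiff_fderiv_apply hφ _).continuous_fderiv one_ne_zero).clm_apply continuous_const)
  · intro i _
    refine Continuous.integrable_of_hasCompactSupport ?_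
      (HasCompactSupport.mul_right (h.hasCompactSupport.fderiv_apply ℝ _))
    exact ((h.contDiff.continuous_fderiv one_ne_zero).clm_apply continuous_const).mul
      (contDiff_fderiv_apply hφ _).continuous

/-- Poincaré inequality. -/
lemma poincare (h : IsCore Ω a) {R : ℝ} (hR : ∀ x ∈ Ω, ‖x‖ ≤ R) (i : Fin N) :
    ∫ x, a x ^ 2 ≤ 4 * R ^ 2 * ∫ x, ‖gradient a x‖ ^ 2 := by
  set e : Euc N := EuclideanSpace.single i 1 with he
  have hne : ‖e‖ = 1 := by simp [he]
  have hgr : ∀ x, fderiv ℝ a x e = inner ℝ (gradient a x) e := fun x =>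
    (inner_gradient_eq a x e).symm
  have cd : Continuous fun x => fderiv ℝ a x e :=
      (h.contDiff.continuous_fderiv one_ne_zero).clm_apply continuous_const
  have hci : Continuous fun x : Euc N => (inner ℝ e x : ℝ) := by fun_prop
  have hsq : ∀ x, fderiv ℝ (fun x => a x ^ 2) x e = 2 * a x * fderiv ℝ a x e := by
    intro x
    rw [((h.differentiable x).hasFDerivAt.pow 2).fderiv]
    simp
  have hin : ∀ x : Euc N, fderiv ℝ (fun x : Euc N => (inner ℝ e x : ℝ)) x e = 1 := by
    intro x
    have : (fun x : Euc N => (inner ℝ e x : ℝ)) = innerSL ℝ e := rfl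
    rw [this, ContinuousLinearMap.fderiv]
    simp [hne]
  have hs2 : HasCompactSupport fun x => a x ^ 2 :=
    h.hasCompactSupport.comp_left (g := fun t : ℝ => t ^ 2) (by simp)
  have ibp : ∫ x, a x ^ 2 * fderiv ℝ (fun x : Euc N => (inner ℝ e x : ℝ)) x e =
      - ∫ x, fderiv ℝ (fun x => a x ^ 2) x e * inner ℝ e x := by
    refine integral_mul_fderiv_eq_neg_fderiv_mul_of_integrable ?_ ?_ ?_
      (fun x _ => (h.differentiable x).pow 2)
      (fun x _ => (innerSL ℝ e).differentiableAt)
    · simp_rw [hsq]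
      refine Continuous.integrable_of_hasCompactSupport (((continuous_const.mul
        h.continuous).mul cd).mul hci) ?_
      exact ((h.hasCompactSupport.mul_left).mul_right).mul_right
    · simp_rw [hin, mul_one]
      exact (h.continuous.pow 2).integrable_of_hasCompactSupport hs2
    · exact ((h.continuous.pow 2).mul hci).integrable_of_hasCompactSupport hs2.mul_right
  simp_rw [hin, hsq, mul_one] at ibp
  have i1 : Integrable fun x => a x ^ 2 :=
    (h.continuous.pow 2).integrable_of_hasCompactSupport hs2
  have i2 : Integrable fun x => ‖gradient a x‖ ^ 2 := by
    refine Continuous.integrable_of_hasCompactSupport (h.continuous_gradient.norm.pow 2) ?_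
    exact h.hasCompactSupport_gradient.comp_left (g := fun t : Euc N => ‖t‖ ^ 2) (by simp)
  have hb : ∫ x, a x ^ 2 ≤ ∫ x, (a x ^ 2 / 2 + 2 * R ^ 2 * ‖gradient a x‖ ^ 2) := by
    rw [ibp, ← integral_neg]
    refine integral_mono ?_ ((i1.div_const 2).add (i2.const_mul _)) ?_
    · refine (Continuous.integrable_of_hasCompactSupport (((continuous_const.mul
        h.continuous).mul cd).mul hci) ?_).neg
      exact ((h.hasCompactSupport.mul_left).mul_right).mul_right
    · intro x
      by_cases hx : x ∈ Ω
      · have h1 : |fderiv ℝ a x e| ≤ ‖gradient a x‖ := by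
          rw [hgr]; simpa [hne] using abs_real_inner_le_norm (gradient a x) e
        have h2 : |(inner ℝ e x : ℝ)| ≤ R := by
          have := abs_real_inner_le_norm e x
          rw [hne, one_mul] at this
          exact this.trans (hR x hx)
        have h3 : |fderiv ℝ a x e * inner ℝ e x| ≤ ‖gradient a x‖ * R := by
          rw [abs_mul]; exact mul_le_mul h1 h2 (abs_nonneg _) (norm_nonneg _)
        have h4 : (fderiv ℝ a x e * inner ℝ e x) ^ 2 ≤ (‖gradient a x‖ * R) ^ 2 :=
          sq_le_sq' (abs_le.1 h3).1 (abs_le.1 h3).2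
        show -(2 * a x * fderiv ℝ a x e * inner ℝ e x) ≤ _
        nlinarith [sq_nonneg (a x + 2 * (fderiv ℝ a x e * inner ℝ e x))]
      · have : fderiv ℝ a x e = 0 := by rw [hgr, h.gradient_eq_zero hx]; simp
        simp only [this]
        simp [h.eq_zero hx, h.gradient_eq_zero hx]
  rw [integral_add (i1.div_const 2) (i2.const_mul _), integral_div, integral_const_mul] at hb
  linarith

end IsCore

lemma exists_subseq_ae_of_eLpNorm {α E : Type*} {m : MeasurableSpace α} {ν : Measure α}
    [NormedAddCommGroup E] {f : ℕ → α → E} {f₀ : α → E}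
    (hf : ∀ n, MemLp (f n) 2 ν) (hf₀ : MemLp f₀ 2 ν)
    (h : Tendsto (fun n => eLpNorm (f n - f₀) 2 ν) atTop (𝓝 0)) :
    ∃ ns : ℕ → ℕ, StrictMono ns ∧
      ∀ᵐ x ∂ν, Tendsto (fun i => f (ns i) x) atTop (𝓝 (f₀ x)) :=
  (tendstoInMeasure_of_tendsto_eLpNorm two_ne_zero (fun n => (hf n).1) hf₀.1 h).exists_seq_tendsto_ae

/-- The ambient Hilbert space for pairs (function, weak gradient). -/
abbrev PairSpace (N : ℕ) :=
  WithLp 2 (Lp ℝ 2 (volume : Measure (Euc N)) × Lp (Euc N) 2 (volume : Measure (Euc N)))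

/-- The graph of the gradient on `C¹` functions with compact support in `Ω`. -/
def coreGraph (Ω : Set (Euc N)) : Submodule ℝ (PairSpace N) where
  carrier := {p | ∃ a, IsCore Ω a ∧ p.fst =ᵐ[volume] a ∧ p.snd =ᵐ[volume] gradient a}
  add_mem' := by
    rintro p q ⟨a, ha, h1, h2⟩ ⟨b, hb, h3, h4⟩
    refine ⟨a + b, ha.add hb, ?_, ?_⟩
    · rw [WithLp.add_fst]
      exact (Lp.coeFn_add _ _).trans (h1.add h3)
    · rw [WithLp.add_snd, ha.gradient_add hb]
      exact (Lp.coeFn_add _ _).trans (h2.add h4)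
  zero_mem' := by
    refine ⟨0, IsCore.zero, ?_, ?_⟩
    · rw [WithLp.zero_fst]; exact Lp.coeFn_zero _ _ _
    · rw [WithLp.zero_snd]
      refine (Lp.coeFn_zero _ _ _).trans (Eventually.of_forall fun x => ?_)
      simp [gradient]
  smul_mem' := by
    rintro c p ⟨a, ha, h1, h2⟩
    refine ⟨c • a, ha.const_smul c, ?_, ?_⟩
    · rw [WithLp.smul_fst]
      exact (Lp.coeFn_smul _ _).trans (h1.const_smul c)
    · rw [WithLp.smul_snd, ha.gradient_const_smul]
      exact (Lp.coeFn_smul _ _).trans (h2.const_smul c)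

/-- `H¹₀(Ω)` as a closed subspace of pairs. -/
def graphClosure (Ω : Set (Euc N)) : Submodule ℝ (PairSpace N) := (coreGraph Ω).topologicalClosure

instance (Ω : Set (Euc N)) : CompleteSpace (graphClosure Ω) :=
  (Submodule.isClosed_topologicalClosure _).completeSpace_coe

lemma MemH.congr {Ω : Set (Euc N)} {v v' : Euc N → ℝ} {V V' : Euc N → Euc N} (h : MemH Ω v V)
    (hv : v =ᵐ[volume] v') (hV : V =ᵐ[volume] V') : MemH Ω v' V' := by
  obtain ⟨h1, h2, a, ha, h3, h4⟩ := h
  refine ⟨(memLp_congr_ae hv).1 h1, (memLp_congr_ae hV).1 h2, a, ha, ?_, ?_⟩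
  · simpa only [eLpNorm_congr_ae ((EventuallyEq.refl _ (a _)).sub hv)] using h3
  · simpa only [eLpNorm_congr_ae ((EventuallyEq.refl _ (gradient (a _))).sub hV)] using h4

lemma mem_graphClosure_iff {Ω : Set (Euc N)} {p : PairSpace N} :
    p ∈ graphClosure Ω ↔ MemH Ω p.fst p.snd := by
  rw [graphClosure, ← SetLike.mem_coe, Submodule.topologicalClosure_coe, mem_closure_iff_seq_limit]
  constructor
  · rintro ⟨x, hx, hl⟩
    choose a ha h1 h2 using hx
    refine ⟨Lp.memLp _, Lp.memLp _, a, ha, ?_, ?_⟩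
    · have := (Lp.tendsto_Lp_iff_tendsto_eLpNorm' _ _).1
        (((WithLp.continuous_fst 2 _ _).tendsto p).comp hl)
      refine this.congr fun n => eLpNorm_congr_ae ((h1 n).sub (EventuallyEq.refl _ _))
    · have := (Lp.tendsto_Lp_iff_tendsto_eLpNorm' _ _).1
        (((WithLp.continuous_snd 2 _ _).tendsto p).comp hl)
      refine this.congr fun n => eLpNorm_congr_ae ((h2 n).sub (EventuallyEq.refl _ _))
  · rintro ⟨-, -, a, ha, h1, h2⟩
    refine ⟨fun n => WithLp.toLp 2 ((ha n).memLp.toLp (a n), (ha n).memLp_gradient.toLp _),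
      fun n => ⟨a n, ha n, (ha n).memLp.coeFn_toLp, (ha n).memLp_gradient.coeFn_toLp⟩, ?_⟩
    have e1 : Tendsto (fun n => (ha n).memLp.toLp (a n)) atTop (𝓝 p.fst) := by
      rw [Lp.tendsto_Lp_iff_tendsto_eLpNorm']
      refine h1.congr fun n => eLpNorm_congr_ae ?_
      exact (MemLp.coeFn_toLp _).symm.sub (EventuallyEq.refl _ _)
    have e2 : Tendsto (fun n => (ha n).memLp_gradient.toLp (gradient (a n))) atTop
        (𝓝 p.snd) := by
      rw [Lp.tendsto_Lp_iff_tendsto_eLpNorm']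
      refine h2.congr fun n => eLpNorm_congr_ae ?_
      exact (MemLp.coeFn_toLp _).symm.sub (EventuallyEq.refl _ _)
    exact ((WithLp.prod_continuous_toLp 2 _ _).tendsto (p.fst, p.snd)).comp
      (e1.prodMk_nhds e2)

namespace MemH

variable {Ω : Set (Euc N)} {v v' : Euc N → ℝ} {V V' : Euc N → Euc N}

lemma mem_graphClosure (h : MemH Ω v V) :
    (WithLp.toLp 2 (h.1.toLp v, h.2.1.toLp V) : PairSpace N) ∈ graphClosure Ω :=
  mem_graphClosure_iff.2 (h.congr h.1.coeFn_toLp.symm h.2.1.coeFn_toLp.symm)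

lemma sub (h : MemH Ω v V) (h' : MemH Ω v' V') : MemH Ω (v - v') (V - V') := by
  have := mem_graphClosure_iff.1 ((graphClosure Ω).sub_mem h.mem_graphClosure h'.mem_graphClosure)
  refine this.congr ?_ ?_
  · exact (Lp.coeFn_sub _ _).trans (h.1.coeFn_toLp.sub h'.1.coeFn_toLp)
  · exact (Lp.coeFn_sub _ _).trans (h.2.1.coeFn_toLp.sub h'.2.1.coeFn_toLp)

lemma ae_eq_zero (h : MemH Ω v V) : ∀ᵐ x, x ∉ Ω → v x = 0 ∧ V x = 0 := by
  obtain ⟨h1, h2, a, ha, h3, h4⟩ := h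
  obtain ⟨ns, -, hns⟩ := exists_subseq_ae_of_eLpNorm (fun n => (ha n).memLp) h1 h3
  obtain ⟨ms, -, hms⟩ := exists_subseq_ae_of_eLpNorm (fun n => (ha n).memLp_gradient) h2 h4
  filter_upwards [hns, hms] with x hx hx' hxΩ
  simp only [(ha _).eq_zero hxΩ, (ha _).gradient_eq_zero hxΩ] at hx hx'
  exact ⟨tendsto_nhds_unique hx tendsto_const_nhds |>.symm ▸ rfl,
    tendsto_nhds_unique hx' tendsto_const_nhds |>.symm ▸ rfl⟩

lemma poincare (h : MemH Ω v V) {R : ℝ} (hR : ∀ x ∈ Ω, ‖x‖ ≤ R) (i : Fin N) :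
    ∫ x, v x ^ 2 ≤ 4 * R ^ 2 * ∫ x, ‖V x‖ ^ 2 := by
  obtain ⟨h1, h2, a, ha, h3, h4⟩ := h
  have e1 := tendsto_integral_inner_of_eLpNorm (fun n => (ha n).memLp) h1
    (fun n => (ha n).memLp) h1 h3 h3
  have e2 := tendsto_integral_inner_of_eLpNorm (fun n => (ha n).memLp_gradient) h2
    (fun n => (ha n).memLp_gradient) h2 h4 h4
  simp_rw [real_inner_self_eq_norm_sq, Real.norm_eq_abs, sq_abs] at e1
  simp_rw [real_inner_self_eq_norm_sq] at e2
  exact le_of_tendsto_of_tendsto' e1 (e2.const_mul _) fun n => (ha n).poincare hR i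

/-- The weak gradient pairing against `C²` functions. -/
lemma integral_inner_gradient (h : MemH Ω v V) (hΩ : IsOpen Ω) (hb : Bornology.IsBounded Ω)
    {φ : Euc N → ℝ} (hφ : ContDiff ℝ 2 φ) :
    ∫ x in Ω, (inner ℝ (V x) (gradient φ x) : ℝ) = ∫ x in Ω, v x * -(lap φ x) := by
  obtain ⟨h1, h2, a, ha, h3, h4⟩ := h
  have hK : IsCompact (closure Ω) := hb.isCompact_closure
  have m1 : MemLp (gradient φ) 2 (volume.restrict Ω) := by
    have : IsFiniteMeasure (volume.restrict Ω) := ⟨by simpa using hb.measure_lt_top⟩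
    have hc := continuous_gradient (hφ.of_le one_le_two)
    obtain ⟨C, hC⟩ := hK.exists_bound_of_continuousOn hc.continuousOn
    exact MemLp.of_bound hc.aestronglyMeasurable C
      ((ae_restrict_mem hΩ.measurableSet).mono fun x hx => hC x (subset_closure hx))
  have m2 : MemLp (fun x => -(lap φ x)) 2 (volume.restrict Ω) := by
    have : IsFiniteMeasure (volume.restrict Ω) := ⟨by simpa using hb.measure_lt_top⟩
    have hc := (continuous_lap hφ).neg
    obtain ⟨C, hC⟩ := hK.exists_bound_of_continuousOn hc.continuousOn
    exact MemLp.of_bound hc.aestronglyMeasurable C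
      ((ae_restrict_mem hΩ.measurableSet).mono fun x hx => hC x (subset_closure hx))
  have r3 : Tendsto (fun n => eLpNorm (a n - v) 2 (volume.restrict Ω)) atTop (𝓝 0) :=
    tendsto_of_tendsto_of_tendsto_of_le_of_le tendsto_const_nhds h3 (fun _ => zero_le)
      fun n => eLpNorm_mono_measure _ Measure.restrict_le_self
  have r4 : Tendsto (fun n => eLpNorm (gradient (a n) - V) 2 (volume.restrict Ω)) atTop (𝓝 0) :=
    tendsto_of_tendsto_of_tendsto_of_le_of_le tendsto_const_nhds h4 (fun _ => zero_le)
      fun n => eLpNorm_mono_measure _ Measure.restrict_le_self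
  have e1 := tendsto_integral_inner_left (fun n => ((ha n).memLp (p := 2)).restrict Ω)
    (h1.restrict Ω) m2 r3
  have e2 := tendsto_integral_inner_left (fun n => ((ha n).memLp_gradient (p := 2)).restrict Ω)
    (h2.restrict Ω) m1 r4
  have e3 : ∀ n, ∫ x in Ω, (inner ℝ (gradient (a n) x) (gradient φ x) : ℝ) =
      ∫ x in Ω, inner ℝ (a n x) (-(lap φ x)) := by
    intro n
    rw [setIntegral_eq_integral_of_forall_compl_eq_zero, (ha n).integral_inner_gradient hφ,
      setIntegral_eq_integral_of_forall_compl_eq_zero]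
    · refine integral_congr_ae (Eventually.of_forall fun x => ?_)
      simp [mul_comm]
    · intro x hx; simp [(ha n).eq_zero hx]
    · intro x hx; simp [(ha n).gradient_eq_zero hx]
  simp_rw [e3] at e2
  rw [tendsto_nhds_unique e2 e1]
  refine integral_congr_ae (Eventually.of_forall fun x => ?_)
  simp [mul_comm]

end MemH

/-- Solvability of `-Δv = G(x, v)` in `H¹₀(Ω)` for `G` Lipschitz and nonincreasing in `v`. -/
lemma exists_memH_solution {Ω : Set (Euc N)} {R : ℝ} (hR : ∀ x ∈ Ω, ‖x‖ ≤ R) (i : Fin N)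
    {G : Euc N → ℝ → ℝ} {L : ℝ}
    (hmeas : ∀ a : Euc N → ℝ, AEStronglyMeasurable a volume →
      AEStronglyMeasurable (fun x => G x (a x)) volume)
    (hlip : ∀ x s t, |G x s - G x t| ≤ L * |s - t|)
    (hanti : ∀ x, Antitone (G x)) (h0 : MemLp (fun x => G x 0) 2 volume) :
    ∃ v V, MemH Ω v V ∧ ∀ ψ Ψ, MemH Ω ψ Ψ →
      ∫ x, (inner ℝ (V x) (Ψ x) : ℝ) = ∫ x, G x (v x) * ψ x := by
  have hmem : ∀ a : Euc N → ℝ, MemLp a 2 volume → MemLp (fun x => G x (a x)) 2 volume := by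
    intro a ha
    have : MemLp (fun x => G x (a x) - G x 0) 2 volume := by
      refine ha.of_le_mul (c := L) ((hmeas a ha.1).sub h0.1) (Eventually.of_forall fun x => ?_)
      simpa using hlip x (a x) 0
    exact (memLp_congr_ae (Eventually.of_forall fun x => by simp)).1 (this.add h0)
  let F : Lp ℝ 2 (volume : Measure (Euc N)) → Lp ℝ 2 (volume : Measure (Euc N)) :=
    fun a => (hmem a (Lp.memLp a)).toLp _
  have hF : ∀ a, F a =ᵐ[volume] fun x => G x (a x) := fun a => MemLp.coeFn_toLp _
  have hFl : ∀ a b, ‖F a - F b‖ ≤ L * ‖a - b‖ := by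
    intro a b
    refine Lp.norm_le_mul_norm_of_ae_le_mul ?_
    filter_upwards [Lp.coeFn_sub (F a) (F b), hF a, hF b, Lp.coeFn_sub a b] with x e1 e2 e3 e4
    rw [e1, e4, Pi.sub_apply, Pi.sub_apply, e2, e3]
    exact hlip x _ _
  have hFm : ∀ a b, (inner ℝ (F a - F b) (a - b) : ℝ) ≤ 0 := by
    intro a b
    rw [L2.inner_def]
    refine integral_nonpos_of_ae ?_
    filter_upwards [Lp.coeFn_sub (F a) (F b), hF a, hF b, Lp.coeFn_sub a b] with x e1 e2 e3 e4
    rw [e1, e4, Pi.sub_apply, Pi.sub_apply, e2, e3]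
    simp only [RCLike.inner_apply, conj_trivial, Pi.zero_apply]
    rcases le_total (a x) (b x) with h | h
    · exact mul_nonpos_of_nonpos_of_nonneg (sub_nonpos.2 h) (sub_nonneg.2 (hanti x h))
    · exact mul_nonpos_of_nonneg_of_nonpos (sub_nonneg.2 h) (sub_nonpos.2 (hanti x h))
  let B : PairSpace N → PairSpace N := fun p => WithLp.toLp 2 (-F p.fst, p.snd)
  have hBsub : ∀ p q, B p - B q = WithLp.toLp 2 (-(F p.fst - F q.fst), p.snd - q.snd) := by
    intro p q
    have : -(F p.fst - F q.fst) = -F p.fst - -F q.fst := by abel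
    rw [this]; rfl
  let A : graphClosure Ω → graphClosure Ω := fun p =>
    (graphClosure Ω).orthogonalProjectionOnto (B p)
  have hpo : ∀ r : graphClosure Ω, ‖(r : PairSpace N).fst‖ ^ 2 ≤
      4 * R ^ 2 * ‖(r : PairSpace N).snd‖ ^ 2 := by
    intro r
    have := (mem_graphClosure_iff.1 r.2).poincare hR i
    rw [← real_inner_self_eq_norm_sq, ← real_inner_self_eq_norm_sq, L2.inner_def, L2.inner_def]
    simp_rw [real_inner_self_eq_norm_sq, Real.norm_eq_abs, sq_abs]
    exact this
  have hc : (0 : ℝ) < 1 / (1 + 4 * R ^ 2) := by positivity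
  obtain ⟨p, hp⟩ := exists_zero_of_stronglyMonotone A (L := max L 0 + 1) hc
    (by
      intro x y
      have e1 : A x - A y = (graphClosure Ω).orthogonalProjectionOnto (B x - B y) := by
        rw [map_sub]
      rw [e1]
      refine ((graphClosure Ω).norm_orthogonalProjectionOnto_apply_le _).trans ?_
      have n1 : ‖(x - y : PairSpace N).fst‖ ≤ ‖(x : PairSpace N) - y‖ := WithLp.norm_fst_le _ _
      have n2 : ‖(x - y : PairSpace N).snd‖ ≤ ‖(x : PairSpace N) - y‖ := WithLp.norm_snd_le _ _
      have n3 := hFl (x : PairSpace N).fst (y : PairSpace N).fst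
      have n4 : ‖x - y‖ = ‖(x : PairSpace N) - y‖ := rfl
      have n5 : ‖F (x : PairSpace N).fst - F (y : PairSpace N).fst‖ ≤
          max L 0 * ‖(x : PairSpace N) - y‖ :=
        n3.trans (mul_le_mul (le_max_left _ _) n1 (norm_nonneg _) (le_max_right _ _))
      rw [n4]
      refine le_of_sq_le_sq ?_ (by positivity)
      rw [WithLp.prod_norm_sq_eq_of_L2, hBsub]
      show ‖-(F (x : PairSpace N).fst - F (y : PairSpace N).fst)‖ ^ 2 +
        ‖(x - y : PairSpace N).snd‖ ^ 2 ≤ _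
      rw [norm_neg]
      have m0 : 0 ≤ max L 0 := le_max_right _ _
      have m1 := pow_le_pow_left₀ (norm_nonneg _) n5 2
      have m2 := pow_le_pow_left₀ (norm_nonneg _) n2 2
      nlinarith [mul_nonneg m0 (sq_nonneg ‖(x : PairSpace N) - y‖)])
    (by
      intro x y
      have e1 : A x - A y = (graphClosure Ω).orthogonalProjectionOnto (B x - B y) := by
        rw [map_sub]
      rw [e1, Submodule.inner_orthogonalProjectionOnto_eq_of_mem_right, hBsub,
        WithLp.prod_inner_apply]
      show _ ≤ (inner ℝ (-(F (x : PairSpace N).fst - F (y : PairSpace N).fst))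
        ((x : PairSpace N).fst - (y : PairSpace N).fst) : ℝ) +
        inner ℝ (x - y : PairSpace N).snd (x - y : PairSpace N).snd
      rw [inner_neg_left, real_inner_self_eq_norm_sq]
      have h1 := hFm (x : PairSpace N).fst (y : PairSpace N).fst
      have h2 := hpo (x - y)
      have h3 : ‖x - y‖ ^ 2 = ‖(x - y : PairSpace N).fst‖ ^ 2 +
        ‖(x - y : PairSpace N).snd‖ ^ 2 := WithLp.prod_norm_sq_eq_of_L2 _
      have h4 : (((x - y : graphClosure Ω) : PairSpace N)) = (x - y : PairSpace N) := rfl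
      rw [h4] at h2
      rw [h3, div_mul_eq_mul_div, one_mul, div_le_iff₀ (by positivity)]
      nlinarith [sq_nonneg R, mul_nonneg (sq_nonneg R) (neg_nonneg.2 h1)])
  refine ⟨(p : PairSpace N).fst, (p : PairSpace N).snd, mem_graphClosure_iff.1 p.2, ?_⟩
  intro ψ Ψ h
  have h1 : (inner ℝ (B p) (WithLp.toLp 2 (h.1.toLp ψ, h.2.1.toLp Ψ) : PairSpace N) : ℝ) = 0 := by
    have := Submodule.inner_orthogonalProjectionOnto_eq_of_mem_right
      (⟨_, h.mem_graphClosure⟩ : graphClosure Ω) (B p)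
    rw [← this]
    show inner ℝ (A p) _ = _
    rw [hp, inner_zero_left]
  rw [WithLp.prod_inner_apply] at h1
  change (inner ℝ (-F (p : PairSpace N).fst) (h.1.toLp ψ) : ℝ) +
    inner ℝ (p : PairSpace N).snd (h.2.1.toLp Ψ) = 0 at h1
  rw [inner_neg_left, L2.inner_def, L2.inner_def] at h1
  have e1 : ∫ x, (inner ℝ (F (p : PairSpace N).fst x) (h.1.toLp ψ x) : ℝ) =
      ∫ x, G x ((p : PairSpace N).fst x) * ψ x := by
    refine integral_congr_ae ?_
    filter_upwards [hF (p : PairSpace N).fst, h.1.coeFn_toLp] with x e1 e2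
    rw [e1, e2]; simp [mul_comm]
  have e2 : ∫ x, (inner ℝ ((p : PairSpace N).snd x) (h.2.1.toLp Ψ x) : ℝ) =
      ∫ x, inner ℝ ((p : PairSpace N).snd x) (Ψ x) := by
    refine integral_congr_ae ?_
    filter_upwards [h.2.1.coeFn_toLp] with x e2
    rw [e2]
  rw [e1, e2] at h1
  linarith

/-! ### Truncations -/

lemma tendsto_eLpNorm_two_zero_of_dominated {α E : Type*} {m : MeasurableSpace α} {ν : Measure α}
    [NormedAddCommGroup E] {f : ℕ → α → E} {b : α → ℝ}
    (hf : ∀ n, AEStronglyMeasurable (f n) ν) (hb : MemLp b 2 ν)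
    (hfb : ∀ n, ∀ᵐ x ∂ν, ‖f n x‖ ≤ b x)
    (hl : ∀ᵐ x ∂ν, Tendsto (fun n => f n x) atTop (𝓝 0)) :
    Tendsto (fun n => eLpNorm (f n) 2 ν) atTop (𝓝 0) := by
  have key : Tendsto (fun n => ∫⁻ x, ‖f n x‖ₑ ^ (2 : ℝ) ∂ν) atTop (𝓝 (∫⁻ _, 0 ∂ν)) := by
    refine tendsto_lintegral_of_dominated_convergence' (fun x => ‖b x‖ₑ ^ (2 : ℝ))
      (fun n => (hf n).enorm.pow_const _) (fun n => ?_) ?_ ?_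
    · filter_upwards [hfb n] with x hx
      refine ENNReal.rpow_le_rpow ?_ (by norm_num)
      rw [enorm_le_iff_norm_le]
      exact hx.trans (le_abs_self _)
    · have := lintegral_rpow_enorm_lt_top_of_eLpNorm_lt_top two_ne_zero ofNat_ne_top hb.2
      simpa using this.ne
    · filter_upwards [hl] with x hx
      have := (ENNReal.continuous_rpow_const (y := 2)).tendsto (0 : ℝ≥0∞)
      rw [ENNReal.zero_rpow_of_pos two_pos] at this
      refine this.comp ?_
      simpa using hx.enorm
  rw [lintegral_zero] at key
  have h2 := ((ENNReal.continuous_rpow_const (y := 1 / 2)).tendsto (0 : ℝ≥0∞)).comp key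
  rw [ENNReal.zero_rpow_of_pos (by norm_num)] at h2
  refine h2.congr fun n => ?_
  rw [eLpNorm_eq_lintegral_rpow_enorm_toReal two_ne_zero ofNat_ne_top]
  simp

lemma lipschitz_of_hasDerivAt {θ θ' : ℝ → ℝ} (hθ : ∀ t, HasDerivAt θ (θ' t) t)
    (hb : ∀ t, |θ' t| ≤ 1) (s t : ℝ) : |θ s - θ t| ≤ |s - t| := by
  have := convex_univ.norm_image_sub_le_of_norm_hasDerivWithin_le (𝕜 := ℝ) (f := θ) (f' := θ')
    (C := 1) (fun x _ => (hθ x).hasDerivWithinAt) (fun x _ => hb x) (mem_univ t) (mem_univ s)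
  simpa using this

lemma MemH.comp_real {Ω : Set (Euc N)} {v : Euc N → ℝ} {V : Euc N → Euc N} (h : MemH Ω v V)
    {θ θ' : ℝ → ℝ} (hθ : ∀ t, HasDerivAt θ (θ' t) t) (hc : Continuous θ') (h0 : θ 0 = 0)
    (hb : ∀ t, |θ' t| ≤ 1) : MemH Ω (fun x => θ (v x)) (fun x => θ' (v x) • V x) := by
  obtain ⟨h1, h2, a, ha, h3, h4⟩ := h
  obtain ⟨ns, hmono, hns⟩ := exists_subseq_ae_of_eLpNorm (fun n => (ha n).memLp) h1 h3
  have hθc : Continuous θ := continuous_iff_continuousAt.2 fun t => (hθ t).continuousAt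
  have hlip := lipschitz_of_hasDerivAt hθ hb
  have hg : ∀ n, gradient (fun x => θ (a (ns n) x)) =
      fun x => θ' (a (ns n) x) • gradient (a (ns n)) x := fun n =>
    funext fun x => gradient_comp_real hθ ((ha (ns n)).differentiable x)
  have hcore : ∀ n, IsCore Ω (fun x => θ (a (ns n) x)) := fun n => (ha _).comp_real hθ hc h0
  have m1 : MemLp (fun x => θ (v x)) 2 volume := by
    refine h1.of_le (hθc.comp_aestronglyMeasurable h1.1) (Eventually.of_forall fun x => ?_)
    simpa [h0] using hlip (v x) 0
  have m2 : MemLp (fun x => θ' (v x) • V x) 2 volume := by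
    refine h2.of_le ((hc.comp_aestronglyMeasurable h1.1).smul h2.1)
      (Eventually.of_forall fun x => ?_)
    rw [norm_smul]
    exact mul_le_of_le_one_left (norm_nonneg _) (hb _)
  refine ⟨m1, m2, _, hcore, ?_, ?_⟩
  · refine tendsto_of_tendsto_of_tendsto_of_le_of_le tendsto_const_nhds
      (h3.comp hmono.tendsto_atTop) (fun _ => zero_le) fun n => ?_
    exact eLpNorm_mono_ae (Eventually.of_forall fun x => hlip _ _)
  · have d1 : Tendsto (fun n => eLpNorm (fun x => (θ' (a (ns n) x) - θ' (v x)) • V x) 2 volume)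
        atTop (𝓝 0) := by
      refine tendsto_eLpNorm_two_zero_of_dominated (b := fun x => 2 * ‖V x‖) (fun n => ?_)
        (h2.norm.const_mul 2) (fun n => Eventually.of_forall fun x => ?_) ?_
      · exact ((hc.comp_aestronglyMeasurable (ha (ns n)).continuous.aestronglyMeasurable).sub
          (hc.comp_aestronglyMeasurable h1.1)).smul h2.1
      · rw [norm_smul]
        refine mul_le_mul_of_nonneg_right ?_ (norm_nonneg _)
        refine (norm_sub_le _ _).trans ?_
        have e1 := hb (a (ns n) x)
        have e2 := hb (v x)
        simp only [Real.norm_eq_abs]; linarith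
      · filter_upwards [hns] with x hx
        have := (((hc.tendsto _).comp hx).sub_const (θ' (v x))).smul_const (V x)
        simpa using this
    have d2 := (h4.comp hmono.tendsto_atTop).add d1
    rw [add_zero] at d2
    refine tendsto_of_tendsto_of_tendsto_of_le_of_le tendsto_const_nhds d2
      (fun _ => zero_le) fun n => ?_
    have hM : AEStronglyMeasurable (fun x => θ' (a (ns n) x) • (gradient (a (ns n)) x - V x))
        volume := (hc.comp_aestronglyMeasurable (ha (ns n)).continuous.aestronglyMeasurable).smul
          ((ha (ns n)).continuous_gradient.aestronglyMeasurable.sub h2.1)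
    have hM' : AEStronglyMeasurable (fun x => (θ' (a (ns n) x) - θ' (v x)) • V x) volume :=
      ((hc.comp_aestronglyMeasurable (ha (ns n)).continuous.aestronglyMeasurable).sub
          (hc.comp_aestronglyMeasurable h1.1)).smul h2.1
    have e : gradient (fun x => θ (a (ns n) x)) - (fun x => θ' (v x) • V x) =
        (fun x => θ' (a (ns n) x) • (gradient (a (ns n)) x - V x)) +
        (fun x => (θ' (a (ns n) x) - θ' (v x)) • V x) := by
      funext x
      simp only [hg n, Pi.sub_apply, Pi.add_apply, smul_sub, sub_smul]
      abel
    rw [e]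
    refine (eLpNorm_add_le hM hM' one_le_two).trans ?_
    gcongr
    refine eLpNorm_mono_ae (Eventually.of_forall fun x => ?_)
    rw [norm_smul]
    exact mul_le_of_le_one_left (norm_nonneg _) (hb _)

/-- A `C¹` approximation of the positive part. -/
def softPos (t : ℝ) : ℝ := √(1 + max t 0 ^ 2) - 1

/-- The derivative of `softPos`. -/
def softPos' (t : ℝ) : ℝ := max t 0 / √(1 + max t 0 ^ 2)

lemma hasDerivAt_softPos (t : ℝ) : HasDerivAt softPos (softPos' t) t := by
  have h := (((hasDerivAt_posPart_pow 0 t).const_add 1).sqrt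
    (by positivity : (1 : ℝ) + max t 0 ^ (0 + 2) ≠ 0)).sub_const 1
  refine h.congr_deriv ?_
  rw [softPos']
  push_cast
  simp only [zero_add, pow_one]
  rw [mul_div_mul_left _ _ two_ne_zero]

lemma continuous_softPos' : Continuous softPos' := by
  unfold softPos'
  exact (by fun_prop : Continuous fun t : ℝ => max t 0).div
    (by fun_prop) fun t => (Real.sqrt_pos.2 (by positivity)).ne'

lemma softPos'_nonneg (t : ℝ) : 0 ≤ softPos' t := by unfold softPos'; positivity

lemma softPos'_le_one (t : ℝ) : softPos' t ≤ 1 := by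
  unfold softPos'
  rw [div_le_one (Real.sqrt_pos.2 (by positivity))]
  exact Real.le_sqrt_of_sq_le (by linarith)

lemma softPos_of_nonpos {t : ℝ} (ht : t ≤ 0) : softPos t = 0 := by simp [softPos, ht]

lemma softPos'_of_nonpos {t : ℝ} (ht : t ≤ 0) : softPos' t = 0 := by simp [softPos', ht]

lemma softPos_nonneg (t : ℝ) : 0 ≤ softPos t := by
  rw [softPos, sub_nonneg]
  exact Real.le_sqrt_of_sq_le (by nlinarith [sq_nonneg (max t 0)])

lemma softPos_pos {t : ℝ} (ht : 0 < t) : 0 < softPos t := by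
  rw [softPos, sub_pos, max_eq_left ht.le]
  exact Real.lt_sqrt_of_sq_lt (by nlinarith)

lemma abs_softPos'_le (t : ℝ) : |softPos' t| ≤ 1 := by
  rw [abs_of_nonneg (softPos'_nonneg t)]; exact softPos'_le_one t

lemma abs_softPos_sub_le {t : ℝ} (ht : 0 ≤ t) : |softPos t - t| ≤ 1 := by
  have h1 : t ≤ √(1 + t ^ 2) := Real.le_sqrt_of_sq_le (by linarith)
  have h2 : √(1 + t ^ 2) ≤ 1 + t := Real.sqrt_le_left (by linarith) |>.2 (by nlinarith)
  rw [softPos, max_eq_left ht, abs_le]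
  constructor <;> linarith

lemma tendsto_softPos' : Tendsto softPos' atTop (𝓝 1) := by
  have h : Tendsto (fun t : ℝ => 1 - t⁻¹) atTop (𝓝 1) := by
    simpa using tendsto_inv_atTop_zero.const_sub (1 : ℝ)
  refine tendsto_of_tendsto_of_tendsto_of_le_of_le' h tendsto_const_nhds ?_
    (Eventually.of_forall softPos'_le_one)
  filter_upwards [eventually_gt_atTop 0] with t ht
  have h2 : √(1 + t ^ 2) ≤ 1 + t := Real.sqrt_le_left (by linarith) |>.2 (by nlinarith)
  rw [softPos', max_eq_left ht.le, le_div_iff₀ (Real.sqrt_pos.2 (by positivity))]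
  have h1 : t ≤ √(1 + t ^ 2) := Real.le_sqrt_of_sq_le (by linarith)
  have h3 : (1 - t⁻¹) * √(1 + t ^ 2) = √(1 + t ^ 2) - √(1 + t ^ 2) / t := by ring
  rw [h3]
  have : 1 ≤ √(1 + t ^ 2) / t := (one_le_div ht).2 h1
  linarith

/-- Weak comparison principle. -/
lemma MemH.ae_nonpos {Ω : Set (Euc N)} {a : Euc N → ℝ} {A : Euc N → Euc N} (h : MemH Ω a A)
    {R : ℝ} (hR : ∀ x ∈ Ω, ‖x‖ ≤ R) (i : Fin N) {F : Euc N → ℝ}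
    (heq : ∀ ψ Ψ, MemH Ω ψ Ψ → ∫ x, (inner ℝ (A x) (Ψ x) : ℝ) = ∫ x, F x * ψ x)
    (hF : ∀ᵐ x, 0 < a x → F x ≤ 0) : ∀ᵐ x, a x ≤ 0 := by
  have hψ := h.comp_real hasDerivAt_softPos continuous_softPos'
    (softPos_of_nonpos le_rfl) abs_softPos'_le
  have h1 := heq _ _ hψ
  have h2 : ∫ x, F x * softPos (a x) ≤ 0 := by
    refine integral_nonpos_of_ae ?_
    filter_upwards [hF] with x hx
    rcases le_or_gt (a x) 0 with h' | h'
    · simp [softPos_of_nonpos h']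
    · exact mul_nonpos_of_nonpos_of_nonneg (hx h') (softPos_nonneg _)
  have h3 : ∫ x, ‖softPos' (a x) • A x‖ ^ 2 ≤ ∫ x, (inner ℝ (A x) (softPos' (a x) • A x) : ℝ) := by
    refine integral_mono ?_ (memLp_two_integrable_inner h.2.1 hψ.2.1) fun x => ?_
    · have := memLp_two_integrable_inner hψ.2.1 hψ.2.1
      simpa only [real_inner_self_eq_norm_sq] using this
    · simp only
      rw [inner_smul_right, real_inner_self_eq_norm_sq, norm_smul, mul_pow,
        Real.norm_of_nonneg (softPos'_nonneg _)]
      have e1 := softPos'_nonneg (a x)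
      have e2 := softPos'_le_one (a x)
      nlinarith [mul_nonneg (mul_nonneg e1 (sub_nonneg.2 e2)) (sq_nonneg ‖A x‖)]
  have h4 := hψ.poincare hR i
  have h5 : ∫ x, softPos (a x) ^ 2 = 0 := by
    refine le_antisymm ?_ (integral_nonneg fun x => sq_nonneg _)
    nlinarith [mul_nonneg (by positivity : 0 ≤ 4 * R ^ 2) (neg_nonneg.2 (h3.trans (h1.trans_le h2)))]
  rw [integral_eq_zero_iff_of_nonneg (fun x => sq_nonneg _) hψ.1.integrable_sq] at h5
  filter_upwards [h5] with x hx
  by_contra hc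
  have := softPos_pos (not_le.1 hc)
  simp only [Pi.zero_apply] at hx
  nlinarith [this, pow_pos this 2]

/-! ### Test functions belong to `H¹₀` -/

/-- A `C¹` function vanishing on `[-1,1]` and at bounded distance from the identity. -/
def softTrunc (t : ℝ) : ℝ := softPos (t - 1) - softPos (-t - 1)

/-- The derivative of `softTrunc`. -/
def softTrunc' (t : ℝ) : ℝ := softPos' (t - 1) + softPos' (-t - 1)

lemma hasDerivAt_softTrunc (t : ℝ) : HasDerivAt softTrunc (softTrunc' t) t := by
  have h1 := (hasDerivAt_softPos (t - 1)).comp t ((hasDerivAt_id t).sub_const 1)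
  have h2 := (hasDerivAt_softPos (-t - 1)).comp t (((hasDerivAt_id t).neg).sub_const 1)
  refine (h1.sub h2).congr_deriv ?_
  simp [softTrunc']

lemma continuous_softTrunc' : Continuous softTrunc' :=
  (continuous_softPos'.comp (by fun_prop)).add (continuous_softPos'.comp (by fun_prop))

lemma abs_softTrunc'_le (t : ℝ) : |softTrunc' t| ≤ 1 := by
  rw [softTrunc', abs_of_nonneg (add_nonneg (softPos'_nonneg _) (softPos'_nonneg _))]
  rcases le_total t 0 with h | h
  · rw [softPos'_of_nonpos (by linarith), zero_add]; exact softPos'_le_one _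
  · rw [softPos'_of_nonpos (t := -t - 1) (by linarith), add_zero]; exact softPos'_le_one _

lemma softTrunc_eq_zero {t : ℝ} (h : |t| ≤ 1) : softTrunc t = 0 := by
  have := abs_le.1 h
  rw [softTrunc, softPos_of_nonpos (by linarith), softPos_of_nonpos (by linarith), sub_zero]

lemma abs_softTrunc_sub_le (t : ℝ) : |softTrunc t - t| ≤ 2 := by
  rcases le_total |t| 1 with h | h
  · rw [softTrunc_eq_zero h, zero_sub, abs_neg]; linarith
  · rw [softTrunc]
    rcases le_abs.1 h with h | h
    · rw [softPos_of_nonpos (t := -t - 1) (by linarith)]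
      have := abs_le.1 (abs_softPos_sub_le (t := t - 1) (by linarith))
      rw [abs_le]; constructor <;> linarith
    · rw [softPos_of_nonpos (t := t - 1) (by linarith)]
      have := abs_le.1 (abs_softPos_sub_le (t := -t - 1) (by linarith))
      rw [abs_le]; constructor <;> linarith

lemma tendsto_softTrunc'_mul {s : ℝ} (hs : s ≠ 0) :
    Tendsto (fun n : ℕ => softTrunc' (((n : ℝ) + 1) * s)) atTop (𝓝 1) := by
  have hn : Tendsto (fun n : ℕ => (n : ℝ) + 1) atTop atTop :=
    tendsto_natCast_atTop_atTop.atTop_add tendsto_const_nhds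
  have h : Tendsto (fun n : ℕ => softPos' (((n : ℝ) + 1) * |s| - 1)) atTop (𝓝 1) := by
    refine tendsto_softPos'.comp ?_
    exact tendsto_atTop_add_const_right _ _ (hn.atTop_mul_const (abs_pos.2 hs))
  refine h.congr fun n => ?_
  have hp : (0 : ℝ) < n + 1 := by positivity
  rw [softTrunc']
  rcases lt_or_gt_of_ne hs with h' | h'
  · rw [softPos'_of_nonpos (t := ((n : ℝ) + 1) * s - 1) (by nlinarith), zero_add, abs_of_neg h']
    ring_nf
  · rw [softPos'_of_nonpos (t := -(((n : ℝ) + 1) * s) - 1) (by nlinarith), add_zero,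
      abs_of_pos h']

lemma ae_fderiv_eq_zero_of_eq_zero (i : Fin N) {φ : Euc N → ℝ} (hφ : ContDiff ℝ 1 φ) :
    ∀ᵐ x, φ x = 0 → fderiv ℝ φ x = 0 := by
  set e : Euc N := EuclideanSpace.single i 1 with he
  have hne : ‖e‖ = 1 := by simp [he]
  set s : Set (Euc N) := {x | φ x = 0} with hs
  have hsm : MeasurableSet s := (isClosed_eq hφ.continuous continuous_const).measurableSet
  have hap : ApproximatesLinearOn (fun x => φ x • e) (0 : Euc N →L[ℝ] Euc N) s 0 := by
    intro x hx y hy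
    have hx' : φ x = 0 := hx
    have hy' : φ y = 0 := hy
    simp [hx', hy']
  have := hap.norm_fderiv_sub_le volume hsm (fun x => (fderiv ℝ φ x).smulRight e)
    fun x _ => ((hφ.differentiable one_ne_zero x).hasFDerivAt.smul_const e).hasFDerivWithinAt
  rw [ae_restrict_iff' hsm] at this
  filter_upwards [this] with x hx h0
  have h1 := hx h0
  rw [sub_zero] at h1
  have h2 : (fderiv ℝ φ x).smulRight e = 0 := by
    rw [← norm_le_zero_iff]; exact_mod_cast h1
  ext v
  have h3 := congrArg (fun L : Euc N →L[ℝ] Euc N => ‖L v‖) h2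
  simpa [norm_smul, hne] using h3

lemma TestFun.memH {Ω : Set (Euc N)} (hΩ : IsOpen Ω) (hb : Bornology.IsBounded Ω) (i : Fin N)
    {φ : Euc N → ℝ} (hφ : TestFun Ω φ) :
    MemH Ω (Ω.indicator φ) (Ω.indicator (gradient φ)) := by
  have hφ1 : ContDiff ℝ 1 φ := hφ.1.of_le one_le_two
  have hK : IsCompact (closure Ω) := hb.isCompact_closure
  have hfin : volume Ω < ⊤ := hb.measure_lt_top
  obtain ⟨C1, hC1⟩ := hK.exists_bound_of_continuousOn hφ1.continuous.continuousOn
  obtain ⟨C2, hC2⟩ := hK.exists_bound_of_continuousOn (continuous_gradient hφ1).continuousOn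
  have hbd : ∀ c : ℝ, MemLp (Ω.indicator fun _ => c) 2 (volume : Measure (Euc N)) := fun c =>
    memLp_indicator_const 2 hΩ.measurableSet c (Or.inr hfin.ne)
  have m1 : MemLp (Ω.indicator φ) 2 volume := by
    refine (hbd C1).of_le (hφ1.continuous.aestronglyMeasurable.indicator hΩ.measurableSet)
      (Eventually.of_forall fun x => ?_)
    by_cases hx : x ∈ Ω
    · simp only [indicator_of_mem hx]
      exact (hC1 x (subset_closure hx)).trans (le_abs_self _)
    · simp [indicator_of_notMem hx]
  have m2 : MemLp (Ω.indicator (gradient φ)) 2 volume := by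
    refine (hbd C2).of_le ((continuous_gradient hφ1).aestronglyMeasurable.indicator
      hΩ.measurableSet) (Eventually.of_forall fun x => ?_)
    by_cases hx : x ∈ Ω
    · simp only [indicator_of_mem hx]
      exact (hC2 x (subset_closure hx)).trans (le_abs_self _)
    · simp [indicator_of_notMem hx]
  let θ : ℕ → ℝ → ℝ := fun n t => ((n : ℝ) + 1)⁻¹ * softTrunc (((n : ℝ) + 1) * t)
  have hθ : ∀ n t, HasDerivAt (θ n) (softTrunc' (((n : ℝ) + 1) * t)) t := by
    intro n t
    have hp : ((n : ℝ) + 1) ≠ 0 := by positivity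
    have := ((hasDerivAt_softTrunc (((n : ℝ) + 1) * t)).comp t
      ((hasDerivAt_id t).const_mul ((n : ℝ) + 1))).const_mul ((n : ℝ) + 1)⁻¹
    refine this.congr_deriv ?_
    field_simp
  have hθc : ∀ n, ContDiff ℝ 1 (θ n) := by
    intro n
    rw [contDiff_one_iff_deriv]
    refine ⟨fun t => (hθ n t).differentiableAt, ?_⟩
    rw [show deriv (θ n) = _ from funext fun t => (hθ n t).deriv]
    exact continuous_softTrunc'.comp (by fun_prop)
  let K : ℕ → Set (Euc N) := fun n => closure Ω ∩ {x | ((n : ℝ) + 1)⁻¹ ≤ |φ x|}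
  have hKc : ∀ n, IsClosed (K n) := fun n =>
    isClosed_closure.inter (isClosed_le continuous_const hφ1.continuous.abs)
  have hKΩ : ∀ n, K n ⊆ Ω := by
    rintro n x ⟨hx, hx'⟩
    by_contra hxΩ
    have : φ x = 0 := hφ.2 x ⟨hx, by rwa [hΩ.interior_eq]⟩
    rw [mem_ofPred_eq, this, abs_zero] at hx'
    have : (0 : ℝ) < ((n : ℝ) + 1)⁻¹ := by positivity
    linarith
  have hzero : ∀ n x, x ∉ K n → Ω.indicator (fun y => θ n (φ y)) x = 0 := by
    intro n x hx
    by_cases hxΩ : x ∈ Ω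
    · rw [indicator_of_mem hxΩ]
      have : |φ x| < ((n : ℝ) + 1)⁻¹ := by
        by_contra hc
        exact hx ⟨subset_closure hxΩ, not_lt.1 hc⟩
      have hp : (0 : ℝ) < n + 1 := by positivity
      show _ * softTrunc _ = 0
      rw [softTrunc_eq_zero, mul_zero]
      rw [abs_mul, abs_of_pos hp]
      have := mul_lt_mul_of_pos_left this hp
      rw [mul_inv_cancel₀ hp.ne'] at this
      exact this.le
    · exact indicator_of_notMem hxΩ _
  have hsup : ∀ n, tsupport (Ω.indicator fun y => θ n (φ y)) ⊆ K n := fun n =>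
    closure_minimal (fun x hx => by_contra fun h => hx (hzero n x h)) (hKc n)
  have heqΩ : ∀ n, ∀ x ∈ Ω, (Ω.indicator fun y => θ n (φ y)) =ᶠ[𝓝 x] fun y => θ n (φ y) := by
    intro n x hx
    filter_upwards [hΩ.mem_nhds hx] with y hy
    exact indicator_of_mem hy _
  have hcore : ∀ n, IsCore Ω (Ω.indicator fun y => θ n (φ y)) := by
    intro n
    refine ⟨?_, ?_, (hsup n).trans (hKΩ n)⟩
    · rw [contDiff_iff_contDiffAt]
      intro x
      by_cases hx : x ∈ K n
      · exact (((hθc n).comp hφ1).contDiffAt).congr_of_eventuallyEq (heqΩ n x (hKΩ n hx))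
      · refine (contDiffAt_const (c := (0 : ℝ))).congr_of_eventuallyEq ?_
        filter_upwards [(hKc n).isOpen_compl.mem_nhds hx] with y hy
        exact hzero n y hy
    · exact hK.of_isClosed_subset (isClosed_tsupport _) ((hsup n).trans inter_subset_left)
  have hgr : ∀ n, gradient (Ω.indicator fun y => θ n (φ y)) =
      Ω.indicator fun x => softTrunc' (((n : ℝ) + 1) * φ x) • gradient φ x := by
    intro n
    funext x
    by_cases hx : x ∈ Ω
    · rw [indicator_of_mem hx, ← gradient_comp_real (hθ n)
        (hφ1.differentiable one_ne_zero x), gradient, gradient, (heqΩ n x hx).fderiv_eq]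
    · rw [indicator_of_notMem hx, (hcore n).gradient_eq_zero hx]
  have hinv : Tendsto (fun n : ℕ => 2 * ((n : ℝ) + 1)⁻¹) atTop (𝓝 0) := by
    have : Tendsto (fun n : ℕ => (n : ℝ) + 1) atTop atTop :=
      tendsto_natCast_atTop_atTop.atTop_add tendsto_const_nhds
    simpa using (tendsto_inv_atTop_zero.comp this).const_mul 2
  have hdiff : ∀ n t, |θ n t - t| ≤ 2 * ((n : ℝ) + 1)⁻¹ := by
    intro n t
    have hp : (0 : ℝ) < n + 1 := by positivity
    have h1 := abs_softTrunc_sub_le (((n : ℝ) + 1) * t)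
    have h2 : θ n t - t = ((n : ℝ) + 1)⁻¹ * (softTrunc (((n : ℝ) + 1) * t) - ((n : ℝ) + 1) * t) := by
      show _ * _ - t = _
      field_simp
    rw [h2, abs_mul, abs_of_pos (inv_pos.2 hp), mul_comm]
    exact mul_le_mul_of_nonneg_right h1 (inv_pos.2 hp).le
  refine ⟨m1, m2, _, hcore, ?_, ?_⟩
  · refine tendsto_eLpNorm_two_zero_of_dominated (b := Ω.indicator fun _ => 2)
      (fun n => ((hcore n).continuous.aestronglyMeasurable.sub m1.1)) (hbd 2)
      (fun n => Eventually.of_forall fun x => ?_) (Eventually.of_forall fun x => ?_)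
    · by_cases hx : x ∈ Ω
      · simp only [Pi.sub_apply, indicator_of_mem hx]
        refine (hdiff n _).trans ?_
        have : ((n : ℝ) + 1)⁻¹ ≤ 1 := inv_le_one_of_one_le₀ (by simp)
        linarith
      · simp [indicator_of_notMem hx]
    · by_cases hx : x ∈ Ω
      · simp only [Pi.sub_apply, indicator_of_mem hx]
        exact squeeze_zero_norm (fun n => hdiff n _) hinv
      · simp [indicator_of_notMem hx]
  · simp_rw [hgr]
    refine tendsto_eLpNorm_two_zero_of_dominated (b := Ω.indicator fun _ => 2 * C2)
      (fun n => ?_) (hbd _) (fun n => Eventually.of_forall fun x => ?_) ?_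
    · refine AEStronglyMeasurable.sub ?_ m2.1
      refine Continuous.aestronglyMeasurable ?_ |>.indicator hΩ.measurableSet
      exact (continuous_softTrunc'.comp (continuous_const.mul hφ1.continuous)).smul
        (continuous_gradient hφ1)
    · by_cases hx : x ∈ Ω
      · simp only [Pi.sub_apply, indicator_of_mem hx]
        refine (norm_sub_le _ _).trans ?_
        rw [norm_smul]
        have h1 := hC2 x (subset_closure hx)
        have h2 : ‖softTrunc' (((n : ℝ) + 1) * φ x)‖ * ‖gradient φ x‖ ≤ ‖gradient φ x‖ :=
          mul_le_of_le_one_left (norm_nonneg _) (abs_softTrunc'_le _)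
        linarith
      · simp [indicator_of_notMem hx]
    · filter_upwards [ae_fderiv_eq_zero_of_eq_zero i hφ1] with x hx0
      by_cases hx : x ∈ Ω
      · simp only [Pi.sub_apply, indicator_of_mem hx]
        by_cases h0 : φ x = 0
        · have : gradient φ x = 0 := by simp [gradient, hx0 h0]
          simp [this]
        · have := ((tendsto_softTrunc'_mul h0).smul_const (gradient φ x)).sub_const (gradient φ x)
          simpa using this
      · simp [indicator_of_notMem hx]

/-! ### A mollifier adapted to superharmonic functions -/

/-- The unnormalised mollifier. -/
def mollKer (t : ℝ) (y : Euc N) : ℝ := (t ^ (N + 6))⁻¹ * max (t ^ 2 - ‖y‖ ^ 2) 0 ^ 3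

/-- The time derivative of `mollKer`. -/
def mollKer' (t : ℝ) (y : Euc N) : ℝ :=
  (8 * t ^ (N + 7))⁻¹ * (48 * t ^ 2 * max (t ^ 2 - ‖y‖ ^ 2) 0 ^ 2 -
    8 * (N + 6) * max (t ^ 2 - ‖y‖ ^ 2) 0 ^ 3)

/-- The mollifier with unit mass. -/
def moll (t : ℝ) (y : Euc N) : ℝ := (∫ x : Euc N, mollKer 1 x)⁻¹ * mollKer t y

lemma continuous_mollKer (t : ℝ) : Continuous (mollKer (N := N) t) := by
  unfold mollKer; fun_prop

lemma continuous_mollKer' (t : ℝ) : Continuous (mollKer' (N := N) t) := by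
  unfold mollKer'; fun_prop

lemma continuous_moll (t : ℝ) : Continuous (moll (N := N) t) :=
  continuous_const.mul (continuous_mollKer t)

lemma mollKer_nonneg {t : ℝ} (ht : 0 ≤ t) (y : Euc N) : 0 ≤ mollKer t y := by
  unfold mollKer; positivity

lemma mollKer_eq_zero {t : ℝ} (ht : 0 ≤ t) {y : Euc N} (h : t ≤ ‖y‖) : mollKer t y = 0 := by
  have : t ^ 2 - ‖y‖ ^ 2 ≤ 0 := by nlinarith
  simp [mollKer, max_eq_right this]

lemma mollKer_le {t : ℝ} (ht : 0 < t) (y : Euc N) : mollKer t y ≤ (t ^ N)⁻¹ := by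
  have h1 : max (t ^ 2 - ‖y‖ ^ 2) 0 ≤ t ^ 2 :=
    max_le (by nlinarith [sq_nonneg ‖y‖]) (sq_nonneg t)
  have h2 : max (t ^ 2 - ‖y‖ ^ 2) 0 ^ 3 ≤ (t ^ 2) ^ 3 := pow_le_pow_left₀ (le_max_right _ _) h1 3
  calc mollKer t y ≤ (t ^ (N + 6))⁻¹ * (t ^ 2) ^ 3 :=
        mul_le_mul_of_nonneg_left h2 (by positivity)
    _ = (t ^ N)⁻¹ := by rw [pow_add]; field_simp

lemma hasCompactSupport_mollKer {t : ℝ} (ht : 0 ≤ t) : HasCompactSupport (mollKer (N := N) t) := by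
  refine HasCompactSupport.intro (isCompact_closedBall 0 t) fun y hy => mollKer_eq_zero ht ?_
  rw [mem_closedBall_zero_iff, not_le] at hy
  exact hy.le

lemma mollKer_mass_pos : 0 < ∫ x : Euc N, mollKer 1 x :=
  (continuous_mollKer 1).integral_pos_of_hasCompactSupport_nonneg_nonzero (x := 0)
    (hasCompactSupport_mollKer zero_le_one) (fun y => mollKer_nonneg zero_le_one y)
    (by simp [mollKer])

lemma integral_mollKer {t : ℝ} (ht : 0 < t) : ∫ x : Euc N, mollKer t x = ∫ x : Euc N, mollKer 1 x := by
  have h := Measure.integral_comp_smul volume (mollKer (N := N) t) t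
  have h2 : ∀ x : Euc N, mollKer t (t • x) = (t ^ N)⁻¹ * mollKer 1 x := by
    intro x
    have : t ^ 2 - ‖t • x‖ ^ 2 = t ^ 2 * (1 - ‖x‖ ^ 2) := by
      rw [norm_smul, Real.norm_of_nonneg ht.le]; ring
    have h3 : max (t ^ 2 - ‖t • x‖ ^ 2) 0 = t ^ 2 * max (1 - ‖x‖ ^ 2) 0 := by
      rw [this, mul_max_of_nonneg _ _ (sq_nonneg t), mul_zero]
    simp only [mollKer]
    rw [h3, pow_add, one_pow, one_pow]
    field_simp
  simp_rw [h2] at h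
  rw [integral_const_mul, finrank_euclideanSpace_fin, abs_of_pos (by positivity), smul_eq_mul] at h
  exact (mul_left_cancel₀ (by positivity) h).symm

lemma integral_moll {t : ℝ} (ht : 0 < t) : ∫ x : Euc N, moll t x = 1 := by
  unfold moll
  rw [integral_const_mul, integral_mollKer ht, inv_mul_cancel₀ mollKer_mass_pos.ne']

lemma moll_nonneg {t : ℝ} (ht : 0 ≤ t) (y : Euc N) : 0 ≤ moll t y :=
  mul_nonneg (inv_nonneg.2 mollKer_mass_pos.le) (mollKer_nonneg ht y)

lemma moll_eq_zero {t : ℝ} (ht : 0 ≤ t) {y : Euc N} (h : t ≤ ‖y‖) : moll t y = 0 := by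
  rw [moll, mollKer_eq_zero ht h, mul_zero]

lemma moll_le {t : ℝ} (ht : 0 < t) (y : Euc N) :
    moll t y ≤ (∫ x : Euc N, mollKer 1 x)⁻¹ * (t ^ N)⁻¹ :=
  mul_le_mul_of_nonneg_left (mollKer_le ht y) (inv_nonneg.2 mollKer_mass_pos.le)

lemma hasCompactSupport_moll {t : ℝ} (ht : 0 ≤ t) : HasCompactSupport (moll (N := N) t) :=
  (hasCompactSupport_mollKer ht).mul_left

lemma integrable_moll_sub {t : ℝ} (ht : 0 ≤ t) (x : Euc N) :
    Integrable fun y => moll t (y - x) :=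
  ((continuous_moll t).integrable_of_hasCompactSupport
    (hasCompactSupport_moll ht)).comp_sub_right x

lemma integral_moll_sub {t : ℝ} (ht : 0 < t) (x : Euc N) : ∫ y, moll t (y - x) = 1 := by
  rw [integral_sub_right_eq_self (moll t) x, integral_moll ht]

lemma hasDerivAt_mollKer {t : ℝ} (ht : 0 < t) (y : Euc N) :
    HasDerivAt (fun s => mollKer s y) (mollKer' t y) t := by
  have h1 : HasDerivAt (fun s : ℝ => max (s ^ 2 - ‖y‖ ^ 2) 0 ^ 3)
      (3 * max (t ^ 2 - ‖y‖ ^ 2) 0 ^ 2 * (2 * t)) t := by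
    have h := (hasDerivAt_posPart_pow 1 (t ^ 2 - ‖y‖ ^ 2)).comp t
      ((hasDerivAt_pow 2 t).sub_const (‖y‖ ^ 2))
    refine h.congr_deriv ?_
    push_cast; ring
  have h2 : HasDerivAt (fun s : ℝ => (s ^ (N + 6))⁻¹)
      (-((N + 6 : ℕ) * t ^ (N + 5)) / (t ^ (N + 6)) ^ 2) t :=
    (hasDerivAt_pow (N + 6) t).inv (by positivity)
  refine (h2.mul h1).congr_deriv ?_
  simp only [mollKer']
  push_cast
  have e5 : t ^ (N + 5) = t ^ N * t ^ 5 := pow_add _ _ _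
  have e6 : t ^ (N + 6) = t ^ N * t ^ 6 := pow_add _ _ _
  have e7 : t ^ (N + 7) = t ^ N * t ^ 7 := pow_add _ _ _
  rw [e5, e6, e7]
  have : t ^ N ≠ 0 := by positivity
  field_simp
  ring

/-- The compactly supported function whose Laplacian is a multiple of `mollKer'`. -/
def mollPot (t : ℝ) (x y : Euc N) : ℝ := max (t ^ 2 - ‖y - x‖ ^ 2) 0 ^ 4

lemma contDiff_mollPot (t : ℝ) (x : Euc N) : ContDiff ℝ 2 (mollPot t x) :=
  ((contDiff_posPart_pow 2).of_le (by norm_num)).comp (contDiff_sub_normSq (t ^ 2) x)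

lemma mollPot_nonneg (t : ℝ) (x y : Euc N) : 0 ≤ mollPot t x y := by
  unfold mollPot; positivity

lemma testFun_mollPot {Ω : Set (Euc N)} (hΩ : IsOpen Ω) {t : ℝ} (ht : 0 ≤ t) {x : Euc N}
    (h : ball x t ⊆ Ω) : TestFun Ω (mollPot t x) := by
  refine ⟨contDiff_mollPot t x, fun y hy => ?_⟩
  have hy' : y ∉ Ω := by rw [hΩ.frontier_eq] at hy; exact hy.2
  have h1 : t ≤ ‖y - x‖ := by
    by_contra hc
    exact hy' (h (by rw [mem_ball, dist_eq_norm]; exact not_le.1 hc))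
  have : t ^ 2 - ‖y - x‖ ^ 2 ≤ 0 := by nlinarith
  simp [mollPot, max_eq_right this]

lemma lap_mollPot {t : ℝ} (ht : 0 < t) (x y : Euc N) :
    lap (mollPot t x) y = 8 * t ^ (N + 7) * mollKer' t (y - x) := by
  have h := lap_comp_real (F := fun s => max s 0 ^ 4) (F' := fun s => 4 * max s 0 ^ 3)
    (F'' := fun s => 12 * max s 0 ^ 2)
    (fun s => (hasDerivAt_posPart_pow 2 s).congr_deriv (by push_cast; ring))
    (fun s => ((hasDerivAt_posPart_pow 1 s).const_mul 4).congr_deriv (by push_cast; ring))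
    ((contDiff_posPart_pow 2).of_le (by norm_num)) (contDiff_sub_normSq (t ^ 2) x (n := 2)) y
  change lap (mollPot t x) y = _ at h
  rw [h, gradient_sub_normSq, lap_sub_normSq, norm_smul, mul_pow, mollKer',
    mul_inv_cancel_left₀ (by positivity)]
  have hq : max (t ^ 2 - ‖y - x‖ ^ 2) 0 ^ 2 * ‖y - x‖ ^ 2 =
      max (t ^ 2 - ‖y - x‖ ^ 2) 0 ^ 2 * (t ^ 2 - max (t ^ 2 - ‖y - x‖ ^ 2) 0) := by
    rcases le_total (t ^ 2 - ‖y - x‖ ^ 2) 0 with h | h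
    · rw [max_eq_right h]; ring
    · rw [max_eq_left h]; ring
  have h2 : ‖(-2 : ℝ)‖ ^ 2 = 4 := by norm_num
  rw [h2]
  linear_combination 48 * hq

/-- Mollification of a function on `Ω`. -/
def mollify (Ω : Set (Euc N)) (z : Euc N → ℝ) (t : ℝ) (x : Euc N) : ℝ :=
  ∫ y in Ω, z y * moll t (y - x)

lemma integrableOn_mul_moll {Ω : Set (Euc N)} {z : Euc N → ℝ} (hz : IntegrableOn z Ω) {t : ℝ}
    (ht : 0 < t) (x : Euc N) : IntegrableOn (fun y => z y * moll t (y - x)) Ω := by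
  refine Integrable.mul_bdd (c := (∫ x : Euc N, mollKer 1 x)⁻¹ * (t ^ N)⁻¹) hz
    ((continuous_moll t).comp (continuous_id.sub continuous_const)).aestronglyMeasurable
    (Eventually.of_forall fun y => ?_)
  rw [Real.norm_of_nonneg (moll_nonneg ht.le _)]
  exact moll_le ht _

lemma abs_mollKer'_le {t : ℝ} (ht : 0 < t) (y : Euc N) :
    |mollKer' t y| ≤ (48 + 8 * (N + 6)) * (8 * t ^ (N + 1))⁻¹ := by
  set q := max (t ^ 2 - ‖y‖ ^ 2) 0 with hq
  have h0 : 0 ≤ q := le_max_right _ _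
  have h1 : q ≤ t ^ 2 := max_le (by nlinarith [sq_nonneg ‖y‖]) (sq_nonneg t)
  have h2 : q ^ 2 ≤ (t ^ 2) ^ 2 := pow_le_pow_left₀ h0 h1 2
  have h3 : q ^ 3 ≤ (t ^ 2) ^ 3 := pow_le_pow_left₀ h0 h1 3
  have h4 : |48 * t ^ 2 * q ^ 2 - 8 * (N + 6) * q ^ 3| ≤ (48 + 8 * (N + 6)) * t ^ 6 := by
    refine (abs_sub _ _).trans ?_
    rw [abs_of_nonneg (by positivity), abs_of_nonneg (by positivity)]
    have e1 : 48 * t ^ 2 * q ^ 2 ≤ 48 * t ^ 2 * (t ^ 2) ^ 2 :=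
      mul_le_mul_of_nonneg_left h2 (by positivity)
    have e2 : 8 * ((N : ℝ) + 6) * q ^ 3 ≤ 8 * (N + 6) * (t ^ 2) ^ 3 :=
      mul_le_mul_of_nonneg_left h3 (by positivity)
    nlinarith
  rw [mollKer', abs_mul, abs_of_pos (by positivity), mul_comm]
  calc _ ≤ (48 + 8 * (N + 6)) * t ^ 6 * (8 * t ^ (N + 7))⁻¹ :=
        mul_le_mul_of_nonneg_right h4 (by positivity)
    _ = _ := by
      have e7 : t ^ (N + 7) = t ^ (N + 1) * t ^ 6 := by rw [← pow_add]
      rw [e7]; field_simp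

lemma hasDerivAt_integral_mollKer {Ω : Set (Euc N)} {z : Euc N → ℝ} (hz : IntegrableOn z Ω)
    {t : ℝ} (ht : 0 < t) (x : Euc N) :
    HasDerivAt (fun s => ∫ y in Ω, z y * mollKer s (y - x))
      (∫ y in Ω, z y * mollKer' t (y - x)) t := by
  have hc : ∀ s, Continuous fun y : Euc N => mollKer s (y - x) := fun s =>
    (continuous_mollKer s).comp (continuous_id.sub continuous_const)
  have hc' : ∀ s, Continuous fun y : Euc N => mollKer' s (y - x) := fun s =>
    (continuous_mollKer' s).comp (continuous_id.sub continuous_const)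
  refine (hasDerivAt_integral_of_dominated_loc_of_deriv_le
    (F := fun s y => z y * mollKer s (y - x)) (F' := fun s y => z y * mollKer' s (y - x))
    (bound := fun y => ‖z y‖ * ((48 + 8 * (N + 6)) * (8 * (t / 2) ^ (N + 1))⁻¹))
    (Ioi_mem_nhds (half_lt_self ht)) (Eventually.of_forall fun s =>
      hz.aestronglyMeasurable.mul (hc s).aestronglyMeasurable) ?_
    (hz.aestronglyMeasurable.mul (hc' t).aestronglyMeasurable) ?_ (hz.norm.mul_const _) ?_).2
  · refine Integrable.mul_bdd (c := (t ^ N)⁻¹) hz (hc t).aestronglyMeasurable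
      (Eventually.of_forall fun y => ?_)
    rw [Real.norm_of_nonneg (mollKer_nonneg ht.le _)]
    exact mollKer_le ht _
  · refine Eventually.of_forall fun y s hs => ?_
    rw [mem_Ioi] at hs
    have hs0 : 0 < t / 2 := half_pos ht
    rw [norm_mul]
    refine mul_le_mul_of_nonneg_left ((abs_mollKer'_le (hs0.trans hs) _).trans ?_) (norm_nonneg _)
    refine mul_le_mul_of_nonneg_left ?_ (by positivity)
    refine inv_anti₀ (by positivity) ?_
    exact mul_le_mul_of_nonneg_left (pow_le_pow_left₀ hs0.le hs.le _) (by norm_num)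
  · refine Eventually.of_forall fun y s hs => ?_
    exact (hasDerivAt_mollKer ((half_pos ht).trans hs) _).const_mul _

/-- Mollifications of weakly superharmonic functions increase as the radius decreases. -/
lemma mollify_antitone {Ω : Set (Euc N)} (hΩ : IsOpen Ω) {z : Euc N → ℝ} (hz : IntegrableOn z Ω)
    (hsup : ∀ η, TestFun Ω η → (∀ y, 0 ≤ η y) → 0 ≤ ∫ y in Ω, z y * -(lap η y))
    {x : Euc N} {s t : ℝ} (hs : 0 < s) (hst : s ≤ t) (hball : ball x t ⊆ Ω) :
    mollify Ω z t x ≤ mollify Ω z s x := by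
  have hd : ∀ r ∈ Icc s t, HasDerivAt (fun s => ∫ y in Ω, z y * mollKer s (y - x))
      (∫ y in Ω, z y * mollKer' r (y - x)) r := fun r hr =>
    hasDerivAt_integral_mollKer hz (hs.trans_le hr.1) x
  have hanti : AntitoneOn (fun s => ∫ y in Ω, z y * mollKer s (y - x)) (Icc s t) := by
    refine antitoneOn_of_deriv_nonpos (convex_Icc s t)
      (fun r hr => (hd r hr).continuousAt.continuousWithinAt) (fun r hr =>
        (hd r (interior_subset hr)).differentiableAt.differentiableWithinAt) fun r hr => ?_
    have hr' := interior_subset hr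
    have hr0 : 0 < r := hs.trans_le hr'.1
    rw [(hd r hr').deriv]
    have h1 := hsup _ (testFun_mollPot hΩ hr0.le ((ball_subset_ball hr'.2).trans hball))
      (mollPot_nonneg r x)
    have h2 : ∀ y, z y * -(lap (mollPot r x) y) =
        -(8 * r ^ (N + 7)) * (z y * mollKer' r (y - x)) := by
      intro y; rw [lap_mollPot hr0]; ring
    simp_rw [h2] at h1
    rw [integral_const_mul] at h1
    have h3 : 0 < 8 * r ^ (N + 7) := by positivity
    nlinarith
  have h := hanti (left_mem_Icc.2 hst) (right_mem_Icc.2 hst) hst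
  have e : ∀ r, mollify Ω z r x = (∫ x : Euc N, mollKer 1 x)⁻¹ *
      ∫ y in Ω, z y * mollKer r (y - x) := by
    intro r
    rw [← integral_const_mul, mollify]
    refine integral_congr_ae (Eventually.of_forall fun y => ?_)
    simp only [moll]; ring
  rw [e, e]
  exact mul_le_mul_of_nonneg_left h (inv_nonneg.2 mollKer_mass_pos.le)

lemma tendsto_mollify {Ω : Set (Euc N)} (hΩ : IsOpen Ω) {z : Euc N → ℝ} (hz : IntegrableOn z Ω) :
    ∀ᵐ x, x ∈ Ω → Tendsto (fun t => mollify Ω z t x) (𝓝[>] 0) (𝓝 (z x)) := by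
  have hz' : Integrable (Ω.indicator z) := hz.integrable_indicator hΩ.measurableSet
  have hL := IsUnifLocDoublingMeasure.ae_tendsto_average_norm_sub (volume : Measure (Euc N))
    hz'.locallyIntegrable 1
  filter_upwards [hL] with x hx hxΩ
  set zz := Ω.indicator z with hzz
  set M := ∫ x : Euc N, mollKer 1 x with hM
  have hM0 : 0 < M := mollKer_mass_pos
  set b := (volume (ball (0 : Euc N) 1)).toReal with hb
  have h1 := hx (fun _ : ℝ => x) (fun t => t) (tendsto_id (α := ℝ) (x := 𝓝[>] 0))
    (by filter_upwards [self_mem_nhdsWithin] with t ht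
        rw [one_mul]; exact mem_closedBall_self (le_of_lt ht))
  rw [tendsto_iff_norm_sub_tendsto_zero]
  have h2 := h1.const_mul (M⁻¹ * b)
  rw [mul_zero] at h2
  refine squeeze_zero' (Eventually.of_forall fun t => norm_nonneg _) ?_ h2
  filter_upwards [self_mem_nhdsWithin] with t ht
  have ht0 : 0 < t := ht
  have e1 : mollify Ω z t x = ∫ y, zz y * moll t (y - x) := by
    rw [mollify, ← integral_indicator hΩ.measurableSet]
    refine integral_congr_ae (Eventually.of_forall fun y => ?_)
    by_cases hy : y ∈ Ω <;> simp [hzz, hy]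
  have h_integrable : Integrable fun y => zz y * moll t (y - x) := by
    have := integrableOn_mul_moll (Ω := univ) (integrableOn_univ.2 hz') ht0 x
    rwa [integrableOn_univ] at this
  have e2 : mollify Ω z t x - z x = ∫ y, (zz y - zz x) * moll t (y - x) := by
    simp_rw [sub_mul]
    rw [integral_sub h_integrable ((integrable_moll_sub ht0.le x).const_mul _), integral_const_mul,
      integral_moll_sub ht0, e1, mul_one, hzz, indicator_of_mem hxΩ]
  have hvol : volume.real (closedBall x t) = t ^ N * b := by
    rw [Measure.real, Measure.addHaar_closedBall _ _ ht0.le, ENNReal.toReal_mul,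
      ENNReal.toReal_ofReal (by positivity), finrank_euclideanSpace_fin]
  have hfin : IntegrableOn (fun y => ‖zz y - zz x‖) (closedBall x t) := by
    refine (hz'.integrableOn.sub ?_).norm
    exact integrableOn_const (measure_closedBall_lt_top.ne)
  have e3 : ‖mollify Ω z t x - z x‖ ≤
      (M⁻¹ * (t ^ N)⁻¹) * ∫ y in closedBall x t, ‖zz y - zz x‖ := by
    rw [e2, ← integral_const_mul, ← integral_indicator measurableSet_closedBall]
    refine (norm_integral_le_integral_norm _).trans
      (integral_mono_of_nonneg (Eventually.of_forall fun _ => norm_nonneg _) ?_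
      (Eventually.of_forall fun y => ?_))
    · rw [integrable_indicator_iff measurableSet_closedBall]
      exact hfin.const_mul _
    · by_cases hy : y ∈ closedBall x t
      · simp only [indicator_of_mem hy]
        rw [norm_mul, mul_comm, Real.norm_of_nonneg (moll_nonneg ht0.le _)]
        exact mul_le_mul_of_nonneg_right (moll_le ht0 _) (norm_nonneg _)
      · simp only [indicator_of_notMem hy]
        rw [mem_closedBall, dist_eq_norm, not_le] at hy
        rw [moll_eq_zero ht0.le hy.le, mul_zero, norm_zero]
  refine e3.trans (le_of_eq ?_)
  rw [setAverage_eq, hvol, smul_eq_mul]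
  have hb0 : b ≠ 0 := (ENNReal.toReal_pos (measure_ball_pos _ _ one_pos).ne'
    measure_ball_lt_top.ne).ne'
  field_simp

/-- Weakly harmonic functions are bounded away from the boundary. -/
lemma exists_bound_of_weakly_harmonic {Ω : Set (Euc N)} (hΩ : IsOpen Ω) {z : Euc N → ℝ}
    (hz : IntegrableOn z Ω) (hh : ∀ η, TestFun Ω η → ∫ y in Ω, z y * -(lap η y) = 0)
    {r : ℝ} (hr : 0 < r) : ∃ C : ℝ, ∀ᵐ x, ball x r ⊆ Ω → |z x| ≤ C := by
  refine ⟨((∫ x : Euc N, mollKer 1 x)⁻¹ * (r ^ N)⁻¹) * ∫ y in Ω, ‖z y‖, ?_⟩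
  have hzn : IntegrableOn (fun y => -z y) Ω := hz.neg
  filter_upwards [tendsto_mollify hΩ hz] with x hx hball
  have hxΩ : x ∈ Ω := hball (mem_ball_self hr)
  have hconst : ∀ t ∈ Ioc 0 r, mollify Ω z t x = mollify Ω z r x := by
    intro t ht
    refine le_antisymm ?_ (mollify_antitone hΩ hz (fun η h1 _ => (hh η h1).ge) ht.1 ht.2 hball)
    have := mollify_antitone hΩ hzn (fun η h1 _ => by
      have := hh η h1
      simp only [neg_mul, integral_neg, this, neg_zero, le_refl]) ht.1 ht.2 hball
    simp only [mollify, neg_mul, integral_neg] at this ⊢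
    linarith
  have hev : (fun t => mollify Ω z t x) =ᶠ[𝓝[>] 0] fun _ => mollify Ω z r x := by
    filter_upwards [Ioc_mem_nhdsGT hr] with t ht using hconst t ht
  have heq : z x = mollify Ω z r x :=
    tendsto_nhds_unique (hx hxΩ) (tendsto_const_nhds.congr' hev.symm)
  rw [heq, mollify, ← integral_const_mul]
  refine (norm_integral_le_integral_norm _).trans (integral_mono
    (integrableOn_mul_moll hz hr x).norm (hz.norm.const_mul _) fun y => ?_)
  simp only
  rw [norm_mul, mul_comm, Real.norm_of_nonneg (moll_nonneg hr.le _)]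
  exact mul_le_mul_of_nonneg_right (moll_le hr _) (norm_nonneg _)

lemma frontier_subset_compl {Ω : Set (Euc N)} (hΩ : IsOpen Ω) {x : Euc N}
    (hx : x ∈ frontier Ω) : x ∉ Ω := by
  rw [hΩ.frontier_eq] at hx; exact hx.2

/-- If `p ≥ 0` on `Ω` vanishes at the boundary point `y`, its derivative in a direction pointing
into `Ω` is nonnegative. -/
lemma fderiv_nonneg_of_inward {Ω : Set (Euc N)} {p : Euc N → ℝ} {y ν : Euc N}
    (hp : DifferentiableAt ℝ p y) (h0 : p y = 0) (hpos : ∀ z ∈ Ω, 0 ≤ p z)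
    (hν : ∀ᶠ t in 𝓝[>] (0 : ℝ), y + t • ν ∈ Ω) : 0 ≤ fderiv ℝ p y ν := by
  have h1 : HasDerivAt (fun t : ℝ => p (y + t • ν)) (fderiv ℝ p y ν) 0 := by
    have h2 : HasDerivAt (fun t : ℝ => y + t • ν) ν 0 := by
      simpa using ((hasDerivAt_id (0 : ℝ)).smul_const ν).const_add y
    have h3 : HasFDerivAt p (fderiv ℝ p y) (y + (0 : ℝ) • ν) := by simpa using hp.hasFDerivAt
    exact h3.comp_hasDerivAt 0 h2
  have h4 := h1.hasDerivWithinAt (s := Ioi 0)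
  rw [hasDerivWithinAt_iff_tendsto_slope' (by simp)] at h4
  refine ge_of_tendsto h4 ?_
  filter_upwards [hν, self_mem_nhdsWithin] with t ht ht0
  rw [mem_Ioi] at ht0
  rw [slope_def_field, zero_smul, add_zero, h0]
  exact div_nonneg (by simpa using hpos _ ht) (by simpa using ht0.le)

/-- A `C²` function which is nonnegative on `Ω`, vanishes on `∂Ω`, and has a nonvanishing inward
derivative at the boundary points near `x`. -/
lemma exists_local_defining {Ω : Set (Euc N)} (hΩ : IsBoundedC2Domain Ω) {x : Euc N}
    (hx : x ∈ frontier Ω) : ∃ p : Euc N → ℝ, ContDiff ℝ 2 p ∧ HasCompactSupport p ∧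
      (∀ y ∈ Ω, 0 ≤ p y) ∧ (∀ y ∈ frontier Ω, p y = 0) ∧
      ∀ᶠ y in 𝓝 x, y ∈ frontier Ω → ∃ ν, 0 < fderiv ℝ p y ν ∧
        ∀ᶠ t in 𝓝[>] (0 : ℝ), y + t • ν ∈ Ω := by
  obtain ⟨f, U, hU, hf, hf', hΩU⟩ := hΩ.2.2.2 x hx
  obtain ⟨χ, hχs, hχc, hχ, hχr, hχx⟩ :=
    exists_contDiff_tsupport_subset (n := 2) (interior_mem_nhds.2 hU)
  have hχ' : ContDiff ℝ 2 χ := hχ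
  have hχ0 : ∀ y, 0 ≤ χ y := fun y => (hχr (mem_range_self y)).1
  have hfat : ∀ y ∈ interior U, ContDiffAt ℝ 2 f y := fun y hy =>
    hf.contDiffAt (mem_interior_iff_mem_nhds.1 hy)
  have hneg : ∀ y ∈ U, y ∈ Ω ↔ f y < 0 := fun y hy => by
    have := Set.ext_iff.1 hΩU y
    simp only [mem_inter_iff, mem_ofPred_eq] at this
    tauto
  have hzero : ∀ y ∈ interior U, y ∈ frontier Ω → f y = 0 := by
    intro y hy hyf
    have hyU := interior_subset hy
    refine le_antisymm ?_ (not_lt.1 fun h => frontier_subset_compl hΩ.1 hyf ((hneg y hyU).2 h))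
    have hcl : y ∈ closure (Ω ∩ interior U) :=
      (mem_closure_iff_nhdsWithin_neBot.2 <| by
        rw [nhdsWithin_inter_of_mem' (mem_nhdsWithin_of_mem_nhds (isOpen_interior.mem_nhds hy))]
        exact mem_closure_iff_nhdsWithin_neBot.1 (frontier_subset_closure hyf))
    have hne := mem_closure_iff_nhdsWithin_neBot.1 hcl
    refine le_of_tendsto ((hfat y hy).continuousAt.continuousWithinAt (s := Ω ∩ interior U)) ?_
    filter_upwards [self_mem_nhdsWithin] with z hz
    exact ((hneg z (interior_subset hz.2)).1 hz.1).le
  have hp : ContDiff ℝ 2 (fun y => χ y * -f y) := by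
    rw [contDiff_iff_contDiffAt]
    intro y
    by_cases hy : y ∈ tsupport χ
    · exact hχ'.contDiffAt.mul (hfat y (hχs hy)).neg
    · have : (fun y => χ y * -f y) =ᶠ[𝓝 y] fun _ => 0 := by
        filter_upwards [notMem_tsupport_iff_eventuallyEq.1 hy] with z hz
        simp [hz]
      exact contDiffAt_const.congr_of_eventuallyEq this
  have hχU : ∀ y, y ∉ interior U → χ y = 0 := fun y hy =>
    image_eq_zero_of_notMem_tsupport fun h => hy (hχs h)
  refine ⟨fun y => χ y * -f y, hp, hχc.mul_right, fun y hy => ?_, fun y hy => ?_, ?_⟩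
  · by_cases hyU : y ∈ interior U
    · exact mul_nonneg (hχ0 y) (neg_nonneg.2 ((hneg y (interior_subset hyU)).1 hy).le)
    · simp [hχU y hyU]
  · by_cases hyU : y ∈ interior U
    · simp [hzero y hyU hy]
    · simp [hχU y hyU]
  · have h1 : ∀ᶠ y in 𝓝 x, 0 < χ y :=
      hχ.continuous.continuousAt.eventually (lt_mem_nhds (by rw [hχx]; exact one_pos))
    filter_upwards [h1] with y hy hyf
    have hyU : y ∈ interior U := by
      by_contra h
      exact hy.ne' (hχU y h)
    have hfd : DifferentiableAt ℝ f y := (hfat y hyU).differentiableAt (by norm_num)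
    have hg0 : 0 < ‖gradient f y‖ := by
      rw [norm_gradient_eq]; exact norm_pos_iff.2 (hf' y (interior_subset hyU))
    have hdir : fderiv ℝ f y (-gradient f y) = -‖gradient f y‖ ^ 2 := by
      rw [← inner_gradient_eq, inner_neg_right, real_inner_self_eq_norm_sq]
    have hline : HasDerivAt (fun t : ℝ => y + t • -gradient f y) (-gradient f y) 0 := by
      simpa using ((hasDerivAt_id (0 : ℝ)).smul_const (-gradient f y)).const_add y
    refine ⟨-gradient f y, ?_, ?_⟩
    · have h2 : HasFDerivAt (fun y => χ y * -f y) _ y :=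
        (hχ'.differentiable (by norm_num) y).hasFDerivAt.mul hfd.hasFDerivAt.neg
      rw [h2.fderiv]
      simp only [_root_.add_apply, _root_.smul_apply,
        _root_.neg_apply, hdir, hzero y hyU hyf, smul_eq_mul]
      have : 0 < χ y * ‖gradient f y‖ ^ 2 := by positivity
      simpa using this
    · have h3 : HasFDerivAt f (fderiv ℝ f y) (y + (0 : ℝ) • -gradient f y) := by
        simpa using hfd.hasFDerivAt
      have h4 := (h3.comp_hasDerivAt 0 hline).hasDerivWithinAt (s := Ioi 0)
      rw [hasDerivWithinAt_iff_tendsto_slope' (by simp), hdir] at h4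
      have h5 := h4.eventually (gt_mem_nhds (neg_lt_zero.2 (by positivity : 0 < ‖gradient f y‖ ^ 2)))
      have h6 : ∀ᶠ t in 𝓝[>] (0 : ℝ), y + t • -gradient f y ∈ interior U := by
        refine (hline.continuousAt.eventually ?_).filter_mono nhdsWithin_le_nhds
        simpa using isOpen_interior.mem_nhds hyU
      filter_upwards [h5, h6, self_mem_nhdsWithin] with t ht htU ht0
      rw [mem_Ioi] at ht0
      refine (hneg _ (interior_subset htU)).2 ?_
      rw [slope_def_field] at ht
      simp only [Function.comp, zero_smul, add_zero, hzero y hyU hyf, sub_zero] at ht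
      by_contra hc
      exact absurd ht (not_lt.2 (div_nonneg (not_lt.1 hc) ht0.le))

/-- A compactly supported global `C²` defining function of `Ω`. -/
structure IsDefining (Ω : Set (Euc N)) (ζ : Euc N → ℝ) : Prop where
  contDiff : ContDiff ℝ 2 ζ
  hasCompactSupport : HasCompactSupport ζ
  pos : ∀ x ∈ Ω, 0 < ζ x
  eq_zero : ∀ x ∈ frontier Ω, ζ x = 0
  fderiv_ne_zero : ∀ x ∈ frontier Ω, fderiv ℝ ζ x ≠ 0

lemma exists_isDefining {Ω : Set (Euc N)} (hΩ : IsBoundedC2Domain Ω) :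
    ∃ ζ, IsDefining Ω ζ := by
  have hfc : IsCompact (frontier Ω) :=
    isCompact_of_isClosed_isBounded isClosed_frontier
      (hΩ.2.2.1.closure.subset frontier_subset_closure)
  choose! p hp1 hp2 hp3 hp4 hp5 using fun x (hx : x ∈ frontier Ω) => exists_local_defining hΩ hx
  obtain ⟨s, hs, hcov⟩ := hfc.elim_nhds_subcover
    (fun x => {y | y ∈ frontier Ω → ∃ ν, 0 < fderiv ℝ (p x) y ν ∧
      ∀ᶠ t in 𝓝[>] (0 : ℝ), y + t • ν ∈ Ω}) hp5
  obtain ⟨χ, hχs, hχ, hχr⟩ := hΩ.1.exists_contDiff_support_eq (n := 2)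
  have hχ' : ContDiff ℝ 2 χ := hχ
  have hχ0 : ∀ y, 0 ≤ χ y := fun y => (hχr (mem_range_self y)).1
  have hχc : HasCompactSupport χ := by
    rw [HasCompactSupport, tsupport, hχs]
    exact isCompact_of_isClosed_isBounded isClosed_closure hΩ.2.2.1.closure
  have hχz : ∀ y ∈ frontier Ω, χ y = 0 := fun y hy => by
    by_contra h
    exact frontier_subset_compl hΩ.1 hy (hχs ▸ h)
  have hsum : ContDiff ℝ 2 (fun y => ∑ i ∈ s, p i y) := ContDiff.sum fun i hi => hp1 i (hs i hi)
  have hd : ∀ i ∈ s, Differentiable ℝ (p i) := fun i hi =>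
    (hp1 i (hs i hi)).differentiable (by norm_num)
  refine ⟨fun y => χ y + ∑ i ∈ s, p i y, hχ'.add hsum, hχc.add ?_, fun y hy => ?_,
    fun y hy => ?_, fun y hy h => ?_⟩
  · have : (fun y => ∑ i ∈ s, p i y) = ∑ i ∈ s, p i := by ext; simp
    clear hsum hd hcov
    rw [this]
    induction s using Finset.cons_induction with
    | empty => simpa using HasCompactSupport.zero
    | cons a s ha ih =>
      rw [Finset.sum_cons]
      exact (hp2 a (hs a (by simp))).add (ih (fun x hx => hs x (by simp [hx])) (by ext; simp))
  · have h1 : 0 < χ y := lt_of_le_of_ne (hχ0 y) (Ne.symm (by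
      have : y ∈ Function.support χ := hχs ▸ hy
      exact this))
    exact add_pos_of_pos_of_nonneg h1 (Finset.sum_nonneg fun i hi => hp3 i (hs i hi) y hy)
  · rw [hχz y hy, zero_add]
    exact Finset.sum_eq_zero fun i hi => hp4 i (hs i hi) y hy
  · have hmem := hcov hy
    simp only [mem_iUnion, mem_ofPred_eq] at hmem
    obtain ⟨i, hi, hi2⟩ := hmem
    obtain ⟨ν, hν, hin⟩ := hi2 hy
    have e1 : HasFDerivAt (fun y => χ y + ∑ i ∈ s, p i y) (fderiv ℝ χ y + ∑ i ∈ s, fderiv ℝ (p i) y)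
        y := by
      refine (hχ'.differentiable (by norm_num) y).hasFDerivAt.add ?_
      exact HasFDerivAt.fun_sum fun i hi => (hd i hi y).hasFDerivAt
    have e2 : 0 < fderiv ℝ χ y ν + ∑ i ∈ s, fderiv ℝ (p i) y ν := by
      refine add_pos_of_nonneg_of_pos (fderiv_nonneg_of_inward (hχ'.differentiable (by norm_num) y)
        (hχz y hy) (fun z _ => hχ0 z) hin) ?_
      refine hν.trans_le (Finset.single_le_sum (f := fun i => fderiv ℝ (p i) y ν)
        (fun j hj => ?_) hi)
      exact fderiv_nonneg_of_inward (hd j hj y) (hp4 j (hs j hj) y hy) (hp3 j (hs j hj)) hin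
    rw [e1.fderiv] at h
    have e3 := congrArg (fun L : Euc N →L[ℝ] ℝ => L ν) h
    simp only [_root_.add_apply, _root_.sum_apply,
      _root_.zero_apply] at e3
    exact e2.ne' e3

lemma rho_nonneg (Ω : Set (Euc N)) (x : Euc N) : 0 ≤ rho Ω x := infDist_nonneg

lemma continuous_rho (Ω : Set (Euc N)) : Continuous (rho Ω) := continuous_infDist_pt _

lemma isCompact_frontier {Ω : Set (Euc N)} (hb : Bornology.IsBounded Ω) :
    IsCompact (frontier Ω) :=
  isCompact_of_isClosed_isBounded isClosed_frontier (hb.closure.subset frontier_subset_closure)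

lemma frontier_nonempty {Ω : Set (Euc N)} (hb : Bornology.IsBounded Ω) (hne : Ω.Nonempty)
    (i : Fin N) : (frontier Ω).Nonempty := by
  rw [nonempty_frontier_iff]
  refine ⟨hne, ?_⟩
  rintro rfl
  have : Nontrivial (Euc N) := ⟨0, EuclideanSpace.single i 1, fun h => by
    simpa using congrArg (fun v : Euc N => v i) h⟩
  exact NormedSpace.unbounded_univ ℝ (Euc N) hb

lemma ball_rho_subset {Ω : Set (Euc N)} (hΩ : IsOpen Ω) {x : Euc N} (hx : x ∈ Ω) :
    ball x (rho Ω x) ⊆ Ω := by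
  rcases (ball x (rho Ω x)).eq_empty_or_nonempty with h | h
  · simp [h]
  refine (convex_ball x (rho Ω x)).isPreconnected.subset_left_of_subset_union hΩ
    isClosed_closure.isOpen_compl (v := (closure Ω)ᶜ)
    (disjoint_compl_right_iff_subset.2 subset_closure) (fun y hy => ?_)
    ⟨x, mem_ball_self (nonempty_ball.1 h), hx⟩
  by_contra hc
  simp only [mem_union, mem_compl_iff, not_or, not_not] at hc
  have hyf : y ∈ frontier Ω := by
    rw [hΩ.frontier_eq]; exact ⟨hc.2, hc.1⟩
  have := infDist_le_dist_of_mem (x := x) hyf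
  rw [mem_ball, dist_comm] at hy
  exact absurd hy (not_lt.2 this)

lemma TestFun.abs_le_rho {Ω : Set (Euc N)} (hb : Bornology.IsBounded Ω)
    (hne : (frontier Ω).Nonempty) {φ : Euc N → ℝ} (hφ : TestFun Ω φ) :
    ∃ C, 0 ≤ C ∧ ∀ x ∈ Ω, |φ x| ≤ C * rho Ω x := by
  obtain ⟨R, hR⟩ := hb.closure.subset_closedBall 0
  have hcont : ContinuousOn (fderiv ℝ φ) (closedBall 0 R) :=
    (hφ.1.continuous_fderiv (by norm_num)).continuousOn
  obtain ⟨C, hC⟩ := (isCompact_closedBall (0 : Euc N) R).exists_bound_of_continuousOn hcont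
  have hC0 : 0 ≤ C := by
    obtain ⟨z, hz⟩ := hne
    exact (norm_nonneg _).trans (hC z (hR (frontier_subset_closure hz)))
  refine ⟨C, hC0, fun x hx => ?_⟩
  obtain ⟨z, hz, hxz⟩ := (isCompact_frontier hb).exists_infDist_eq_dist hne x
  have h := (convex_closedBall (0 : Euc N) R).norm_image_sub_le_of_norm_fderiv_le (𝕜 := ℝ) (f := φ)
    (fun y _ => hφ.1.differentiable (by norm_num) y) hC
    (hR (frontier_subset_closure hz)) (hR (subset_closure hx))
  rw [hφ.2 z hz, sub_zero, Real.norm_eq_abs] at h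
  rwa [rho, hxz, dist_eq_norm]

namespace IsDefining

variable {Ω : Set (Euc N)} {ζ : Euc N → ℝ}

lemma testFun (h : IsDefining Ω ζ) : TestFun Ω ζ := ⟨h.contDiff, h.eq_zero⟩

lemma exists_le_add (h : IsDefining Ω ζ) (hb : Bornology.IsBounded Ω) :
    ∃ m, 0 < m ∧ ∀ x ∈ Ω, 2 * m ≤ ζ x + ‖gradient ζ x‖ := by
  rcases Ω.eq_empty_or_nonempty with rfl | hne
  · exact ⟨1, one_pos, by simp⟩
  have hc : ContinuousOn (fun x => ζ x + ‖gradient ζ x‖) (closure Ω) :=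
    (h.contDiff.continuous.add (continuous_gradient (h.contDiff.of_le (by norm_num))).norm).continuousOn
  obtain ⟨x, hx, hmin⟩ := hb.isCompact_closure.exists_isMinOn hne.closure hc
  refine ⟨(ζ x + ‖gradient ζ x‖) / 2, ?_, fun y hy => ?_⟩
  · rw [closure_eq_self_union_frontier] at hx
    rcases hx with hx | hx
    · exact half_pos (add_pos_of_pos_of_nonneg (h.pos x hx) (norm_nonneg _))
    · rw [h.eq_zero x hx, zero_add, norm_gradient_eq]
      exact half_pos (norm_pos_iff.2 (h.fderiv_ne_zero x hx))
  · have := hmin (subset_closure hy)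
    rw [mem_ofPred_eq] at this
    linarith

lemma exists_rho_le (h : IsDefining Ω ζ) (hΩ : IsOpen Ω) (hb : Bornology.IsBounded Ω)
    (hne : (frontier Ω).Nonempty) : ∃ C, 0 < C ∧ ∀ x ∈ Ω, rho Ω x ≤ C * ζ x := by
  obtain ⟨m, hm, hmin⟩ := h.exists_le_add hb
  obtain ⟨D, hD⟩ := hb.isCompact_closure.exists_bound_of_continuousOn
    (continuous_rho Ω).continuousOn
  have hD' : ∀ x ∈ Ω, rho Ω x ≤ D := fun x hx =>
    (le_abs_self _).trans (hD x (subset_closure hx))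
  have hD0 : 0 ≤ D := by
    obtain ⟨z, hz⟩ := hne
    exact (norm_nonneg _).trans (hD z (frontier_subset_closure hz))
  have huc : UniformContinuous (fderiv ℝ ζ) :=
    (h.hasCompactSupport.fderiv ℝ).uniformContinuous_of_continuous
      (h.contDiff.continuous_fderiv (by norm_num))
  obtain ⟨η, hη, hηc⟩ := Metric.uniformContinuous_iff.1 huc (m / 2) (half_pos hm)
  refine ⟨D / m + 2 / m + 2 * D / (m * η), by positivity, fun x hx => ?_⟩
  have hζ := h.pos x hx
  have hA : 0 ≤ D / m * ζ x := by positivity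
  have hB : 0 ≤ 2 / m * ζ x := by positivity
  have hC : 0 ≤ 2 * D / (m * η) * ζ x := by positivity
  suffices rho Ω x ≤ D / m * ζ x ∨ rho Ω x ≤ 2 / m * ζ x ∨ rho Ω x ≤ 2 * D / (m * η) * ζ x by
    rw [add_mul, add_mul]
    rcases this with h | h | h <;> linarith
  by_cases hcase : m ≤ ζ x
  · left
    refine (hD' x hx).trans ?_
    rw [div_mul_eq_mul_div, le_div_iff₀ hm]
    exact mul_le_mul_of_nonneg_left hcase hD0
  right
  have hgrad : m ≤ ‖gradient ζ x‖ := by linarith [hmin x hx]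
  have hgpos : 0 < ‖gradient ζ x‖ := hm.trans_le hgrad
  set e : Euc N := -(‖gradient ζ x‖⁻¹ • gradient ζ x) with he
  have hen : ‖e‖ = 1 := by
    rw [he, norm_neg, norm_smul, norm_inv, norm_norm, inv_mul_cancel₀ hgpos.ne']
  have hde : fderiv ℝ ζ x e = -‖gradient ζ x‖ := by
    rw [← inner_gradient_eq, he, inner_neg_right, inner_smul_right, real_inner_self_eq_norm_sq]
    field_simp
  have key : ∀ t, 0 < t → t < η → t < rho Ω x → m / 2 * t ≤ ζ x := by
    intro t ht htη htρ
    have hmem : x + t • e ∈ ball x η := by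
      rw [mem_ball, dist_eq_norm, add_sub_cancel_left, norm_smul, hen, Real.norm_of_nonneg ht.le,
        mul_one]
      exact htη
    have hmem' : x + t • e ∈ Ω := by
      refine ball_rho_subset hΩ hx ?_
      rw [mem_ball, dist_eq_norm, add_sub_cancel_left, norm_smul, hen, Real.norm_of_nonneg ht.le,
        mul_one]
      exact htρ
    have h1 := (convex_ball x η).norm_image_sub_le_of_norm_hasFDerivWithin_le' (𝕜 := ℝ) (f := ζ)
      (f' := fderiv ℝ ζ) (φ := fderiv ℝ ζ x) (C := m / 2)
      (fun y _ => (h.contDiff.differentiable (by norm_num) y).hasFDerivAt.hasFDerivWithinAt)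
      (fun y hy => by rw [← dist_eq_norm]; exact (hηc hy).le) (mem_ball_self hη) hmem
    rw [add_sub_cancel_left, norm_smul, hen, Real.norm_of_nonneg ht.le, map_smul, hde, mul_one,
      smul_eq_mul] at h1
    have h2 := (le_abs_self _).trans h1
    have h3 := h.pos _ hmem'
    nlinarith
  have key' : m / 2 * min η (rho Ω x) ≤ ζ x := by
    by_contra! hc
    have h0 : 0 < min η (rho Ω x) := by
      by_contra! h0
      nlinarith
    have h1 : ζ x / (m / 2) < min η (rho Ω x) := by
      rw [div_lt_iff₀ (half_pos hm)]; linarith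
    obtain ⟨t, ht1, ht2⟩ := exists_between h1
    have ht0 : 0 < t := lt_trans (by positivity) ht1
    have := key t ht0 (ht2.trans_le (min_le_left _ _)) (ht2.trans_le (min_le_right _ _))
    rw [div_lt_iff₀ (half_pos hm)] at ht1
    linarith
  rcases le_total η (rho Ω x) with hηρ | hηρ
  · right
    rw [min_eq_left hηρ] at key'
    refine (hD' x hx).trans ?_
    rw [div_mul_eq_mul_div, le_div_iff₀ (by positivity)]
    nlinarith
  · left
    rw [min_eq_right hηρ] at key'
    rw [div_mul_eq_mul_div, le_div_iff₀ hm]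
    nlinarith

end IsDefining

/-- A concave `C²` truncation at height `δ`, equal to `δ` on `[δ, ∞)`. -/
def capAt (δ t : ℝ) : ℝ := δ * (1 - max (1 - t / δ) 0 ^ 3)

lemma contDiff_capAt (δ : ℝ) : ContDiff ℝ 2 (capAt δ) := by
  have h : ContDiff ℝ 2 (fun t : ℝ => max t 0 ^ 3) := (contDiff_posPart_pow 1).of_le (by norm_num)
  exact contDiff_const.mul (contDiff_const.sub
    (h.comp (contDiff_const.sub (contDiff_id.div_const δ))))

lemma hasDerivAt_capAt {δ : ℝ} (hδ : 0 < δ) (t : ℝ) :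
    HasDerivAt (capAt δ) (3 * max (1 - t / δ) 0 ^ 2) t := by
  have h1 : HasDerivAt (fun t => 1 - t / δ) (-(1 / δ)) t :=
    ((hasDerivAt_id t).div_const δ).const_sub 1
  refine ((((hasDerivAt_posPart_pow 1 _).comp t h1).const_sub 1).const_mul δ).congr_deriv ?_
  push_cast; field_simp; ring

lemma hasDerivAt_capAt_deriv {δ : ℝ} (t : ℝ) :
    HasDerivAt (fun t => 3 * max (1 - t / δ) 0 ^ 2) (-(6 / δ) * max (1 - t / δ) 0) t := by
  have h1 : HasDerivAt (fun t => 1 - t / δ) (-(1 / δ)) t :=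
    ((hasDerivAt_id t).div_const δ).const_sub 1
  refine (((hasDerivAt_posPart_pow 0 _).comp t h1).const_mul 3).congr_deriv ?_
  push_cast; ring

lemma posPart_one_sub_div_mem {δ t : ℝ} (hδ : 0 < δ) (ht : 0 ≤ t) :
    0 ≤ max (1 - t / δ) 0 ∧ max (1 - t / δ) 0 ≤ 1 := by
  have : 0 ≤ t / δ := by positivity
  exact ⟨le_max_right _ _, max_le (by linarith) zero_le_one⟩

lemma capAt_nonneg {δ t : ℝ} (hδ : 0 < δ) (ht : 0 ≤ t) : 0 ≤ capAt δ t := by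
  obtain ⟨h0, h1⟩ := posPart_one_sub_div_mem hδ ht
  exact mul_nonneg hδ.le (sub_nonneg.2 (pow_le_one₀ h0 h1))

lemma capAt_le {δ : ℝ} (hδ : 0 < δ) (t : ℝ) : capAt δ t ≤ δ := by
  have : 0 ≤ max (1 - t / δ) 0 ^ 3 := by positivity
  unfold capAt; nlinarith

lemma mul_one_sub_le_capAt {δ t : ℝ} (hδ : 0 < δ) (ht : 0 ≤ t) :
    δ * (1 - max (1 - t / δ) 0) ≤ capAt δ t := by
  obtain ⟨h0, h1⟩ := posPart_one_sub_div_mem hδ ht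
  refine mul_le_mul_of_nonneg_left ?_ hδ.le
  have := pow_le_of_le_one h0 h1 (n := 3) (by norm_num)
  linarith

lemma le_capAt {δ t : ℝ} (hδ : 0 < δ) (ht : 0 ≤ t) (htδ : t ≤ δ) : t ≤ capAt δ t := by
  refine le_trans ?_ (mul_one_sub_le_capAt hδ ht)
  have : t / δ ≤ 1 := (div_le_one hδ).2 htδ
  rw [max_eq_left (by linarith)]
  field_simp; linarith

lemma capAt_le_mul {δ t : ℝ} (hδ : 0 < δ) (ht : 0 ≤ t) : capAt δ t ≤ 3 * t := by
  obtain ⟨h0, h1⟩ := posPart_one_sub_div_mem hδ ht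
  have h2 : 1 - t / δ ≤ max (1 - t / δ) 0 := le_max_left _ _
  set q := max (1 - t / δ) 0 with hq
  have h3 : 1 - q ^ 3 ≤ 3 * (1 - q) := by nlinarith [sq_nonneg (q - 1), sq_nonneg q]
  have h4 : δ * (1 - q) ≤ t := by
    have : 1 - q ≤ t / δ := by linarith
    calc δ * (1 - q) ≤ δ * (t / δ) := mul_le_mul_of_nonneg_left this hδ.le
      _ = t := by field_simp
  unfold capAt
  rw [← hq]
  nlinarith

lemma lap_capAt {δ : ℝ} (hδ : 0 < δ) {ζ : Euc N → ℝ} (hζ : ContDiff ℝ 2 ζ) (x : Euc N) :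
    lap (fun y => capAt δ (ζ y)) x = -(6 / δ) * max (1 - ζ x / δ) 0 * ‖gradient ζ x‖ ^ 2 +
      3 * max (1 - ζ x / δ) 0 ^ 2 * lap ζ x :=
  lap_comp_real (hasDerivAt_capAt hδ) hasDerivAt_capAt_deriv (contDiff_capAt δ) hζ x

lemma barrier_estimate {m M S δ q B L I G P n : ℝ} (hδ : 0 < δ) (hM0 : 0 ≤ M) (hS0 : 0 ≤ S)
    (hn : 1 ≤ n) (hδK : 3 * (S ^ 2 + 1) * M + 12 * M * S + 1 ≤ 6 * m ^ 2 / δ) (hq0 : 0 ≤ q)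
    (hq1 : q ≤ 1) (hB1 : 1 ≤ B) (hB2 : B ≤ S ^ 2 + 1) (hgrad : m ^ 2 * q ≤ G * q) (hG : 0 ≤ G)
    (hl : |L| ≤ M) (hI : |I| ≤ M * (2 * S)) (hcap : δ * (1 - q) ≤ P) :
    min 1 (2 * δ) ≤ -(P * -(2 * n) + 2 * (3 * q ^ 2 * I) +
      B * (-(6 / δ) * q * G + 3 * q ^ 2 * L)) := by
  have hqq : q ^ 2 ≤ q := by nlinarith
  have hP0 : 0 ≤ P := le_trans (mul_nonneg hδ.le (by linarith)) hcap
  have t1 : (3 * (S ^ 2 + 1) * M + 12 * M * S + 1) * q ≤ B * (6 / δ * q * G) := by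
    have a1 : 6 * m ^ 2 / δ * q ≤ 6 / δ * q * G := by
      have : 6 / δ * (m ^ 2 * q) ≤ 6 / δ * (G * q) :=
        mul_le_mul_of_nonneg_left hgrad (by positivity)
      calc _ = 6 / δ * (m ^ 2 * q) := by ring
        _ ≤ _ := this
        _ = _ := by ring
    have a2 := mul_le_mul_of_nonneg_right hδK hq0
    have a3 : 0 ≤ 6 / δ * q * G := by positivity
    exact (a2.trans a1).trans (le_mul_of_one_le_left a3 hB1)
  have t2 : B * (3 * q ^ 2 * L) ≤ 3 * (S ^ 2 + 1) * M * q := by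
    have a1 : 3 * q ^ 2 * L ≤ 3 * q * M := by
      have : q ^ 2 * L ≤ q * M :=
        (mul_le_mul_of_nonneg_left ((le_abs_self L).trans hl) (sq_nonneg q)).trans
          (mul_le_mul_of_nonneg_right hqq hM0)
      linarith
    have a2 : 0 ≤ 3 * q * M := by positivity
    calc B * (3 * q ^ 2 * L) ≤ B * (3 * q * M) := mul_le_mul_of_nonneg_left a1 (by linarith)
      _ ≤ (S ^ 2 + 1) * (3 * q * M) := mul_le_mul_of_nonneg_right hB2 a2
      _ = _ := by ring
  have t3 : 2 * (3 * q ^ 2 * I) ≤ 12 * M * S * q := by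
    have : q ^ 2 * I ≤ q * (M * (2 * S)) :=
      (mul_le_mul_of_nonneg_left ((le_abs_self I).trans hI) (sq_nonneg q)).trans
        (mul_le_mul_of_nonneg_right hqq (by positivity))
    linarith
  have t4 : 2 * (δ * (1 - q)) ≤ P * (2 * n) := by
    have : P * 1 ≤ P * n := mul_le_mul_of_nonneg_left hn hP0
    linarith
  have t5 : min 1 (2 * δ) ≤ q + 2 * (δ * (1 - q)) := by
    have a1 := mul_le_mul_of_nonneg_left (min_le_left (1 : ℝ) (2 * δ)) hq0
    have a2 := mul_le_mul_of_nonneg_left (min_le_right (1 : ℝ) (2 * δ)) (sub_nonneg.2 hq1)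
    linarith
  linarith

namespace IsDefining

variable {Ω : Set (Euc N)} {ζ : Euc N → ℝ}

lemma testFun_capAt (h : IsDefining Ω ζ) (δ : ℝ) : TestFun Ω (fun y => capAt δ (ζ y)) :=
  ⟨(contDiff_capAt δ).comp h.contDiff, fun x hx => by simp [capAt, h.eq_zero x hx]⟩

/-- A strictly superharmonic test function comparable with `ζ`. -/
lemma exists_barrier (h : IsDefining Ω ζ) (hb : Bornology.IsBounded Ω) (i : Fin N) :
    ∃ b, TestFun Ω b ∧ ∃ c, 0 < c ∧ (∀ x ∈ Ω, c ≤ -lap b x) ∧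
      ∃ C, 0 ≤ C ∧ ∀ x ∈ Ω, 0 ≤ b x ∧ b x ≤ C * ζ x := by
  obtain ⟨m, hm, hmin⟩ := h.exists_le_add hb
  obtain ⟨R, hR⟩ := hb.subset_closedBall 0
  have hcl := hb.isCompact_closure
  obtain ⟨M₁, hM₁⟩ := hcl.exists_bound_of_continuousOn (continuous_lap h.contDiff).continuousOn
  obtain ⟨M₂, hM₂⟩ := hcl.exists_bound_of_continuousOn
    (continuous_gradient (h.contDiff.of_le (by norm_num))).continuousOn
  set M := max (max M₁ M₂) 0 with hM
  have hM0 : 0 ≤ M := le_max_right _ _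
  set S := max R 0 with hS
  have hS0 : 0 ≤ S := le_max_right _ _
  set K := 3 * (S ^ 2 + 1) * M + 12 * M * S with hK
  have hK0 : 0 ≤ K := by positivity
  have hN : (1 : ℝ) ≤ N := by exact_mod_cast i.pos
  set δ := min m (6 * m ^ 2 / (K + 1)) with hδd
  have hδ : 0 < δ := lt_min hm (by positivity)
  have hδK : K + 1 ≤ 6 * m ^ 2 / δ := by
    rw [le_div_iff₀ hδ]
    have h1 : δ ≤ 6 * m ^ 2 / (K + 1) := min_le_right _ _
    rw [le_div_iff₀ (by positivity)] at h1
    linarith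
  have hBc : ContDiff ℝ 2 (fun y : Euc N => S ^ 2 + 1 - ‖y - 0‖ ^ 2) := contDiff_sub_normSq _ _
  have hBx : ∀ x ∈ Ω, 1 ≤ S ^ 2 + 1 - ‖x - 0‖ ^ 2 ∧ S ^ 2 + 1 - ‖x - 0‖ ^ 2 ≤ S ^ 2 + 1 ∧
      ‖x - 0‖ ≤ S := by
    intro x hx
    have h1 : ‖x - 0‖ ≤ S := by
      have := hR hx
      rw [mem_closedBall, dist_eq_norm] at this
      exact this.trans (le_max_left _ _)
    have h2 := norm_nonneg (x - 0)
    refine ⟨by nlinarith, by nlinarith, h1⟩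
  refine ⟨fun y => capAt δ (ζ y) * (S ^ 2 + 1 - ‖y - 0‖ ^ 2),
    ⟨(h.testFun_capAt δ).1.mul hBc, fun x hx => by
      have := (h.testFun_capAt δ).2 x hx
      simp only at this ⊢
      rw [this, zero_mul]⟩, min 1 (2 * δ), by positivity,
    fun x hx => ?_, 3 * (S ^ 2 + 1), by positivity, fun x hx => ⟨?_, ?_⟩⟩
  · obtain ⟨hB1, hB2, hxS⟩ := hBx x hx
    have hζ := h.pos x hx
    obtain ⟨hq0, hq1⟩ := posPart_one_sub_div_mem hδ hζ.le
    have hcap := mul_one_sub_le_capAt hδ hζ.le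
    have hgrad : m ^ 2 * max (1 - ζ x / δ) 0 ≤ ‖gradient ζ x‖ ^ 2 * max (1 - ζ x / δ) 0 := by
      rcases le_or_gt δ (ζ x) with hc | hc
      · rw [max_eq_right (by rw [sub_nonpos, one_le_div hδ]; exact hc)]; simp
      · refine mul_le_mul_of_nonneg_right ?_ hq0
        refine pow_le_pow_left₀ hm.le ?_ 2
        linarith [hmin x hx, hc.trans_le (min_le_left _ _)]
    have hl : |lap ζ x| ≤ M :=
      (hM₁ x (subset_closure hx)).trans ((le_max_left _ _).trans (le_max_left _ _))
    have hg : ‖gradient ζ x‖ ≤ M :=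
      (hM₂ x (subset_closure hx)).trans ((le_max_right _ _).trans (le_max_left _ _))
    have hinner : |inner ℝ (gradient ζ x) (-(2 : ℝ) • (x - 0))| ≤ M * (2 * S) := by
      refine (abs_real_inner_le_norm _ _).trans (mul_le_mul hg ?_ (norm_nonneg _) hM0)
      rw [norm_smul]
      norm_num at hxS ⊢
      exact hxS
    rw [lap_fun_mul (h.testFun_capAt δ).1 hBc, lap_capAt hδ h.contDiff, lap_sub_normSq,
      gradient_sub_normSq, gradient_comp_real (hasDerivAt_capAt hδ)
        (h.contDiff.differentiable (by norm_num) x), inner_smul_left]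
    simp only [conj_trivial]
    exact barrier_estimate hδ hM0 hS0 hN hδK hq0 hq1 hB1 hB2 hgrad (sq_nonneg _) hl hinner hcap
  · exact mul_nonneg (capAt_nonneg hδ (h.pos x hx).le) (by linarith [(hBx x hx).1])
  · have h1 := capAt_le_mul hδ (h.pos x hx).le
    have h2 := capAt_nonneg hδ (h.pos x hx).le
    obtain ⟨hB1, hB2, -⟩ := hBx x hx
    calc _ ≤ 3 * ζ x * (S ^ 2 + 1) := mul_le_mul h1 hB2 (by linarith) (by linarith [h.pos x hx])
      _ = _ := by ring

end IsDefining

/-- An increasing sequence of nonnegative integrable functions with bounded integrals has an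
integrable limit. -/
lemma exists_integrable_limit_of_monotone {α : Type*} {m : MeasurableSpace α} {ν : Measure α}
    {f : ℕ → α → ℝ} (h_integrable : ∀ n, Integrable (f n) ν) (hnn : ∀ n, ∀ᵐ x ∂ν, 0 ≤ f n x)
    (hmono : ∀ n, ∀ᵐ x ∂ν, f n x ≤ f (n + 1) x) {C : ℝ} (hC : ∀ n, ∫ x, f n x ∂ν ≤ C) :
    ∃ v, Integrable v ν ∧ ∀ᵐ x ∂ν, (∀ n, 0 ≤ f n x ∧ f n x ≤ v x) ∧
      Tendsto (fun n => f n x) atTop (𝓝 (v x)) := by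
  have hmeas : ∀ n, AEMeasurable (fun x => ENNReal.ofReal (f n x)) ν := fun n =>
    (h_integrable n).aemeasurable.ennreal_ofReal
  have hm : ∀ᵐ x ∂ν, Monotone fun n => f n x := by
    filter_upwards [ae_all_iff.2 hmono] with x hx
    exact monotone_nat_of_le_succ hx
  have hsup : ∫⁻ x, ⨆ n, ENNReal.ofReal (f n x) ∂ν ≠ ∞ := by
    rw [lintegral_iSup' hmeas]
    · refine ne_top_of_le_ne_top (ofReal_ne_top (r := C)) (iSup_le fun n => ?_)
      rw [← ofReal_integral_eq_lintegral_ofReal (h_integrable n) (hnn n)]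
      exact ENNReal.ofReal_le_ofReal (hC n)
    · filter_upwards [hm] with x hx i j hij
      exact ENNReal.ofReal_le_ofReal (hx hij)
  have hmeas' : AEMeasurable (fun x => ⨆ n, ENNReal.ofReal (f n x)) ν := AEMeasurable.iSup hmeas
  refine ⟨fun x => (⨆ n, ENNReal.ofReal (f n x)).toReal,
    integrable_toReal_of_lintegral_ne_top hmeas' hsup, ?_⟩
  filter_upwards [hm, ae_all_iff.2 hnn, ae_lt_top' hmeas' hsup] with x h1 h2 h3
  have h4 : ∀ n, f n x ≤ (⨆ n, ENNReal.ofReal (f n x)).toReal := fun n =>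
    (ENNReal.ofReal_le_iff_le_toReal h3.ne).1 (le_iSup (fun n => ENNReal.ofReal (f n x)) n)
  refine ⟨fun n => ⟨h2 n, h4 n⟩, ?_⟩
  have h5 : Tendsto (fun n => ENNReal.ofReal (f n x)) atTop (𝓝 (⨆ n, ENNReal.ofReal (f n x))) :=
    tendsto_atTop_iSup fun i j hij => ENNReal.ofReal_le_ofReal (h1 hij)
  refine ((ENNReal.tendsto_toReal h3.ne).comp h5).congr fun n => ?_
  exact ENNReal.toReal_ofReal (h2 n)

/-- A bounded function vanishing outside a bounded set is square integrable. -/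
lemma memLp_two_of_bounded {Ω : Set (Euc N)} (hΩ : IsOpen Ω) (hb : Bornology.IsBounded Ω)
    {F : Euc N → ℝ} (hF : AEStronglyMeasurable F volume) (C : ℝ) (hC : ∀ x, |F x| ≤ C)
    (h0 : ∀ᵐ x, x ∉ Ω → F x = 0) : MemLp F 2 volume := by
  have h1 : MemLp (Ω.indicator fun _ => C) 2 (volume : Measure (Euc N)) :=
    memLp_indicator_const 2 hΩ.measurableSet C (Or.inr hb.measure_lt_top.ne)
  refine h1.of_le hF ?_
  filter_upwards [h0] with x hx
  by_cases hxΩ : x ∈ Ω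
  · rw [indicator_of_mem hxΩ]
    exact (hC x).trans (le_abs_self C)
  · simp [hx hxΩ]

/-- `v` is the `H¹₀(Ω)` solution of `-Δv = F` with `F ∈ L²`. -/
def HSol (Ω : Set (Euc N)) (v F : Euc N → ℝ) : Prop :=
  MemLp F 2 volume ∧ ∃ V, MemH Ω v V ∧ ∀ ψ Ψ, MemH Ω ψ Ψ →
    ∫ x, (inner ℝ (V x) (Ψ x) : ℝ) = ∫ x, F x * ψ x

namespace HSol

variable {Ω : Set (Euc N)} {v w F G : Euc N → ℝ}

lemma memLp (h : HSol Ω v F) : MemLp v 2 volume := by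
  obtain ⟨-, V, hV, -⟩ := h
  exact hV.1

lemma ae_eq_zero (h : HSol Ω v F) : ∀ᵐ x, x ∉ Ω → v x = 0 := by
  obtain ⟨-, V, hV, -⟩ := h
  filter_upwards [hV.ae_eq_zero] with x hx hxΩ
  exact (hx hxΩ).1

lemma integrableOn (h : HSol Ω v F) (hb : Bornology.IsBounded Ω) : IntegrableOn v Ω := by
  have : IsFiniteMeasure (volume.restrict Ω) := ⟨by simpa using hb.measure_lt_top⟩
  exact (h.memLp.restrict Ω).integrable (by norm_num)

lemma exists_of_memLp (hb : Bornology.IsBounded Ω) (i : Fin N) (hF : MemLp F 2 volume) :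
    ∃ v, HSol Ω v F := by
  obtain ⟨R, hR⟩ := hb.subset_closedBall 0
  obtain ⟨v, V, hV, h⟩ := exists_memH_solution (Ω := Ω) (R := R)
    (fun x hx => by simpa using hR hx) i (G := fun x _ => F x) (L := 0) (fun a _ => hF.1) (by simp)
    (fun x s t _ => le_rfl) hF
  exact ⟨v, hF, V, hV, h⟩

lemma integral_mul_comm (h : HSol Ω v F) (h' : HSol Ω w G) :
    ∫ x, F x * w x = ∫ x, G x * v x := by
  obtain ⟨-, V, hV, hV'⟩ := h
  obtain ⟨-, W, hW, hW'⟩ := h'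
  rw [← hV' w W hW, ← hW' v V hV]
  exact integral_congr_ae (Eventually.of_forall fun x => real_inner_comm _ _)

lemma le_of_le (hb : Bornology.IsBounded Ω) (i : Fin N) (h : HSol Ω v F) (h' : HSol Ω w G)
    (hFG : ∀ᵐ x, w x < v x → F x ≤ G x) : ∀ᵐ x, v x ≤ w x := by
  obtain ⟨R, hR⟩ := hb.subset_closedBall 0
  obtain ⟨hF, V, hV, hV'⟩ := h
  obtain ⟨hG, W, hW, hW'⟩ := h'
  have := (hV.sub hW).ae_nonpos (R := R) (fun x hx => by simpa using hR hx) i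
    (F := fun x => F x - G x) (fun ψ Ψ hψ => ?_) ?_
  · filter_upwards [this] with x hx
    rw [Pi.sub_apply] at hx
    linarith
  · have e1 : ∀ x, (inner ℝ ((V - W) x) (Ψ x) : ℝ) = inner ℝ (V x) (Ψ x) - inner ℝ (W x) (Ψ x) :=
      fun x => by rw [Pi.sub_apply, inner_sub_left]
    simp_rw [e1, sub_mul]
    rw [integral_sub (memLp_two_integrable_inner hV.2.1 hψ.2.1)
      (memLp_two_integrable_inner hW.2.1 hψ.2.1), hV' ψ Ψ hψ, hW' ψ Ψ hψ]
    exact (integral_sub (hF.integrable_mul hψ.1) (hG.integrable_mul hψ.1)).symm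
  · filter_upwards [hFG] with x hx hlt
    rw [Pi.sub_apply] at hlt
    linarith [hx (by linarith)]

lemma nonneg (hb : Bornology.IsBounded Ω) (i : Fin N) (h : HSol Ω v F) (hF : ∀ᵐ x, 0 ≤ F x) :
    ∀ᵐ x, 0 ≤ v x := by
  obtain ⟨R, hR⟩ := hb.subset_closedBall 0
  obtain ⟨hF2, V, hV, hV'⟩ := h
  have h0 : HSol Ω (v - v) 0 := by
    refine ⟨MemLp.zero, V - V, hV.sub hV, fun ψ Ψ _ => ?_⟩
    simp
  have h1 := h0.le_of_le hb i ⟨hF2, V, hV, hV'⟩ (by filter_upwards [hF] with x hx _; exact hx)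
  filter_upwards [h1] with x hx
  simpa using hx

lemma integral_mul_neg_lap (hΩ : IsOpen Ω) (hb : Bornology.IsBounded Ω) (i : Fin N)
    (h : HSol Ω v F) {φ : Euc N → ℝ} (hφ : TestFun Ω φ) :
    ∫ x in Ω, v x * -(lap φ x) = ∫ x in Ω, F x * φ x := by
  obtain ⟨-, V, hV, hV'⟩ := h
  have h1 := hV' _ _ (hφ.memH hΩ hb i)
  have e1 : ∀ x, (inner ℝ (V x) (Ω.indicator (gradient φ) x) : ℝ) =
      Ω.indicator (fun x => inner ℝ (V x) (gradient φ x)) x := fun x => by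
    by_cases hx : x ∈ Ω <;> simp [hx]
  have e2 : ∀ x, F x * Ω.indicator φ x = Ω.indicator (fun x => F x * φ x) x := fun x => by
    by_cases hx : x ∈ Ω <;> simp [hx]
  simp_rw [e1, e2] at h1
  rw [integral_indicator hΩ.measurableSet, integral_indicator hΩ.measurableSet] at h1
  rw [← h1, hV.integral_inner_gradient hΩ hb hφ.1]

end HSol

lemma TestFun.continuous {Ω : Set (Euc N)} {φ : Euc N → ℝ} (hφ : TestFun Ω φ) : Continuous φ :=
  hφ.1.continuous

lemma exists_bound_on {Ω : Set (Euc N)} (hb : Bornology.IsBounded Ω) {φ : Euc N → ℝ}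
    (hφ : Continuous φ) : ∃ C, 0 ≤ C ∧ ∀ x ∈ Ω, |φ x| ≤ C := by
  obtain ⟨C, hC⟩ := hb.isCompact_closure.exists_bound_of_continuousOn hφ.continuousOn
  exact ⟨max C 0, le_max_right _ _, fun x hx => (hC x (subset_closure hx)).trans (le_max_left _ _)⟩

lemma integrableOn_mul_continuous {Ω : Set (Euc N)} (hΩ : IsOpen Ω)
    (hb : Bornology.IsBounded Ω) {z φ : Euc N → ℝ} (hz : IntegrableOn z Ω) (hφ : Continuous φ) :
    IntegrableOn (fun x => z x * φ x) Ω := by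
  obtain ⟨C, -, hC⟩ := exists_bound_on hb hφ
  exact Integrable.mul_bdd (c := C) hz hφ.aestronglyMeasurable
    ((ae_restrict_iff' hΩ.measurableSet).2 (Eventually.of_forall hC))

lemma IsDefining.exists_integral_le {Ω : Set (Euc N)} {ζ : Euc N → ℝ} (hζ : IsDefining Ω ζ)
    (hΩ : IsOpen Ω) (hb : Bornology.IsBounded Ω) (i : Fin N) :
    ∃ C, 0 ≤ C ∧ ∀ v F, HSol Ω v F → (∀ᵐ x, 0 ≤ F x) →
      ∫ x in Ω, v x ≤ C * ∫ x in Ω, F x * ζ x := by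
  obtain ⟨b, hbT, c, hc, hlap, C, hC, hbC⟩ := hζ.exists_barrier hb i
  refine ⟨C / c, by positivity, fun v F h hF => ?_⟩
  have hFi : IntegrableOn F Ω := by
    have : IsFiniteMeasure (volume.restrict Ω) := ⟨by simpa using hb.measure_lt_top⟩
    exact (h.1.restrict Ω).integrable (by norm_num)
  have h1 : c * ∫ x in Ω, v x ≤ ∫ x in Ω, v x * -(lap b x) := by
    rw [← integral_const_mul]
    refine integral_mono_ae ((h.integrableOn hb).const_mul c)
      (integrableOn_mul_continuous hΩ hb (h.integrableOn hb) (continuous_lap hbT.1).neg) ?_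
    filter_upwards [ae_restrict_mem hΩ.measurableSet, ae_restrict_of_ae (h.nonneg hb i hF)]
      with x hx hv
    rw [mul_comm]
    exact mul_le_mul_of_nonneg_left (hlap x hx) hv
  have h2 : ∫ x in Ω, F x * b x ≤ C * ∫ x in Ω, F x * ζ x := by
    rw [← integral_const_mul]
    refine integral_mono_ae (integrableOn_mul_continuous hΩ hb hFi hbT.continuous)
      ((integrableOn_mul_continuous hΩ hb hFi hζ.contDiff.continuous).const_mul C) ?_
    filter_upwards [ae_restrict_mem hΩ.measurableSet, ae_restrict_of_ae hF] with x hx hv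
    calc F x * b x ≤ F x * (C * ζ x) := mul_le_mul_of_nonneg_left (hbC x hx).2 hv
      _ = _ := by ring
  rw [h.integral_mul_neg_lap hΩ hb i hbT] at h1
  rw [div_mul_eq_mul_div, le_div_iff₀ hc]
  linarith

/-- The mollification of a measure. -/
def smear (t : ℝ) (ν : Measure (Euc N)) (y : Euc N) : ℝ := ∫ x, moll t (y - x) ∂ν

lemma abs_moll_le {t : ℝ} (ht : 0 < t) (y : Euc N) :
    ‖moll t y‖ ≤ (∫ x : Euc N, mollKer 1 x)⁻¹ * (t ^ N)⁻¹ := by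
  rw [Real.norm_of_nonneg (moll_nonneg ht.le y)]
  exact moll_le ht y

lemma continuous_uncurry_moll (t : ℝ) :
    Continuous fun p : Euc N × Euc N => moll t (p.1 - p.2) :=
  (continuous_moll t).comp (continuous_fst.sub continuous_snd)

section smear

variable {Ω : Set (Euc N)} {ν : Measure (Euc N)} {t : ℝ}

lemma measurable_smear [IsFiniteMeasure ν] : StronglyMeasurable (smear t ν) :=
  (continuous_uncurry_moll t).stronglyMeasurable.integral_prod_right

lemma smear_nonneg (ht : 0 < t) (y : Euc N) : 0 ≤ smear t ν y :=
  integral_nonneg fun _ => moll_nonneg ht.le _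

lemma abs_smear_le [IsFiniteMeasure ν] (ht : 0 < t) (y : Euc N) :
    |smear t ν y| ≤ (∫ x : Euc N, mollKer 1 x)⁻¹ * (t ^ N)⁻¹ * ν.real univ :=
  norm_integral_le_of_norm_le_const (Eventually.of_forall fun _ => abs_moll_le ht _)

lemma smear_eq_zero (ht : 0 < t) (hν : ∀ᵐ x ∂ν, ball x t ⊆ Ω) {y : Euc N} (hy : y ∉ Ω) :
    smear t ν y = 0 := by
  refine integral_eq_zero_of_ae ?_
  filter_upwards [hν] with x hx
  refine moll_eq_zero ht.le (not_lt.1 fun h => hy (hx ?_))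
  rwa [mem_ball, dist_eq_norm]

lemma memLp_smear [IsFiniteMeasure ν] (hΩ : IsOpen Ω) (hb : Bornology.IsBounded Ω) (ht : 0 < t)
    (hν : ∀ᵐ x ∂ν, ball x t ⊆ Ω) : MemLp (smear t ν) 2 volume :=
  memLp_two_of_bounded hΩ hb measurable_smear.aestronglyMeasurable _ (abs_smear_le ht)
    (Eventually.of_forall fun _ h => smear_eq_zero ht hν h)

lemma integrable_mul_moll_prod [IsFiniteMeasure ν] {z : Euc N → ℝ} (hz : IntegrableOn z Ω) (ht : 0 < t) :
    Integrable (fun p : Euc N × Euc N => z p.1 * moll t (p.1 - p.2))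
      ((volume.restrict Ω).prod ν) :=
  (hz.comp_fst ν).mul_bdd (c := (∫ x : Euc N, mollKer 1 x)⁻¹ * (t ^ N)⁻¹)
    (continuous_uncurry_moll t).aestronglyMeasurable
    (Eventually.of_forall fun _ => abs_moll_le ht _)

lemma integrable_mollify [IsFiniteMeasure ν] {z : Euc N → ℝ} (hz : IntegrableOn z Ω) (ht : 0 < t) :
    Integrable (mollify Ω z t) ν :=
  (integrable_mul_moll_prod hz ht).integral_prod_right

lemma integral_smear_mul [IsFiniteMeasure ν] {z : Euc N → ℝ} (hz : IntegrableOn z Ω) (ht : 0 < t) :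
    ∫ y in Ω, smear t ν y * z y = ∫ x, mollify Ω z t x ∂ν := by
  have := integral_integral_swap (f := fun y x => z y * moll t (y - x))
    (integrable_mul_moll_prod (ν := ν) hz ht)
  simp_rw [integral_const_mul] at this
  simp only [smear, mollify]
  rw [← this]
  exact integral_congr_ae (Eventually.of_forall fun y => mul_comm _ _)

end smear

section testfun

variable {Ω : Set (Euc N)} {φ : Euc N → ℝ}

lemma mollify_sub (hφ : IntegrableOn φ Ω) {t : ℝ} (ht : 0 < t) {x : Euc N}
    (hball : ball x t ⊆ Ω) :
    mollify Ω φ t x - φ x = ∫ y in Ω, (φ y - φ x) * moll t (y - x) := by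
  have h1 : ∫ y in Ω, moll t (y - x) = 1 := by
    rw [setIntegral_eq_integral_of_forall_compl_eq_zero fun y hy => ?_, integral_moll_sub ht x]
    refine moll_eq_zero ht.le (not_lt.1 fun h => hy (hball ?_))
    rwa [mem_ball, dist_eq_norm]
  simp_rw [sub_mul]
  rw [integral_sub (integrableOn_mul_moll hφ ht x)
    ((integrable_moll_sub ht.le x).integrableOn.const_mul _), integral_const_mul, h1, mul_one,
    mollify]

lemma abs_mollify_sub_le (hφ : IntegrableOn φ Ω) {t : ℝ} (ht : 0 < t) {x : Euc N}
    (hball : ball x t ⊆ Ω) {C : ℝ} (hC : ∀ y ∈ ball x t, |φ y - φ x| ≤ C) :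
    |mollify Ω φ t x - φ x| ≤ C := by
  have hC0 : 0 ≤ C := (abs_nonneg _).trans (hC x (mem_ball_self ht))
  rw [mollify_sub hφ ht hball, ← Real.norm_eq_abs]
  calc ‖∫ y in Ω, (φ y - φ x) * moll t (y - x)‖
      ≤ ∫ y in Ω, C * moll t (y - x) := by
        refine norm_integral_le_of_norm_le ((integrable_moll_sub ht.le x).integrableOn.const_mul _)
          (Eventually.of_forall fun y => ?_)
        rw [norm_mul, Real.norm_of_nonneg (moll_nonneg ht.le _)]
        by_cases h : t ≤ ‖y - x‖
        · simp [moll_eq_zero ht.le h]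
        · exact mul_le_mul_of_nonneg_right (hC y (by rw [mem_ball, dist_eq_norm]; exact not_le.1 h))
            (moll_nonneg ht.le _)
    _ ≤ ∫ y, C * moll t (y - x) :=
        setIntegral_le_integral ((integrable_moll_sub ht.le x).const_mul _)
          (Eventually.of_forall fun y => mul_nonneg hC0 (moll_nonneg ht.le _))
    _ = C := by rw [integral_const_mul, integral_moll_sub ht, mul_one]

lemma tendsto_mollify_of_continuous (hΩ : IsOpen Ω) (hφi : IntegrableOn φ Ω) (hφ : Continuous φ)
    {x : Euc N} (hx : x ∈ Ω) :
    Tendsto (fun t => mollify Ω φ t x) (𝓝[>] 0) (𝓝 (φ x)) := by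
  rw [Metric.tendsto_nhds]
  intro ε hε
  obtain ⟨r, hr, hball⟩ := Metric.isOpen_iff.1 hΩ x hx
  obtain ⟨s, hs, hφs⟩ := Metric.continuous_iff.1 hφ x (ε / 2) (half_pos hε)
  filter_upwards [Ioo_mem_nhdsGT (lt_min hr hs)] with t ht
  rw [Real.dist_eq]
  refine (abs_mollify_sub_le hφi ht.1 ((ball_subset_ball
    (ht.2.le.trans (min_le_left _ _))).trans hball) (C := ε / 2) fun y hy => ?_).trans_lt
    (half_lt_self hε)
  exact (hφs y ((mem_ball.1 hy).trans (ht.2.trans_le (min_le_right _ _)))).le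

lemma abs_mollify_le (hΩ : IsOpen Ω) {C : ℝ} (hC : 0 ≤ C)
    (hφρ : ∀ x ∈ Ω, |φ x| ≤ C * rho Ω x) {t : ℝ} (ht : 0 < t) {x : Euc N}
    (htx : t ≤ rho Ω x) : |mollify Ω φ t x| ≤ 2 * C * rho Ω x := by
  rw [mollify, ← Real.norm_eq_abs]
  calc ‖∫ y in Ω, φ y * moll t (y - x)‖
      ≤ ∫ y in Ω, (2 * C * rho Ω x) * moll t (y - x) := by
        refine norm_integral_le_of_norm_le ((integrable_moll_sub ht.le x).integrableOn.const_mul _)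
          ((ae_restrict_iff' hΩ.measurableSet).2 (Eventually.of_forall fun y hy => ?_))
        rw [norm_mul, Real.norm_of_nonneg (moll_nonneg ht.le _)]
        by_cases h : t ≤ ‖y - x‖
        · simp [moll_eq_zero ht.le h]
        · refine mul_le_mul_of_nonneg_right ((hφρ y hy).trans ?_) (moll_nonneg ht.le _)
          have : rho Ω y ≤ rho Ω x + dist y x := infDist_le_infDist_add_dist
          rw [dist_eq_norm] at this
          nlinarith
    _ ≤ ∫ y, (2 * C * rho Ω x) * moll t (y - x) :=
        setIntegral_le_integral ((integrable_moll_sub ht.le x).const_mul _)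
          (Eventually.of_forall fun y => mul_nonneg
            (mul_nonneg (by positivity) (rho_nonneg Ω x)) (moll_nonneg ht.le _))
    _ = _ := by rw [integral_const_mul, integral_moll_sub ht, mul_one]

end testfun

/-- An exhaustion of `Ω` by sets at positive distance from the boundary. -/
def exhaust (Ω : Set (Euc N)) (n : ℕ) : Set (Euc N) := {x ∈ Ω | 2 * (1 / ((n : ℝ) + 1)) ≤ rho Ω x}

section exhaust

variable {Ω : Set (Euc N)}

lemma measurableSet_exhaust (hΩ : IsOpen Ω) (n : ℕ) : MeasurableSet (exhaust Ω n) :=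
  hΩ.measurableSet.inter (measurableSet_le measurable_const (continuous_rho Ω).measurable)

lemma one_div_succ_antitone {m n : ℕ} (h : m ≤ n) : 1 / ((n : ℝ) + 1) ≤ 1 / ((m : ℝ) + 1) :=
  one_div_le_one_div_of_le (by positivity) (by simpa using h)

lemma exhaust_mono {m n : ℕ} (h : m ≤ n) : exhaust Ω m ⊆ exhaust Ω n := fun _ hx =>
  ⟨hx.1, (mul_le_mul_of_nonneg_left (one_div_succ_antitone h) two_pos.le).trans hx.2⟩

lemma one_div_succ_le_rho {n : ℕ} {x : Euc N} (hx : x ∈ exhaust Ω n) :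
    1 / ((n : ℝ) + 1) ≤ rho Ω x := by
  have : (0 : ℝ) < 1 / ((n : ℝ) + 1) := by positivity
  linarith [hx.2]

lemma ball_subset_of_mem_exhaust (hΩ : IsOpen Ω) {n : ℕ} {x : Euc N} (hx : x ∈ exhaust Ω n) :
    ball x (1 / ((n : ℝ) + 1)) ⊆ Ω :=
  (ball_subset_ball (one_div_succ_le_rho hx)).trans (ball_rho_subset hΩ hx.1)

lemma MemMrho.integrable_rho {μ : Measure (Euc N)} (hμ : MemMrho Ω μ) : Integrable (rho Ω) μ :=
  ⟨(continuous_rho Ω).aestronglyMeasurable,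
    (hasFiniteIntegral_iff_ofReal (Eventually.of_forall (rho_nonneg Ω))).2 hμ.2⟩

lemma MemMrho.ae_mem {μ : Measure (Euc N)} (hμ : MemMrho Ω μ) : ∀ᵐ x ∂μ, x ∈ Ω := hμ.1

lemma MemMrho.isFiniteMeasure_restrict {μ : Measure (Euc N)} (hμ : MemMrho Ω μ) (n : ℕ) :
    IsFiniteMeasure (μ.restrict (exhaust Ω n)) := by
  refine ⟨?_⟩
  rw [Measure.restrict_apply_univ]
  refine lt_of_le_of_lt (measure_mono fun x hx => ?_) (hμ.integrable_rho.measure_norm_ge_lt_top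
    (ε := 1 / ((n : ℝ) + 1)) (by positivity))
  exact (one_div_succ_le_rho hx).trans (le_abs_self _)

/-- Bounded approximations of a measure by functions, increasing in the sense of potentials. -/
def approx (Ω : Set (Euc N)) (μ : Measure (Euc N)) (n : ℕ) : Euc N → ℝ :=
  smear (1 / ((n : ℝ) + 1)) (μ.restrict (exhaust Ω n))

variable {μ : Measure (Euc N)}

lemma approx_nonneg (n : ℕ) (x : Euc N) : 0 ≤ approx Ω μ n x := smear_nonneg (by positivity) x

lemma ae_ball_subset (hΩ : IsOpen Ω) (n : ℕ) :
    ∀ᵐ x ∂(μ.restrict (exhaust Ω n)), ball x (1 / ((n : ℝ) + 1)) ⊆ Ω := by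
  filter_upwards [ae_restrict_mem (measurableSet_exhaust hΩ n)] with x hx
  exact ball_subset_of_mem_exhaust hΩ hx

lemma approx_eq_zero (hΩ : IsOpen Ω) (n : ℕ) {x : Euc N} (hx : x ∉ Ω) : approx Ω μ n x = 0 :=
  smear_eq_zero (by positivity) (ae_ball_subset hΩ n) hx

lemma memLp_approx (hΩ : IsOpen Ω) (hb : Bornology.IsBounded Ω) (hμ : MemMrho Ω μ) (n : ℕ) :
    MemLp (approx Ω μ n) 2 volume := by
  have := hμ.isFiniteMeasure_restrict n
  exact memLp_smear hΩ hb (by positivity) (ae_ball_subset hΩ n)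

lemma integral_approx_mul (hμ : MemMrho Ω μ) {z : Euc N → ℝ}
    (hz : IntegrableOn z Ω) (n : ℕ) :
    ∫ y in Ω, approx Ω μ n y * z y = ∫ x in exhaust Ω n, mollify Ω z (1 / ((n : ℝ) + 1)) x ∂μ := by
  have := hμ.isFiniteMeasure_restrict n
  exact integral_smear_mul hz (by positivity)

lemma integral_approx_mul_le (hΩ : IsOpen Ω) (hμ : MemMrho Ω μ) {z : Euc N → ℝ}
    (hz : IntegrableOn z Ω) (hz0 : ∀ᵐ x, 0 ≤ z x)
    (hsup : ∀ η, TestFun Ω η → (∀ y, 0 ≤ η y) → 0 ≤ ∫ y in Ω, z y * -(lap η y)) (n : ℕ) :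
    ∫ y in Ω, approx Ω μ n y * z y ≤ ∫ y in Ω, approx Ω μ (n + 1) y * z y := by
  rw [integral_approx_mul hμ hz, integral_approx_mul hμ hz]
  have hfin := hμ.isFiniteMeasure_restrict n
  have hfin' := hμ.isFiniteMeasure_restrict (n + 1)
  have h_integrable : IntegrableOn (mollify Ω z (1 / (((n + 1 : ℕ) : ℝ) + 1))) (exhaust Ω (n + 1)) μ :=
    integrable_mollify hz (by positivity)
  calc ∫ x in exhaust Ω n, mollify Ω z (1 / ((n : ℝ) + 1)) x ∂μ
      ≤ ∫ x in exhaust Ω n, mollify Ω z (1 / (((n + 1 : ℕ) : ℝ) + 1)) x ∂μ := by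
        refine setIntegral_mono_on (integrable_mollify hz (by positivity))
          (h_integrable.mono_set (exhaust_mono n.le_succ)) (measurableSet_exhaust hΩ n) fun x hx => ?_
        exact mollify_antitone hΩ hz hsup (by positivity) (one_div_succ_antitone n.le_succ)
          (ball_subset_of_mem_exhaust hΩ hx)
    _ ≤ _ := by
        refine setIntegral_mono_set h_integrable (Eventually.of_forall fun x => ?_)
          (LE.le.eventuallyLE (exhaust_mono n.le_succ))
        refine integral_nonneg_of_ae ?_
        filter_upwards [ae_restrict_of_ae hz0] with y hy
        exact mul_nonneg hy (moll_nonneg (by positivity) _)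

lemma setIntegral_approx_mul (hΩ : IsOpen Ω) (z : Euc N → ℝ) (n : ℕ) :
    ∫ y in Ω, approx Ω μ n y * z y = ∫ y, approx Ω μ n y * z y :=
  setIntegral_eq_integral_of_forall_compl_eq_zero fun y hy => by simp [approx_eq_zero hΩ n hy]

lemma HSol.approx_mono (hΩ : IsOpen Ω) (hb : Bornology.IsBounded Ω) (i : Fin N)
    (hμ : MemMrho Ω μ) {n : ℕ} {v v' : Euc N → ℝ} (h : HSol Ω v (approx Ω μ n))
    (h' : HSol Ω v' (approx Ω μ (n + 1))) : ∀ᵐ x, v x ≤ v' x := by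
  set S : Set (Euc N) := {x | v' x < v x} ∩ Ω with hS
  have hSm : NullMeasurableSet S volume :=
    (nullMeasurableSet_lt h'.memLp.1.aemeasurable h.memLp.1.aemeasurable).inter
      hΩ.measurableSet.nullMeasurableSet
  have hψ : MemLp (S.indicator fun _ => (1 : ℝ)) 2 (volume : Measure (Euc N)) := by
    refine memLp_two_of_bounded hΩ hb (aestronglyMeasurable_const.indicator₀ hSm) 1 (fun x => ?_)
      (Eventually.of_forall fun x hx => indicator_of_notMem (fun h => hx h.2) _)
    by_cases hx : x ∈ S <;> simp [hx]
  have hψ0 : ∀ x, 0 ≤ S.indicator (fun _ => (1 : ℝ)) x := fun x =>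
    indicator_nonneg (fun _ _ => zero_le_one) x
  obtain ⟨z, hz⟩ := HSol.exists_of_memLp hb i hψ
  have hle := integral_approx_mul_le hΩ hμ (hz.integrableOn hb)
    (hz.nonneg hb i (Eventually.of_forall hψ0)) (fun η hη hη0 => by
      rw [hz.integral_mul_neg_lap hΩ hb i hη]
      exact integral_nonneg fun x => mul_nonneg (hψ0 x) (hη0 x)) n
  rw [setIntegral_approx_mul hΩ, setIntegral_approx_mul hΩ, h.integral_mul_comm hz,
    h'.integral_mul_comm hz] at hle
  have hi := (hψ.integrable_mul h.memLp).sub (hψ.integrable_mul h'.memLp)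
  have hnn : 0 ≤ (S.indicator fun _ => (1 : ℝ)) * v - (S.indicator fun _ => (1 : ℝ)) * v' := by
    intro x
    by_cases hx : x ∈ S
    · simpa [hx] using hx.1.le
    · simp [hx]
  have hzero : ∫ x, ((S.indicator fun _ => (1 : ℝ)) * v - (S.indicator fun _ => (1 : ℝ)) * v') x
      = 0 := by
    refine le_antisymm ?_ (integral_nonneg hnn)
    rw [integral_sub' (hψ.integrable_mul h.memLp) (hψ.integrable_mul h'.memLp)]
    exact sub_nonpos.2 hle
  rw [integral_eq_zero_iff_of_nonneg hnn hi] at hzero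
  filter_upwards [hzero, h.ae_eq_zero, h'.ae_eq_zero] with x hx h1 h2
  by_contra! hlt
  by_cases hxΩ : x ∈ Ω
  · have hxS : x ∈ S := ⟨hlt, hxΩ⟩
    simp [hxS] at hx
    linarith
  · rw [h1 hxΩ, h2 hxΩ] at hlt
    exact lt_irrefl _ hlt

lemma TestFun.integrable_of_memMrho {φ : Euc N → ℝ} (hφ : TestFun Ω φ)
    (hb : Bornology.IsBounded Ω) (hne : (frontier Ω).Nonempty) (hμ : MemMrho Ω μ) :
    Integrable φ μ := by
  obtain ⟨C, -, hC⟩ := hφ.abs_le_rho hb hne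
  refine (hμ.integrable_rho.const_mul C).mono' hφ.continuous.aestronglyMeasurable ?_
  filter_upwards [hμ.ae_mem] with x hx using hC x hx

lemma integrableOn_of_continuous (hb : Bornology.IsBounded Ω) {φ : Euc N → ℝ}
    (hφ : Continuous φ) : IntegrableOn φ Ω :=
  (hφ.continuousOn.integrableOn_compact hb.isCompact_closure).mono_set subset_closure

lemma exists_integral_approx_le (hΩ : IsOpen Ω) (hb : Bornology.IsBounded Ω)
    (hne : (frontier Ω).Nonempty) (hμ : MemMrho Ω μ) {φ : Euc N → ℝ} (hφ : TestFun Ω φ) :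
    ∃ C, ∀ n, ∫ y in Ω, approx Ω μ n y * φ y ≤ C := by
  obtain ⟨C, hC0, hC⟩ := hφ.abs_le_rho hb hne
  refine ⟨∫ x, 2 * C * rho Ω x ∂μ, fun n => ?_⟩
  have hfin := hμ.isFiniteMeasure_restrict n
  have hφi := integrableOn_of_continuous hb hφ.continuous
  rw [integral_approx_mul hμ hφi]
  calc ∫ x in exhaust Ω n, mollify Ω φ (1 / ((n : ℝ) + 1)) x ∂μ
      ≤ ∫ x in exhaust Ω n, 2 * C * rho Ω x ∂μ :=
        setIntegral_mono_on (integrable_mollify hφi (by positivity))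
          (hμ.integrable_rho.const_mul _).integrableOn (measurableSet_exhaust hΩ n) fun x hx =>
          (le_abs_self _).trans
            (abs_mollify_le hΩ hC0 hC (by positivity) (one_div_succ_le_rho hx))
    _ ≤ _ := setIntegral_le_integral (hμ.integrable_rho.const_mul _)
        (Eventually.of_forall fun x => mul_nonneg (by positivity) (rho_nonneg Ω x))

lemma tendsto_integral_approx_mul (hΩ : IsOpen Ω) (hb : Bornology.IsBounded Ω)
    (hne : (frontier Ω).Nonempty) (hμ : MemMrho Ω μ) {φ : Euc N → ℝ} (hφ : TestFun Ω φ) :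
    Tendsto (fun n => ∫ y in Ω, approx Ω μ n y * φ y) atTop (𝓝 (∫ x, φ x ∂μ)) := by
  obtain ⟨C, hC0, hC⟩ := hφ.abs_le_rho hb hne
  have hφi := integrableOn_of_continuous hb hφ.continuous
  simp_rw [integral_approx_mul hμ hφi, ← integral_indicator (measurableSet_exhaust hΩ _)]
  refine tendsto_integral_of_dominated_convergence (fun x => 2 * C * rho Ω x) (fun n => ?_)
    (hμ.integrable_rho.const_mul _) (fun n => Eventually.of_forall fun x => ?_) ?_
  · have hfin := hμ.isFiniteMeasure_restrict n
    have : IntegrableOn (mollify Ω φ (1 / ((n : ℝ) + 1))) (exhaust Ω n) μ :=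
      integrable_mollify hφi (by positivity)
    exact (this.integrable_indicator (measurableSet_exhaust hΩ n)).1
  · by_cases hx : x ∈ exhaust Ω n
    · rw [indicator_of_mem hx]
      exact abs_mollify_le hΩ hC0 hC (by positivity) (one_div_succ_le_rho hx)
    · rw [indicator_of_notMem hx, norm_zero]
      exact mul_nonneg (by positivity) (rho_nonneg Ω x)
  · filter_upwards [hμ.ae_mem] with x hx
    have hpos : 0 < rho Ω x := by
      rw [rho, ← isClosed_frontier.notMem_iff_infDist_pos hne]
      exact fun h => frontier_subset_compl hΩ h hx
    have h1 : Tendsto (fun n : ℕ => 1 / ((n : ℝ) + 1)) atTop (𝓝[>] 0) :=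
      tendsto_nhdsWithin_iff.2 ⟨tendsto_one_div_add_atTop_nhds_zero_nat,
        Eventually.of_forall fun n => by simp only [mem_Ioi]; positivity⟩
    refine ((tendsto_mollify_of_continuous hΩ hφi hφ.continuous hx).comp h1).congr' ?_
    filter_upwards [tendsto_one_div_add_atTop_nhds_zero_nat.eventually
      (gt_mem_nhds (half_pos hpos))] with n hn
    rw [indicator_of_mem]
    · rfl
    · exact ⟨hx, by linarith⟩

/-- The Green potential of a positive measure is the increasing limit of solutions with
bounded data. -/
lemma exists_monotone_potential (hΩ : IsOpen Ω) (hb : Bornology.IsBounded Ω)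
    (hne : (frontier Ω).Nonempty) (i : Fin N) {ζ : Euc N → ℝ} (hζ : IsDefining Ω ζ)
    (hμ : MemMrho Ω μ) :
    ∃ (f v : ℕ → Euc N → ℝ) (V : Euc N → ℝ), (∀ n, HSol Ω (v n) (f n)) ∧
      (∀ n, ∀ᵐ x, 0 ≤ f n x) ∧ (∀ n, ∀ᵐ x, v n x ≤ v (n + 1) x) ∧ IntegrableOn V Ω ∧
      (∀ᵐ x ∂(volume.restrict Ω), (∀ n, 0 ≤ v n x ∧ v n x ≤ V x) ∧
        Tendsto (fun n => v n x) atTop (𝓝 (V x))) ∧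
      ∀ φ, TestFun Ω φ → ∫ x in Ω, V x * -(lap φ x) = ∫ x, φ x ∂μ := by
  choose v hv using fun n => HSol.exists_of_memLp hb i (memLp_approx hΩ hb hμ n)
  have hf0 : ∀ n, ∀ᵐ x, 0 ≤ approx Ω μ n x := fun n => Eventually.of_forall (approx_nonneg n)
  obtain ⟨C, hC0, hC⟩ := hζ.exists_integral_le hΩ hb i
  obtain ⟨D, hD⟩ := exists_integral_approx_le hΩ hb hne hμ hζ.testFun
  have hmono : ∀ n, ∀ᵐ x, v n x ≤ v (n + 1) x := fun n =>
    (hv n).approx_mono hΩ hb i hμ (hv (n + 1))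
  obtain ⟨V, hV, hV'⟩ := exists_integrable_limit_of_monotone (ν := volume.restrict Ω)
    (fun n => (hv n).integrableOn hb) (fun n => ae_restrict_of_ae ((hv n).nonneg hb i (hf0 n)))
    (fun n => ae_restrict_of_ae (hmono n)) (C := C * D)
    (fun n => (hC _ _ (hv n) (hf0 n)).trans (mul_le_mul_of_nonneg_left (hD n) hC0))
  refine ⟨fun n => approx Ω μ n, v, V, hv, hf0, hmono, hV, hV', fun φ hφ => ?_⟩
  refine tendsto_nhds_unique ?_ (tendsto_integral_approx_mul hΩ hb hne hμ hφ)
  simp_rw [← fun n => (hv n).integral_mul_neg_lap hΩ hb i hφ]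
  have hlap : Continuous fun x => -(lap φ x) := (continuous_lap hφ.1).neg
  refine tendsto_integral_of_dominated_convergence (fun x => ‖V x * -(lap φ x)‖)
    (fun n => (integrableOn_mul_continuous hΩ hb ((hv n).integrableOn hb) hlap).1)
    (integrableOn_mul_continuous hΩ hb hV hlap).norm (fun n => ?_) ?_
  · filter_upwards [hV'] with x hx
    rw [norm_mul, norm_mul]
    refine mul_le_mul_of_nonneg_right ?_ (norm_nonneg _)
    rw [Real.norm_of_nonneg (hx.1 n).1]
    exact (hx.1 n).2.trans (le_abs_self _)
  · filter_upwards [hV'] with x hx using hx.2.mul_const _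

end exhaust

lemma MemG.zero {g : ℝ → ℝ} (hg : MemG g) : g 0 = 0 := by
  have := hg.2.2.1 0
  rw [neg_zero] at this
  linarith

lemma MemG.nonneg {g : ℝ → ℝ} (hg : MemG g) {t : ℝ} (ht : 0 ≤ t) : 0 ≤ g t :=
  hg.zero ▸ hg.2.1 ht

lemma MemG.absFun_eq {g : ℝ → ℝ} (hg : MemG g) (t : ℝ) : absFun g t = g |t| := by
  rcases le_total 0 t with h | h
  · rw [absFun, abs_of_nonneg h, abs_of_nonneg (hg.nonneg h)]
  · rw [absFun, abs_of_nonpos h, hg.2.2.1, abs_of_nonpos]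
    have := hg.2.1 h
    rwa [hg.zero] at this

lemma MemG.exists_shift_le {g : ℝ → ℝ} (hg : MemG g) (hΔ : DeltaTwo (absFun g)) {k : ℝ}
    (hk : 0 < k) (C : ℝ) : ∃ A, 0 ≤ A ∧ ∀ s, 0 ≤ s → g (s + C) ≤ A * (g (s / k) + g 1) := by
  obtain ⟨D, hD, hΔ⟩ := hΔ
  simp only [hg.absFun_eq] at hΔ
  have hdouble : ∀ m : ℕ, ∀ s, 0 < s → g (2 ^ m * s) ≤ (D * 2) ^ m * g s := by
    intro m
    induction m with
    | zero => intro s _; simp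
    | succ m ih =>
      intro s hs
      have h1 := hΔ (2 ^ m * s) (by positivity) (2 ^ m * s) (by positivity)
      rw [abs_of_pos (by positivity), abs_of_pos (by positivity)] at h1
      calc g (2 ^ (m + 1) * s) = g (2 ^ m * s + 2 ^ m * s) := by congr 1; ring
        _ ≤ D * (g (2 ^ m * s) + g (2 ^ m * s)) := h1
        _ = D * 2 * g (2 ^ m * s) := by ring
        _ ≤ D * 2 * ((D * 2) ^ m * g s) := mul_le_mul_of_nonneg_left (ih s hs) (by positivity)
        _ = _ := by ring
  obtain ⟨m, hm⟩ := pow_unbounded_of_one_lt (max k C) (one_lt_two : (1 : ℝ) < 2)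
  refine ⟨(D * 2) ^ m * max D 1, by positivity, fun s hs => ?_⟩
  have h1 : s + C ≤ 2 ^ m * (s / k + 1) := by
    have e : s = k * (s / k) := by field_simp
    have h2 : k * (s / k) ≤ 2 ^ m * (s / k) :=
      mul_le_mul_of_nonneg_right ((le_max_left _ _).trans hm.le) (by positivity)
    have := (le_max_right k C).trans hm.le
    linarith
  have hg1 := hg.nonneg zero_le_one
  have hgs : 0 ≤ g (s / k) := hg.nonneg (by positivity)
  have h3 : g (s / k + 1) ≤ max D 1 * (g (s / k) + g 1) := by
    rcases hs.eq_or_lt with rfl | hs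
    · rw [zero_div, zero_add, hg.zero, zero_add]
      exact le_mul_of_one_le_left hg1 (le_max_right _ _)
    · have h4 := hΔ (s / k) (by positivity) 1 one_pos
      rw [abs_of_pos (by positivity), abs_of_pos (by positivity), abs_one] at h4
      exact h4.trans (mul_le_mul_of_nonneg_right (le_max_left _ _) (by positivity))
  calc g (s + C) ≤ g (2 ^ m * (s / k + 1)) := hg.2.1 h1
    _ ≤ (D * 2) ^ m * g (s / k + 1) := hdouble m _ (by positivity)
    _ ≤ (D * 2) ^ m * (max D 1 * (g (s / k) + g 1)) :=
      mul_le_mul_of_nonneg_left h3 (by positivity)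
    _ = _ := by ring

/-- Two functions with the same distributional Laplacian belong to the same local Orlicz
class. -/
lemma integrableOn_comp_of_memOrliczLoc {Ω : Set (Euc N)} (hΩ : IsOpen Ω) {g : ℝ → ℝ}
    (hg : MemG g) (hΔ : DeltaTwo (absFun g)) {v w : Euc N → ℝ} (hv : IntegrableOn v Ω)
    (hv0 : ∀ᵐ x ∂(volume.restrict Ω), 0 ≤ v x) (hw : IntegrableOn w Ω)
    (hvw : ∀ φ, TestFun Ω φ → ∫ x in Ω, v x * -(lap φ x) = ∫ x in Ω, w x * -(lap φ x))
    (hb : Bornology.IsBounded Ω) (hloc : MemOrliczLoc (absFun g) Ω w) {K : Set (Euc N)}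
    (hK : IsCompact K) (hKΩ : K ⊆ Ω) : IntegrableOn (fun x => g (v x)) K := by
  obtain ⟨r, hr, hrK⟩ := hK.exists_thickening_subset_open hΩ hKΩ
  obtain ⟨C, hC⟩ := exists_bound_of_weakly_harmonic (z := fun x => v x - w x) hΩ (hv.sub hw)
    (fun η hη => by
      have hlap : Continuous fun x => -(lap η x) := (continuous_lap hη.1).neg
      simp_rw [sub_mul]
      rw [integral_sub (integrableOn_mul_continuous hΩ hb hv hlap)
        (integrableOn_mul_continuous hΩ hb hw hlap), hvw η hη, sub_self]) hr
  obtain ⟨hwm, k, hk, hwk⟩ := hloc K hK hKΩ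
  obtain ⟨A, hA, hA'⟩ := hg.exists_shift_le hΔ hk C
  have hfin : IsFiniteMeasure (volume.restrict K) := ⟨by simpa using hK.measure_lt_top⟩
  have h_integrable : Integrable (fun x => g |w x / k|) (volume.restrict K) := by
    simp only [hg.absFun_eq] at hwk
    refine ⟨?_, ?_⟩
    · exact hg.1.comp_aestronglyMeasurable (continuous_abs.comp_aestronglyMeasurable
        (hwm.aemeasurable.div_const k).aestronglyMeasurable)
    · rw [hasFiniteIntegral_iff_ofReal (Eventually.of_forall fun x => hg.nonneg (abs_nonneg _))]
      exact hwk.trans_lt one_lt_top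
  refine ((h_integrable.add (integrable_const (g 1))).const_mul A).mono'
    (hg.1.comp_aestronglyMeasurable (hv.mono_set hKΩ).1) ?_
  filter_upwards [ae_restrict_mem hK.measurableSet, ae_restrict_of_ae hC,
    ae_restrict_of_ae_restrict_of_subset hKΩ hv0] with x hxK hx hx0
  have hball : ball x r ⊆ Ω := (ball_subset_thickening hxK r).trans hrK
  rw [Real.norm_of_nonneg (hg.nonneg hx0), Pi.add_apply, abs_div, abs_of_pos hk]
  refine (hg.2.1 ?_).trans (hA' |w x| (abs_nonneg _))
  have h1 := (abs_le.1 (hx hball)).2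
  linarith [le_abs_self (w x)]

/-- Fatou's lemma for Bochner integrals of nonnegative functions. -/
lemma integrable_and_integral_le_of_tendsto {α : Type*} {m : MeasurableSpace α} {ν : Measure α}
    {F : ℕ → α → ℝ} {f : α → ℝ} {C : ℝ} (hF : ∀ n, Integrable (F n) ν)
    (h0 : ∀ n, ∀ᵐ x ∂ν, 0 ≤ F n x)
    (hlim : ∀ᵐ x ∂ν, Tendsto (fun n => F n x) atTop (𝓝 (f x))) (hC : ∀ n, ∫ x, F n x ∂ν ≤ C) :
    Integrable f ν ∧ ∫ x, f x ∂ν ≤ C := by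
  have hC0 : 0 ≤ C := (integral_nonneg_of_ae (h0 0)).trans (hC 0)
  have hf0 : ∀ᵐ x ∂ν, 0 ≤ f x := by
    filter_upwards [hlim, ae_all_iff.2 h0] with x hx h
    exact ge_of_tendsto' hx h
  have hfm : AEStronglyMeasurable f ν := aestronglyMeasurable_of_tendsto_ae _ (fun n => (hF n).1) hlim
  have hle : ∫⁻ x, ENNReal.ofReal (f x) ∂ν ≤ ENNReal.ofReal C := by
    calc ∫⁻ x, ENNReal.ofReal (f x) ∂ν
        = ∫⁻ x, liminf (fun n => ENNReal.ofReal (F n x)) atTop ∂ν := by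
          refine lintegral_congr_ae ?_
          filter_upwards [hlim] with x hx
          exact ((ENNReal.continuous_ofReal.tendsto _).comp hx).liminf_eq.symm
      _ ≤ liminf (fun n => ∫⁻ x, ENNReal.ofReal (F n x) ∂ν) atTop :=
          lintegral_liminf_le' fun n => (hF n).aemeasurable.ennreal_ofReal
      _ ≤ ENNReal.ofReal C := by
          refine liminf_le_of_le (by isBoundedDefault) fun b hb => ?_
          obtain ⟨n, hn⟩ := hb.exists
          refine hn.trans ?_
          rw [← ofReal_integral_eq_lintegral_ofReal (hF n) (h0 n)]
          exact ENNReal.ofReal_le_ofReal (hC n)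
  have hfi : Integrable f ν :=
    ⟨hfm, (hasFiniteIntegral_iff_ofReal hf0).2 (hle.trans_lt ofReal_lt_top)⟩
  refine ⟨hfi, ?_⟩
  rw [← ofReal_integral_eq_lintegral_ofReal hfi hf0] at hle
  exact (ENNReal.ofReal_le_ofReal_iff hC0).1 hle

/-- Almost everywhere convergence together with domination off sets of uniformly small integral
gives convergence in `L¹`. -/
lemma tendsto_integral_abs_sub_of_tight {α : Type*} {m : MeasurableSpace α} {ν : Measure α}
    {F : ℕ → α → ℝ} {f : α → ℝ} (hF : ∀ n, Integrable (F n) ν) (h0 : ∀ n, ∀ᵐ x ∂ν, 0 ≤ F n x)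
    (hlim : ∀ᵐ x ∂ν, Tendsto (fun n => F n x) atTop (𝓝 (f x)))
    (htight : ∀ ε, 0 < ε → ∃ A, MeasurableSet A ∧ (∀ n, ∫ x in A, F n x ∂ν ≤ ε) ∧
      ∃ G, IntegrableOn G Aᶜ ν ∧ ∀ n, ∀ᵐ x ∂(ν.restrict Aᶜ), F n x ≤ G x) :
    Integrable f ν ∧ Tendsto (fun n => ∫ x, |F n x - f x| ∂ν) atTop (𝓝 0) := by
  have hcompl : ∀ A, (∃ G, IntegrableOn G Aᶜ ν ∧ ∀ n, ∀ᵐ x ∂(ν.restrict Aᶜ), F n x ≤ G x) →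
      IntegrableOn f Aᶜ ν := by
    rintro A ⟨G, hG, hFG⟩
    refine (integrable_and_integral_le_of_tendsto (fun n => (hF n).integrableOn)
      (fun n => ae_restrict_of_ae (h0 n)) (ae_restrict_of_ae hlim)
      (C := ∫ x in Aᶜ, G x ∂ν) fun n => ?_).1
    exact integral_mono_ae (hF n).integrableOn hG (hFG n)
  have hfi : Integrable f ν := by
    obtain ⟨A, hA, hA1, hA2⟩ := htight 1 one_pos
    rw [← integrableOn_univ, ← union_compl_self A]
    exact IntegrableOn.union (integrable_and_integral_le_of_tendsto
      (fun n => (hF n).integrableOn) (fun n => ae_restrict_of_ae (h0 n)) (ae_restrict_of_ae hlim)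
      hA1).1 (hcompl A hA2)
  refine ⟨hfi, ?_⟩
  rw [Metric.tendsto_nhds]
  intro ε hε
  obtain ⟨A, hA, hA1, G, hG, hFG⟩ := htight (ε / 4) (by positivity)
  have hfA : ∫ x in A, f x ∂ν ≤ ε / 4 :=
    (integrable_and_integral_le_of_tendsto (fun n => (hF n).integrableOn)
      (fun n => ae_restrict_of_ae (h0 n)) (ae_restrict_of_ae hlim) hA1).2
  have hf0 : ∀ᵐ x ∂ν, 0 ≤ f x := by
    filter_upwards [hlim, ae_all_iff.2 h0] with x hx h
    exact ge_of_tendsto' hx h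
  have hfG : ∀ᵐ x ∂(ν.restrict Aᶜ), f x ≤ G x := by
    filter_upwards [ae_restrict_of_ae hlim, ae_all_iff.2 hFG] with x hx h
    exact le_of_tendsto' hx h
  have hdom : Tendsto (fun n => ∫ x in Aᶜ, |F n x - f x| ∂ν) atTop (𝓝 (∫ x in Aᶜ, (0 : ℝ) ∂ν)) := by
    refine tendsto_integral_of_dominated_convergence G
      (fun n => ((hF n).sub hfi).abs.integrableOn.1) hG (fun n => ?_) ?_
    · filter_upwards [hFG n, hfG, ae_restrict_of_ae (h0 n), ae_restrict_of_ae hf0]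
        with x h1 h2 h3 h4
      rw [Real.norm_eq_abs, abs_abs, abs_le]
      constructor <;> linarith
    · filter_upwards [ae_restrict_of_ae hlim] with x hx
      simpa using (hx.sub_const (f x)).abs
  rw [integral_zero] at hdom
  filter_upwards [hdom.eventually (gt_mem_nhds (half_pos hε))] with n hn
  have hsplit := integral_add_compl hA ((hF n).sub hfi).abs
  have hAn : ∫ x in A, |F n x - f x| ∂ν ≤ ∫ x in A, (F n x + f x) ∂ν := by
    refine integral_mono_ae ((hF n).sub hfi).abs.integrableOn
      ((hF n).add hfi).integrableOn ?_
    filter_upwards [ae_restrict_of_ae (h0 n), ae_restrict_of_ae hf0] with x h3 h4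
    rw [abs_le]
    constructor <;> linarith
  rw [integral_add (hF n).integrableOn hfi.integrableOn] at hAn
  rw [Real.dist_eq, sub_zero, abs_of_nonneg (integral_nonneg fun x => abs_nonneg _)]
  simp only [Pi.sub_apply] at hsplit
  have := hA1 n
  linarith

section tight

variable {Ω : Set (Euc N)} {μ : Measure (Euc N)} {ζ V : Euc N → ℝ}

/-- Uniform smallness near the boundary of `F ζ` for solutions of `-Δp = F` dominated by the
potential `V`. -/
lemma IsDefining.exists_small_near_boundary (hζ : IsDefining Ω ζ) (hΩ : IsOpen Ω)
    (hb : Bornology.IsBounded Ω) (hne : (frontier Ω).Nonempty) (i : Fin N) (hμ : MemMrho Ω μ)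
    (hV : IntegrableOn V Ω) (hV0 : ∀ᵐ x ∂(volume.restrict Ω), 0 ≤ V x)
    (hVμ : ∀ φ, TestFun Ω φ → ∫ x in Ω, V x * -(lap φ x) = ∫ x, φ x ∂μ) {ε : ℝ} (hε : 0 < ε) :
    ∃ δ, 0 < δ ∧ ∀ p F, HSol Ω p F → (∀ x, 0 ≤ F x) →
      (∀ᵐ x ∂(volume.restrict Ω), p x ≤ V x) →
      ∫ x in Ω ∩ {x | ζ x < δ}, F x * ζ x ≤ ε := by
  have hζc := hζ.contDiff.continuous
  obtain ⟨M, hM0, hM⟩ := exists_bound_on hb (continuous_lap hζ.contDiff)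
  have hζμ := hζ.testFun.integrable_of_memMrho hb hne hμ
  set δ : ℕ → ℝ := fun k => 1 / ((k : ℝ) + 1) with hδdef
  have hδ : ∀ k, 0 < δ k := fun k => by positivity
  have hδ0 : Tendsto δ atTop (𝓝 0) := tendsto_one_div_add_atTop_nhds_zero_nat
  have hqc : ∀ k, Continuous fun x => max (1 - ζ x / δ k) 0 ^ 2 := fun k =>
    ((continuous_const.sub (hζc.div_const _)).max continuous_const).pow 2
  have h1 : Tendsto (fun k => ∫ x, capAt (δ k) (ζ x) ∂μ) atTop (𝓝 (∫ _, (0 : ℝ) ∂μ)) := by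
    refine tendsto_integral_of_dominated_convergence (fun x => 3 * ζ x)
      (fun k => (hζ.testFun_capAt _).continuous.aestronglyMeasurable) (hζμ.const_mul 3)
      (fun k => ?_) ?_
    · filter_upwards [hμ.ae_mem] with x hx
      rw [Real.norm_of_nonneg (capAt_nonneg (hδ k) (hζ.pos x hx).le)]
      exact capAt_le_mul (hδ k) (hζ.pos x hx).le
    · filter_upwards [hμ.ae_mem] with x hx
      exact squeeze_zero (fun k => capAt_nonneg (hδ k) (hζ.pos x hx).le)
        (fun k => capAt_le (hδ k) _) hδ0
  have h2 : Tendsto (fun k => ∫ x in Ω, V x * max (1 - ζ x / δ k) 0 ^ 2) atTop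
      (𝓝 (∫ _ in Ω, (0 : ℝ))) := by
    refine tendsto_integral_of_dominated_convergence V
      (fun k => (integrableOn_mul_continuous hΩ hb hV (hqc k)).1) hV (fun k => ?_) ?_
    · filter_upwards [ae_restrict_mem hΩ.measurableSet, hV0] with x hx hvx
      obtain ⟨a, b⟩ := posPart_one_sub_div_mem (hδ k) (hζ.pos x hx).le
      rw [Real.norm_of_nonneg (mul_nonneg hvx (by positivity))]
      exact mul_le_of_le_one_right hvx (pow_le_one₀ a b)
    · filter_upwards [ae_restrict_mem hΩ.measurableSet] with x hx
      refine tendsto_const_nhds.congr' ?_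
      filter_upwards [hδ0.eventually (gt_mem_nhds (hζ.pos x hx))] with k hk
      rw [max_eq_right]
      · simp
      · rw [sub_nonpos, one_le_div (hδ k)]
        exact hk.le
  rw [integral_zero] at h1 h2
  have h3 := h1.add (h2.const_mul (6 * M))
  rw [mul_zero, add_zero] at h3
  obtain ⟨k, hk⟩ := (h3.eventually (gt_mem_nhds hε)).exists
  refine ⟨δ k, hδ k, fun p F hp hF hpV => ?_⟩
  have hFi : IntegrableOn F Ω := by
    have : IsFiniteMeasure (volume.restrict Ω) := ⟨by simpa using hb.measure_lt_top⟩
    exact (hp.1.restrict Ω).integrable (by norm_num)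
  have hpi := hp.integrableOn hb
  have hp0 := hp.nonneg hb i (Eventually.of_forall hF)
  have hT := hζ.testFun_capAt (δ k)
  have hS : MeasurableSet {x | ζ x < δ k} := (isOpen_lt hζc continuous_const).measurableSet
  have hcapi := integrableOn_mul_continuous hΩ hb hFi hT.continuous
  have hlapc : Continuous fun x => -(lap (fun y => capAt (δ k) (ζ y)) x) :=
    (continuous_lap hT.1).neg
  have hVi := integrableOn_mul_continuous hΩ hb hV hlapc
  have hVq := integrableOn_mul_continuous hΩ hb hV (hqc k)
  calc ∫ x in Ω ∩ {x | ζ x < δ k}, F x * ζ x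
      ≤ ∫ x in Ω ∩ {x | ζ x < δ k}, F x * capAt (δ k) (ζ x) := by
        refine setIntegral_mono_on
          ((integrableOn_mul_continuous hΩ hb hFi hζc).mono_set inter_subset_left)
          (hcapi.mono_set inter_subset_left) (hΩ.measurableSet.inter hS) fun x hx => ?_
        exact mul_le_mul_of_nonneg_left (le_capAt (hδ k) (hζ.pos x hx.1).le hx.2.le) (hF x)
    _ ≤ ∫ x in Ω, F x * capAt (δ k) (ζ x) := by
        refine setIntegral_mono_set hcapi ?_ (LE.le.eventuallyLE inter_subset_left)
        filter_upwards [ae_restrict_mem hΩ.measurableSet] with x hx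
        exact mul_nonneg (hF x) (capAt_nonneg (hδ k) (hζ.pos x hx).le)
    _ = ∫ x in Ω, p x * -(lap (fun y => capAt (δ k) (ζ y)) x) :=
        (hp.integral_mul_neg_lap hΩ hb i hT).symm
    _ ≤ ∫ x in Ω, (V x * -(lap (fun y => capAt (δ k) (ζ y)) x) +
          6 * M * (V x * max (1 - ζ x / δ k) 0 ^ 2)) := by
        refine integral_mono_ae (integrableOn_mul_continuous hΩ hb hpi hlapc)
          (hVi.add (hVq.const_mul _)) ?_
        filter_upwards [ae_restrict_mem hΩ.measurableSet, hpV, ae_restrict_of_ae hp0]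
          with x hx hpx hpx0
        rw [lap_capAt (hδ k) hζ.contDiff]
        obtain ⟨a, -⟩ := posPart_one_sub_div_mem (hδ k) (hζ.pos x hx).le
        set q := max (1 - ζ x / δ k) 0
        have hQ : 0 ≤ 6 / δ k * q * ‖gradient ζ x‖ ^ 2 := by have := hδ k; positivity
        set Q := 6 / δ k * q * ‖gradient ζ x‖ ^ 2 with hQdef
        have hlap := abs_le.1 (hM x hx)
        have hq2 : 0 ≤ q ^ 2 := by positivity
        have e : -(-(6 / δ k) * q * ‖gradient ζ x‖ ^ 2 + 3 * q ^ 2 * lap ζ x)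
            = Q - 3 * q ^ 2 * lap ζ x := by rw [hQdef]; ring
        rw [e]
        have hl1 : -(3 * q ^ 2 * lap ζ x) ≤ 3 * q ^ 2 * M := by nlinarith
        have hl2 : 3 * q ^ 2 * lap ζ x ≤ 3 * q ^ 2 * M := by nlinarith
        calc p x * (Q - 3 * q ^ 2 * lap ζ x) ≤ p x * (Q + 3 * q ^ 2 * M) :=
              mul_le_mul_of_nonneg_left (by linarith) hpx0
          _ ≤ V x * (Q + 3 * q ^ 2 * M) := mul_le_mul_of_nonneg_right hpx (by positivity)
          _ ≤ V x * (Q - 3 * q ^ 2 * lap ζ x + 6 * M * q ^ 2) :=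
              mul_le_mul_of_nonneg_left (by linarith) (hpx0.trans hpx)
          _ = _ := by ring
    _ = ∫ x, capAt (δ k) (ζ x) ∂μ + 6 * M * ∫ x in Ω, V x * max (1 - ζ x / δ k) 0 ^ 2 := by
        rw [integral_add hVi (hVq.const_mul _), integral_const_mul, hVμ _ hT]
    _ ≤ ε := hk.le

end tight

/-- The truncation of `g` to the values on `[0, n]`. -/
def trunc (g : ℝ → ℝ) (n : ℕ) (t : ℝ) : ℝ := g (max (min t n) 0)

section trunc

variable {g : ℝ → ℝ}

lemma MemG.continuous_trunc (hg : MemG g) (n : ℕ) : Continuous (trunc g n) :=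
  hg.1.comp ((continuous_id.min continuous_const).max continuous_const)

lemma MemG.trunc_nonneg (hg : MemG g) (n : ℕ) (t : ℝ) : 0 ≤ trunc g n t :=
  hg.nonneg (le_max_right _ _)

lemma MemG.trunc_le (hg : MemG g) (n : ℕ) (t : ℝ) : trunc g n t ≤ g n :=
  hg.2.1 (max_le (min_le_right _ _) n.cast_nonneg)

lemma MemG.trunc_eq_zero (hg : MemG g) (n : ℕ) {t : ℝ} (ht : t ≤ 0) : trunc g n t = 0 := by
  rw [trunc, max_eq_right ((min_le_left _ _).trans ht), hg.zero]

lemma MemG.trunc_mono (hg : MemG g) {m n : ℕ} (hmn : m ≤ n) {s t : ℝ} (hst : s ≤ t) :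
    trunc g m s ≤ trunc g n t :=
  hg.2.1 (max_le_max_right _ (min_le_min hst (Nat.cast_le.2 hmn)))

lemma trunc_eq {n : ℕ} {t : ℝ} (ht : 0 ≤ t) (htn : t ≤ n) : trunc g n t = g t := by
  rw [trunc, min_eq_left htn, max_eq_left ht]

lemma MemG.trunc_le_apply (hg : MemG g) (n : ℕ) {t : ℝ} (ht : 0 ≤ t) : trunc g n t ≤ g t :=
  hg.2.1 (max_le (min_le_left _ _) ht)

lemma MemG.exists_lipschitz_trunc (hg : MemG g) (n : ℕ) :
    ∃ L, ∀ s t, |trunc g n s - trunc g n t| ≤ L * |s - t| := by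
  have hd : Continuous (deriv (absFun g)) := hg.2.2.2.1.continuous_deriv le_rfl
  obtain ⟨L, hL⟩ := isCompact_Icc.exists_bound_of_continuousOn (s := Icc 0 (n : ℝ)) hd.continuousOn
  refine ⟨max L 0, fun s t => ?_⟩
  have hmem : ∀ s : ℝ, max (min s n) 0 ∈ Icc 0 (n : ℝ) := fun s =>
    ⟨le_max_right _ _, max_le (min_le_right _ _) n.cast_nonneg⟩
  have h1 := (convex_Icc 0 (n : ℝ)).norm_image_sub_le_of_norm_deriv_le (f := absFun g)
    (fun x _ => (hg.2.2.2.1.differentiable one_ne_zero) x) hL (hmem t) (hmem s)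
  rw [hg.absFun_eq, hg.absFun_eq, abs_of_nonneg (hmem s).1, abs_of_nonneg (hmem t).1] at h1
  refine h1.trans (mul_le_mul (le_max_left _ _) ?_ (norm_nonneg _) (le_max_right _ _))
  refine (abs_max_sub_max_le_abs _ _ _).trans ((abs_min_sub_min_le_max _ _ _ _).trans ?_)
  simp

lemma MemG.tendsto_trunc (hg : MemG g) {t : ℕ → ℝ} {T B : ℝ} (ht : Tendsto t atTop (𝓝 T))
    (h0 : ∀ n, 0 ≤ t n) (hB : ∀ n, t n ≤ B) :
    Tendsto (fun n => trunc g n (t n)) atTop (𝓝 (g T)) := by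
  refine ((hg.1.tendsto T).comp ht).congr' ?_
  filter_upwards [eventually_ge_atTop ⌈B⌉₊] with n hn
  exact (trunc_eq (h0 n) ((hB n).trans (Nat.ceil_le.1 hn))).symm

end trunc

section truncated

variable {Ω : Set (Euc N)} {g : ℝ → ℝ}

lemma MemG.memLp_trunc (hg : MemG g) (hΩ : IsOpen Ω) (hb : Bornology.IsBounded Ω) (n : ℕ)
    {a : Euc N → ℝ} (ha : AEStronglyMeasurable a volume) (h0 : ∀ᵐ x, x ∉ Ω → a x = 0) :
    MemLp (fun x => trunc g n (a x)) 2 volume := by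
  refine memLp_two_of_bounded hΩ hb ((hg.continuous_trunc n).comp_aestronglyMeasurable ha) (g n)
    (fun x => ?_) ?_
  · rw [abs_of_nonneg (hg.trunc_nonneg n _)]
    exact hg.trunc_le n _
  · filter_upwards [h0] with x hx hxΩ
    exact hg.trunc_eq_zero n (hx hxΩ).le

lemma HSol.exists_trunc (hg : MemG g) (hΩ : IsOpen Ω) (hb : Bornology.IsBounded Ω) (i : Fin N)
    (n : ℕ) {v f : Euc N → ℝ} (hv : HSol Ω v f) :
    ∃ p, HSol Ω p (fun x => trunc g n (v x - p x)) := by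
  obtain ⟨R, hR⟩ := hb.subset_closedBall 0
  obtain ⟨L, hL⟩ := hg.exists_lipschitz_trunc n
  obtain ⟨p, P, hp, hP⟩ := exists_memH_solution (Ω := Ω) (R := R)
    (fun x hx => by simpa using hR hx) i (G := fun x q => trunc g n (v x - q)) (L := L)
    (fun a ha => (hg.continuous_trunc n).comp_aestronglyMeasurable (hv.memLp.1.sub ha))
    (fun x s t => by
      refine (hL _ _).trans_eq ?_
      rw [abs_sub_comm s t]
      ring_nf)
    (fun x s t hst => hg.trunc_mono le_rfl (by linarith))
    (by simpa using hg.memLp_trunc hΩ hb n hv.memLp.1 hv.ae_eq_zero)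
  refine ⟨p, hg.memLp_trunc hΩ hb n (hv.memLp.1.sub hp.1.1) ?_, P, hp, hP⟩
  filter_upwards [hv.ae_eq_zero, hp.ae_eq_zero] with x h1 h2 hx
  simp [h1 hx, (h2 hx).1]

lemma isCompact_diff_of_isDefining {ζ : Euc N → ℝ} (hζ : IsDefining Ω ζ)
    (hΩ : IsOpen Ω) (hb : Bornology.IsBounded Ω) {δ : ℝ} (hδ : 0 < δ) :
    IsCompact (Ω ∩ {x | δ ≤ ζ x}) := by
  have h1 : Ω ∩ {x | δ ≤ ζ x} = closure Ω ∩ {x | δ ≤ ζ x} := by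
    refine Subset.antisymm (inter_subset_inter_left _ subset_closure) fun x hx => ⟨?_, hx.2⟩
    by_contra hxΩ
    have h2 := hζ.eq_zero x (by rw [hΩ.frontier_eq]; exact ⟨hx.1, hxΩ⟩)
    have h3 : δ ≤ ζ x := hx.2
    linarith
  rw [h1]
  exact hb.isCompact_closure.inter_right (isClosed_le continuous_const hζ.contDiff.continuous)

end truncated

lemma exists_isWeakSol_of_isEmpty [IsEmpty (Fin N)] {Ω : Set (Euc N)} (hne : Ω.Nonempty)
    {g : ℝ → ℝ} (hg : MemG g) {μ : Measure (Euc N)} {w : Euc N → ℝ} (hw : IsGreenPot Ω μ 0 w) :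
    ∃ u : Euc N → ℝ, IsWeakSol Ω g μ 0 u := by
  have hΩ : Ω = univ := Subsingleton.eq_univ_of_nonempty hne
  have hT : TestFun Ω fun _ => (1 : ℝ) := ⟨contDiff_const, by simp [hΩ]⟩
  obtain ⟨h1, -, h2⟩ := hw.2 _ hT
  have hμ : μ = 0 := by
    have hfin : IsFiniteMeasure μ := by
      rcases (integrable_const_iff (μ := μ) (c := (1 : ℝ))).1 h1 with h | h
      · exact absurd h one_ne_zero
      · exact h
    simpa [lap, Measure.real, ENNReal.toReal_eq_zero_iff] using h2.symm
  subst hμ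
  refine ⟨0, integrableOn_zero, ?_, fun φ hφ => ⟨integrable_zero_measure,
    integrable_zero_measure, ?_⟩⟩
  · simp [hg.zero]
  · simp [hg.zero]

lemma exists_isWeakSol {Ω : Set (Euc N)} (i : Fin N) (hΩ : IsBoundedC2Domain Ω) {g : ℝ → ℝ}
    (hg : MemG g) (hΔ : DeltaTwo (absFun g)) {μ : Measure (Euc N)} (hμ : MemMrho Ω μ)
    {w : Euc N → ℝ} (hw : IsGreenPot Ω μ 0 w) (hwloc : MemOrliczLoc (absFun g) Ω w) :
    ∃ u : Euc N → ℝ, IsWeakSol Ω g μ 0 u := by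
  obtain ⟨ζ, hζ⟩ := exists_isDefining hΩ
  obtain ⟨hO, hconn, hb, -⟩ := hΩ
  have hne := frontier_nonempty hb hconn.nonempty i
  have hζc := hζ.contDiff.continuous
  have hΩm := hO.measurableSet
  obtain ⟨f, v, V, hv, hf, hvmono, hV, hvV, hVμ⟩ := exists_monotone_potential hO hb hne i hζ hμ
  have hV0 : ∀ᵐ x ∂(volume.restrict Ω), 0 ≤ V x := by
    filter_upwards [hvV] with x hx using (hx.1 0).1.trans (hx.1 0).2
  have hgV : ∀ K, IsCompact K → K ⊆ Ω → IntegrableOn (fun x => g (V x)) K := fun K hK hKΩ =>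
    integrableOn_comp_of_memOrliczLoc hO hg hΔ hV hV0 hw.1
      (fun φ hφ => by rw [hVμ φ hφ, (hw.2 φ hφ).2.2]; simp) hb hwloc hK hKΩ
  -- solutions of the problems with truncated nonlinearity
  choose p hp using fun n => HSol.exists_trunc hg hO hb i n (hv n)
  have hp0 : ∀ n, ∀ᵐ x, 0 ≤ p n x := fun n =>
    (hp n).nonneg hb i (Eventually.of_forall fun x => hg.trunc_nonneg n _)
  have hpv : ∀ n, ∀ᵐ x, p n x ≤ v n x := fun n => by
    refine (hp n).le_of_le hb i (hv n) ?_
    filter_upwards [hf n] with x hx hlt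
    rwa [hg.trunc_eq_zero n (by linarith)]
  have hpmono : ∀ n, ∀ᵐ x, p n x ≤ p (n + 1) x := fun n => by
    refine (hp n).le_of_le hb i (hp (n + 1)) ?_
    filter_upwards [hvmono n] with x hx hlt
    exact hg.trunc_mono n.le_succ (by linarith)
  have hpV : ∀ n, ∀ᵐ x ∂(volume.restrict Ω), p n x ≤ V x := fun n => by
    filter_upwards [ae_restrict_of_ae (hpv n), hvV] with x h1 h2 using h1.trans (h2.1 n).2
  obtain ⟨P, hP, hpP⟩ := exists_integrable_limit_of_monotone (ν := volume.restrict Ω)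
    (fun n => (hp n).integrableOn hb) (fun n => ae_restrict_of_ae (hp0 n))
    (fun n => ae_restrict_of_ae (hpmono n)) (C := ∫ x in Ω, V x)
    (fun n => integral_mono_ae ((hp n).integrableOn hb) hV (hpV n))
  set γ : ℕ → Euc N → ℝ := fun n x => trunc g n (v n x - p n x) with hγ
  have hγ0 : ∀ n x, 0 ≤ γ n x := fun n x => hg.trunc_nonneg n _
  have hγi : ∀ n, IntegrableOn (γ n) Ω := fun n => by
    have : IsFiniteMeasure (volume.restrict Ω) := ⟨by simpa using hb.measure_lt_top⟩
    exact ((hp n).1.restrict Ω).integrable (by norm_num)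
  set u : Euc N → ℝ := fun x => V x - P x with hu
  have hui : IntegrableOn u Ω := hV.sub hP
  have hlim : ∀ᵐ x ∂(volume.restrict Ω), 0 ≤ u x ∧ (∀ n, γ n x ≤ g (V x)) ∧
      Tendsto (fun n => γ n x) atTop (𝓝 (g (u x))) := by
    filter_upwards [hvV, hpP, ae_restrict_of_ae (ae_all_iff.2 hpv)] with x h1 h2 h3
    have hlim' : Tendsto (fun n => v n x - p n x) atTop (𝓝 (u x)) := h1.2.sub h2.2
    have hnn : ∀ n, 0 ≤ v n x - p n x := fun n => sub_nonneg.2 (h3 n)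
    have hleV : ∀ n, v n x - p n x ≤ V x := fun n => by
      linarith [(h1.1 n).2, (h2.1 n).1]
    exact ⟨ge_of_tendsto' hlim' hnn,
      fun n => (hg.trunc_le_apply n (hnn n)).trans (hg.2.1 (hleV n)),
      hg.tendsto_trunc hlim' hnn hleV⟩
  obtain ⟨M, -, hM⟩ := exists_bound_on hb hζc
  obtain ⟨hgu, hL1⟩ := tendsto_integral_abs_sub_of_tight (ν := volume.restrict Ω)
    (F := fun n x => γ n x * ζ x) (f := fun x => g (u x) * ζ x)
    (fun n => integrableOn_mul_continuous hO hb (hγi n) hζc)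
    (fun n => by
      filter_upwards [ae_restrict_mem hΩm] with x hx
      exact mul_nonneg (hγ0 n x) (hζ.pos x hx).le)
    (by filter_upwards [hlim] with x hx using hx.2.2.mul_const _)
    (fun ε hε => by
      obtain ⟨δ, hδ, hsmall⟩ := hζ.exists_small_near_boundary hO hb hne i hμ hV hV0 hVμ hε
      have hA : MeasurableSet {x | ζ x < δ} := (isOpen_lt hζc continuous_const).measurableSet
      have hcompl : {x | ζ x < δ}ᶜ ∩ Ω = Ω ∩ {x | δ ≤ ζ x} := by
        ext x
        simp [and_comm]
      refine ⟨{x | ζ x < δ}, hA, fun n => ?_, fun x => g (V x) * M, ?_, fun n => ?_⟩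
      · rw [Measure.restrict_restrict hA, inter_comm]
        exact hsmall _ _ (hp n) (hγ0 n) (hpV n)
      · rw [IntegrableOn, Measure.restrict_restrict hA.compl, hcompl]
        exact (hgV _ (isCompact_diff_of_isDefining hζ hO hb hδ) inter_subset_left).mul_const M
      · filter_upwards [ae_restrict_of_ae hlim, ae_restrict_of_ae hV0,
          ae_restrict_of_ae (ae_restrict_mem hΩm)] with x h1 h2 h3
        exact mul_le_mul (h1.2.1 n) ((le_abs_self _).trans (hM x h3)) (hζ.pos x h3).le
          (hg.nonneg h2))
  have hgum : AEStronglyMeasurable (fun x => g (u x)) (volume.restrict Ω) :=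
    hg.1.comp_aestronglyMeasurable hui.1
  refine ⟨u, hui, ?_, fun φ hφ => ⟨hφ.integrable_of_memMrho hb hne hμ, integrable_zero_measure, ?_⟩⟩
  · obtain ⟨C, hC0, hC⟩ := hζ.exists_rho_le hO hb hne
    refine (hgu.const_mul C).mono' ((hg.1.comp_aestronglyMeasurable
      (continuous_abs.comp_aestronglyMeasurable hui.1)).mul
      (continuous_rho Ω).aestronglyMeasurable) ?_
    filter_upwards [hlim, ae_restrict_mem hΩm] with x hx hxΩ
    rw [abs_of_nonneg hx.1, Real.norm_of_nonneg (mul_nonneg (hg.nonneg hx.1) (rho_nonneg Ω x))]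
    calc g (u x) * rho Ω x ≤ g (u x) * (C * ζ x) :=
          mul_le_mul_of_nonneg_left (hC x hxΩ) (hg.nonneg hx.1)
      _ = C * (g (u x) * ζ x) := by ring
  · obtain ⟨C₁, hC₁, hφρ⟩ := hφ.abs_le_rho hb hne
    obtain ⟨C₂, hC₂, hρζ⟩ := hζ.exists_rho_le hO hb hne
    have hφζ : ∀ x ∈ Ω, |φ x| ≤ C₁ * C₂ * ζ x := fun x hx => (hφρ x hx).trans
      ((mul_le_mul_of_nonneg_left (hρζ x hx) hC₁).trans_eq (by ring))
    have hguφ : IntegrableOn (fun x => g (u x) * φ x) Ω := by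
      refine (hgu.const_mul (C₁ * C₂)).mono' (hgum.mul hφ.continuous.aestronglyMeasurable) ?_
      filter_upwards [hlim, ae_restrict_mem hΩm] with x hx hxΩ
      rw [norm_mul, Real.norm_of_nonneg (hg.nonneg hx.1)]
      exact (mul_le_mul_of_nonneg_left (hφζ x hxΩ) (hg.nonneg hx.1)).trans_eq (by ring)
    have hγφ : ∀ n, IntegrableOn (fun x => γ n x * φ x) Ω := fun n =>
      integrableOn_mul_continuous hO hb (hγi n) hφ.continuous
    have hlim₁ : Tendsto (fun n => ∫ x in Ω, γ n x * φ x) atTop (𝓝 (∫ x in Ω, g (u x) * φ x)) := by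
      rw [tendsto_iff_dist_tendsto_zero]
      refine squeeze_zero (fun _ => dist_nonneg) (fun n => ?_)
        (by simpa using hL1.const_mul (C₁ * C₂))
      rw [Real.dist_eq, ← integral_sub (hγφ n) hguφ, ← integral_const_mul, ← Real.norm_eq_abs]
      refine norm_integral_le_of_norm_le
        (((integrableOn_mul_continuous hO hb (hγi n) hζc).sub hgu).abs.const_mul _) ?_
      filter_upwards [ae_restrict_mem hΩm] with x hx
      rw [← sub_mul, ← sub_mul, norm_mul, abs_mul, abs_of_pos (hζ.pos x hx), Real.norm_eq_abs]
      exact (mul_le_mul_of_nonneg_left (hφζ x hx) (abs_nonneg _)).trans_eq (by ring)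
    have hlapc : Continuous fun x => -(lap φ x) := (continuous_lap hφ.1).neg
    have hlim₂ : Tendsto (fun n => ∫ x in Ω, p n x * -(lap φ x)) atTop
        (𝓝 (∫ x in Ω, P x * -(lap φ x))) := by
      refine tendsto_integral_of_dominated_convergence (fun x => ‖P x * -(lap φ x)‖)
        (fun n => (integrableOn_mul_continuous hO hb ((hp n).integrableOn hb) hlapc).1)
        (integrableOn_mul_continuous hO hb hP hlapc).norm (fun n => ?_) ?_
      · filter_upwards [hpP] with x hx
        rw [norm_mul, norm_mul, Real.norm_of_nonneg (hx.1 n).1]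
        exact mul_le_mul_of_nonneg_right ((hx.1 n).2.trans (le_abs_self _)) (norm_nonneg _)
      · filter_upwards [hpP] with x hx using hx.2.mul_const _
    have hPeq : ∫ x in Ω, P x * -(lap φ x) = ∫ x in Ω, g (u x) * φ x := by
      refine tendsto_nhds_unique hlim₂ (hlim₁.congr fun n => ?_)
      exact ((hp n).integral_mul_neg_lap hO hb i hφ).symm
    have e : ∀ x, -(u x) * lap φ x + g (u x) * φ x =
        V x * -(lap φ x) - P x * -(lap φ x) + g (u x) * φ x := fun x => by
      simp only [hu]
      ring
    simp_rw [e]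
    have hVP : IntegrableOn (fun x => V x * -(lap φ x) - P x * -(lap φ x)) Ω :=
      (integrableOn_mul_continuous hO hb hV hlapc).sub (integrableOn_mul_continuous hO hb hP hlapc)
    rw [integral_add hVP hguφ, integral_sub (integrableOn_mul_continuous hO hb hV hlapc)
      (integrableOn_mul_continuous hO hb hP hlapc), hPeq, hVμ φ hφ, integral_zero_measure]
    ring

/-- If `g ∈ 𝒢₂` and `μ ∈ 𝔐_ρ(Ω)` is a positive measure whose Green
potential `𝔾_μ` belongs to `L^g_loc(Ω)`, then `μ` is `g`-good. -/
theorem good_of_green_potential_loc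
    {N : ℕ} (Ω : Set (Euc N)) (hΩ : IsBoundedC2Domain Ω)
    (g : ℝ → ℝ) (hg : MemG2 g)
    (μ : Measure (Euc N)) (hμ : MemMrho Ω μ)
    (w : Euc N → ℝ) (hw : IsGreenPot Ω μ 0 w)
    (hwloc : MemOrliczLoc (absFun g) Ω w) :
    ∃ u : Euc N → ℝ, IsWeakSol Ω g μ 0 u := by
  rcases isEmpty_or_nonempty (Fin N) with _ | ⟨⟨i⟩⟩
  · exact exists_isWeakSol_of_isEmpty hΩ.2.1.nonempty hg.1 hw
  · exact exists_isWeakSol i hΩ hg.1 hg.2.1 hμ hw hwloc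

end
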